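/- arXiv:1901.02071 — 3 statements merged into one kernel-verified Lean document; each statement's English description precedes it below -/
import Mathlib

section
/- Let N ≥ 3, F_N = FreeGroup (Fin N), and let Φ be an automorphism of F_N with π ∘ Φ = π (the mod-3 abelianization condition for IA_N(Z/3)). Suppose A is a co-rank 1 free factor of F_N with Φ(A) = A and the restriction Φ|_A is atoroidal. Then either Φ is atoroidal, or there exists a nontrivial element g ∈ F_N which is not a proper power such that: (i) Φ(g) is conjugate to g; (ii) for every nontrivial h ∈ F_N, if Φ^n(h) is conjugate to h for some n ≥ 1, then h is conjugate to a nonzero power of g; and (iii) there is an element g' conjugate to g such that F_N is the internal free product of A and the cyclic subgroup generated by g'. -/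
/-- An automorphism `Φ` is atoroidal if no positive power of `Φ` maps a nontrivial
element to a conjugate of itself. -/
def MulAut.Atoroidal {G : Type*} [Group G] (Φ : MulAut G) : Prop :=
  ∀ n : ℕ, 1 ≤ n → ∀ g : G, g ≠ 1 → ¬ IsConj ((Φ ^ n) g) g

/-- The mod-3 abelianization `F_N → (ℤ/3)^N`, sending the `i`-th free generator to
the `i`-th standard basis vector. -/
def piMod3 (N : ℕ) : FreeGroup (Fin N) →* Multiplicative (Fin N → ZMod 3) :=
  FreeGroup.lift fun i => Multiplicative.ofAdd (Pi.single i 1)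

/-- `A` is a co-rank `1` free factor of `F` if `F` is the internal free product of
`A` and an infinite cyclic subgroup. -/
def IsCorankOneFreeFactor {F : Type*} [Group F] (A : Subgroup F) : Prop :=
  ∃ g : F, ¬ IsOfFinOrder g ∧
    Function.Bijective ⇑(Monoid.Coprod.lift A.subtype (Subgroup.zpowers g).subtype)

/-- The restriction of `Φ` to the invariant subgroup `A` is atoroidal: no positive
power of `Φ` maps a nontrivial element of `A` to a conjugate of itself by an
element of `A`. -/
def RestrictionAtoroidal {F : Type*} [Group F] (Φ : MulAut F) (A : Subgroup F) : Prop :=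
  ∀ n : ℕ, 1 ≤ n → ∀ a ∈ A, a ≠ 1 → ¬ ∃ b ∈ A, b * (Φ ^ n) a * b⁻¹ = a


namespace CorankOne

open HNNExtension

variable {G F : Type*} [Group G] [Group F]

/-- The free product of `G` and `ℤ`, realised as a trivial HNN extension. -/
abbrev HN (G : Type*) [Group G] := HNNExtension G (⊥ : Subgroup G) ⊥ (MulEquiv.refl _)

/-- the canonical map from the free product -/
def hl (i : G →* F) (t : F) : HN G →* F :=
  HNNExtension.lift i t (by
    rintro ⟨a, ha⟩
    have : a = 1 := by simpa using ha
    subst this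
    simp)

@[simp] theorem hl_of (i : G →* F) (t : F) (g : G) : hl i t (of g) = i g := by simp [hl]
@[simp] theorem hl_t (i : G →* F) (t : F) : hl i t HNNExtension.t = t := by simp [hl]

/-- `F` is the free product of the image of `i` and `⟨t⟩`. -/
def FP (i : G →* F) (t : F) : Prop := Function.Bijective (hl i t)

/-- product of a word -/
def P (i : G →* F) (t : F) (l : List (ℤˣ × G)) : F :=
  (l.map fun x => t ^ (x.1 : ℤ) * i x.2).prod

/-- no cancellation between adjacent letters -/
def R (a b : ℤˣ × G) : Prop := a.2 = 1 → a.1 = b.1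

variable {i : G →* F} {t : F}

@[simp] theorem P_nil : P i t [] = 1 := rfl
@[simp] theorem P_cons (x : ℤˣ × G) (l) : P i t (x :: l) = t ^ (x.1 : ℤ) * i x.2 * P i t l := by
  simp [P]
@[simp] theorem P_append (l l' : List (ℤˣ × G)) : P i t (l ++ l') = P i t l * P i t l' := by
  simp [P]

theorem exists_rep (h : FP i t) (f : F) : ∃ g l, List.IsChain R l ∧ f = i g * P i t l := by
  obtain ⟨x, rfl⟩ := h.2 f
  obtain ⟨d⟩ := HNNExtension.NormalWord.TransversalPair.nonempty G ⊥ ⊥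
  let w := (HNNExtension.NormalWord.equiv (MulEquiv.refl _) d) x
  have hw : w.prod (MulEquiv.refl _) = x :=
    (HNNExtension.NormalWord.equiv (MulEquiv.refl _) d).symm_apply_apply x
  refine ⟨w.head, w.toList, ?_, ?_⟩
  · refine w.chain.imp ?_
    intro a b hab h1
    apply hab
    rw [h1]; exact one_mem _
  · conv_lhs => rw [← hw]
    simp [HNNExtension.NormalWord.ReducedWord.prod, P, map_list_prod, Function.comp_def]

theorem toSub (u : ℤˣ) : HNNExtension.toSubgroup (⊥ : Subgroup G) ⊥ u = ⊥ := by
  rcases Int.units_eq_one_or u with rfl | rfl <;> rfl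

theorem rep_unique (h : FP i t) : ∀ (l l' : List (ℤˣ × G)) (g g' : G), List.IsChain R l →
    List.IsChain R l' →
    i g * P i t l = i g' * P i t l' → g = g' ∧ l = l' := by
  have key : ∀ (l l' : List (ℤˣ × G)) (g g' : G), List.IsChain R l →
    List.IsChain R l' → i g * P i t l = i g' * P i t l' →
      l.map Prod.fst = l'.map Prod.fst ∧ g = g' := by
    intro l l' g g' hl1 hl2 he
    let w₁ : HNNExtension.NormalWord.ReducedWord G ⊥ ⊥ := ⟨g, l, by
      refine hl1.imp ?_
      intro a b hab h1
      rw [toSub] at h1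
      exact hab (by simpa using h1)⟩
    let w₂ : HNNExtension.NormalWord.ReducedWord G ⊥ ⊥ := ⟨g', l', by
      refine hl2.imp ?_
      intro a b hab h1
      rw [toSub] at h1
      exact hab (by simpa using h1)⟩
    have hp : w₁.prod (MulEquiv.refl _) = w₂.prod (MulEquiv.refl _) := by
      apply h.1
      simpa [HNNExtension.NormalWord.ReducedWord.prod, P, map_list_prod, Function.comp_def, w₁, w₂]
        using he
    obtain ⟨h1, h2⟩ := HNNExtension.ReducedWord.map_fst_eq_and_of_prod_eq _ hp
    refine ⟨h1, ?_⟩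
    rcases l with _ | ⟨x, l⟩
    · have : l' = [] := by simpa [w₁, w₂] using h1.symm
      subst this
      have he' : hl i t (of g) = hl i t (of g') := by simpa using he
      exact HNNExtension.of_injective _ (h.1 he')
    · have := h2 x.1 (by simp [w₁])
      rw [toSub] at this
      have h3 : g⁻¹ * g' = 1 := by simpa [w₁, w₂] using this
      exact inv_mul_eq_one.1 h3
  intro l
  induction l with
  | nil =>
    intro l' g g' h1 h2 he
    obtain ⟨h3, h4⟩ := key _ _ _ _ h1 h2 he
    exact ⟨h4, by simpa using h3.symm⟩
  | cons x l ih =>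
    intro l' g g' h1 h2 he
    obtain ⟨h3, h4⟩ := key _ _ _ _ h1 h2 he
    refine ⟨h4, ?_⟩
    rcases l' with _ | ⟨y, l'⟩
    · simp at h3
    · subst h4
      simp only [List.map_cons, List.cons.injEq] at h3
      rw [P_cons, P_cons, h3.1] at he
      simp only [mul_assoc, mul_right_inj] at he
      obtain ⟨h5, h6⟩ := ih l' x.2 y.2 h1.tail h2.tail he
      rw [h6, Prod.ext h3.1 h5]

theorem inj (h : FP i t) : Function.Injective i := by
  intro a b hab
  exact (rep_unique h [] [] a b (by simp) (by simp) (by simpa using hab)).1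

theorem FP.mul {a b : G} (h : FP i t) : FP i (i a * t * i b) := by
  let ψ : G → G → HN G →* HN G := fun a b => hl of (of a * HNNExtension.t * of b)
  have hc : ∀ a b, (ψ a⁻¹ b⁻¹).comp (ψ a b) = MonoidHom.id _ := by
    intro a b
    apply HNNExtension.hom_ext
    · ext g; simp [ψ]
    · simp [ψ, mul_assoc]
  have hb : Function.Bijective (ψ a b) := by
    constructor
    · exact Function.LeftInverse.injective (g := ψ a⁻¹ b⁻¹) (fun x => DFunLike.congr_fun (hc a b) x)
    · have := hc a⁻¹ b⁻¹
      rw [inv_inv, inv_inv] at this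
      exact Function.RightInverse.surjective (g := ψ a⁻¹ b⁻¹) (fun x => DFunLike.congr_fun this x)
  have : hl i (i a * t * i b) = (hl i t).comp (ψ a b) := by
    apply HNNExtension.hom_ext
    · ext g; simp [ψ]
    · simp [ψ]
  unfold FP
  rw [this]
  exact h.comp hb

/-- exponent sum -/
theorem exists_eps (h : FP i t) : ∃ ε : F →* Multiplicative ℤ, (∀ g, ε (i g) = 1) ∧
    ε t = Multiplicative.ofAdd 1 := by
  let e := MulEquiv.ofBijective _ h
  have e1 : ∀ g, e.symm (i g) = of g := fun g => by
    rw [MulEquiv.symm_apply_eq]; exact (hl_of i t g).symm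
  have e2 : e.symm t = HNNExtension.t := by
    rw [MulEquiv.symm_apply_eq]; exact (hl_t i t).symm
  exact ⟨(hl (1 : G →* Multiplicative ℤ) (Multiplicative.ofAdd 1)).comp e.symm.toMonoidHom,
    fun g => by simp [e1], by simp [e2]⟩

/-- relation with the coproduct -/
theorem fp_of_coprod {A : Subgroup F} {g : F} (hg : ¬ IsOfFinOrder g)
    (hb : Function.Bijective (Monoid.Coprod.lift A.subtype (Subgroup.zpowers g).subtype)) :
    FP A.subtype g := by
  let z : Multiplicative ℤ →* Subgroup.zpowers g := zpowersHom _ ⟨g, Subgroup.mem_zpowers g⟩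
  have hz : Function.Bijective z := by
    constructor
    · intro a b hab
      have h1 : g ^ (Multiplicative.toAdd a) = g ^ (Multiplicative.toAdd b) := by
        have := congrArg Subtype.val hab
        simpa [z] using this
      exact injective_zpow_iff_not_isOfFinOrder.2 hg h1
    · rintro ⟨_, n, rfl⟩
      exact ⟨Multiplicative.ofAdd n, by ext; simp [z]⟩
  let ze := MulEquiv.ofBijective z hz
  let j : HN A →* Monoid.Coprod A (Subgroup.zpowers g) :=
    hl Monoid.Coprod.inl (Monoid.Coprod.inr ⟨g, Subgroup.mem_zpowers g⟩)
  let k : Monoid.Coprod A (Subgroup.zpowers g) →* HN A :=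
    Monoid.Coprod.lift of ((zpowersHom _ (HNNExtension.t : HN A)).comp ze.symm.toMonoidHom)
  have hzg : ze.symm ⟨g, Subgroup.mem_zpowers g⟩ = Multiplicative.ofAdd 1 := by
    rw [MulEquiv.symm_apply_eq]; ext; simp [ze, z]
  have h1 : k.comp j = MonoidHom.id _ := by
    apply HNNExtension.hom_ext
    · ext g; simp [k, j]
    · simp [k, j, hzg]
  have h2 : j.comp k = MonoidHom.id _ := by
    apply Monoid.Coprod.hom_ext
    · ext x; simp [k, j]
    · ext ⟨_, n, rfl⟩
      have : ze.symm (⟨g, Subgroup.mem_zpowers g⟩ ^ n) = Multiplicative.ofAdd n := by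
        rw [map_zpow, hzg, ← ofAdd_zsmul]; simp
      have h3 : (⟨g ^ n, ⟨n, rfl⟩⟩ : Subgroup.zpowers g) = ⟨g, Subgroup.mem_zpowers g⟩ ^ n := by
        ext; simp
      simp only [MonoidHom.comp_apply, MonoidHom.id_apply]
      rw [h3]
      simp [k, j, hzg]
  have hj : Function.Bijective j := by
    constructor
    · exact Function.LeftInverse.injective (g := k) (fun x => DFunLike.congr_fun h1 x)
    · exact Function.RightInverse.surjective (g := k) (fun x => DFunLike.congr_fun h2 x)
  have : hl A.subtype g = (Monoid.Coprod.lift A.subtype (Subgroup.zpowers g).subtype).comp j := by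
    apply HNNExtension.hom_ext
    · ext x; simp [j]
    · simp [j]
  unfold FP
  rw [this]
  exact hb.comp hj

theorem coprod_of_fp {A : Subgroup F} {g : F} (h : FP A.subtype g) :
    Function.Bijective (Monoid.Coprod.lift A.subtype (Subgroup.zpowers g).subtype) := by
  let j : HN A →* Monoid.Coprod A (Subgroup.zpowers g) :=
    hl Monoid.Coprod.inl (Monoid.Coprod.inr ⟨g, Subgroup.mem_zpowers g⟩)
  have hj : Function.Surjective j := by
    rw [← MonoidHom.range_eq_top, eq_top_iff, ← Monoid.Coprod.range_inl_sup_range_inr, sup_le_iff]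
    constructor
    · rintro _ ⟨x, rfl⟩
      exact ⟨of x, by simp [j]⟩
    · rintro _ ⟨⟨_, n, rfl⟩, rfl⟩
      refine ⟨HNNExtension.t ^ n, ?_⟩
      have h3 : (⟨g ^ n, ⟨n, rfl⟩⟩ : Subgroup.zpowers g) = ⟨g, Subgroup.mem_zpowers g⟩ ^ n := by
        ext; simp
      simp only [j, map_zpow, hl_t]
      rw [← map_zpow, ← h3]
  have : hl A.subtype g = (Monoid.Coprod.lift A.subtype (Subgroup.zpowers g).subtype).comp j := by
    apply HNNExtension.hom_ext
    · ext x; simp [j]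
    · simp [j]
  unfold FP at h
  rw [this] at h
  have h' : Function.Bijective
    (Monoid.Coprod.lift A.subtype (Subgroup.zpowers g).subtype ∘ j) := h
  have hji : Function.Injective j := h'.1.of_comp
  exact (Function.Bijective.of_comp_iff _ ⟨hji, hj⟩).1 h'

/-! ### The length function -/

theorem P_mul_last (l : List (ℤˣ × G)) (hl0 : l ≠ []) (g : G) :
    ∃ l' : List (ℤˣ × G), l'.length = l.length ∧ P i t l * i g = P i t l' := by
  obtain ⟨m, x, rfl⟩ := List.eq_nil_or_concat l |>.resolve_left hl0
  exact ⟨m ++ [(x.1, x.2 * g)], by simp, by simp [mul_assoc]⟩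

theorem P_mul_any (l : List (ℤˣ × G)) (g : G) :
    ∃ (g' : G) (l' : List (ℤˣ × G)), l'.length = l.length ∧ P i t l * i g = i g' * P i t l' := by
  by_cases h : l = []
  · subst h; exact ⟨g, [], rfl, by simp⟩
  · obtain ⟨l', h1, h2⟩ := P_mul_last (i := i) (t := t) l h g
    exact ⟨1, l', h1, by simpa using h2⟩

theorem shorten (l : List (ℤˣ × G)) (h : ¬ List.IsChain R l) :
    ∃ (g' : G) (l' : List (ℤˣ × G)), l'.length < l.length ∧ P i t l = i g' * P i t l' := by
  induction l with
  | nil => simp at h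
  | cons x l ih =>
    by_cases hc : List.IsChain R l
    · rcases l with _ | ⟨y, l⟩
      · simp at h
      · rw [List.isChain_cons_cons] at h
        have hR : ¬ R x y := fun h' => h ⟨h', hc⟩
        unfold R at hR
        push Not at hR
        have hxy : (y.1 : ℤˣ) = - x.1 := by
          rcases Int.units_eq_one_or x.1 with h1 | h1 <;>
          rcases Int.units_eq_one_or y.1 with h2 | h2 <;> simp_all
        refine ⟨y.2, l, by simp, ?_⟩
        simp [hR.1, hxy, mul_assoc]
    · obtain ⟨g', l', h1, h2⟩ := ih hc
      refine ⟨1, (x.1, x.2 * g') :: l', by simpa using h1, ?_⟩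
      simp [h2, mul_assoc]

/-- number of `t`-letters in the normal form -/
noncomputable def len (h : FP i t) (f : F) : ℕ := (exists_rep h f).choose_spec.choose.length

theorem len_rep (h : FP i t) {l : List (ℤˣ × G)} (g : G) (hc : List.IsChain R l) :
    len h (i g * P i t l) = l.length := by
  unfold len
  set f := i g * P i t l with hf
  have := (exists_rep h f).choose_spec.choose_spec
  have h2 := rep_unique h _ _ _ _ hc this.1 (hf.symm.trans this.2)
  rw [← h2.2]

theorem len_le (h : FP i t) (l : List (ℤˣ × G)) (g : G) :
    len h (i g * P i t l) ≤ l.length := by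
  induction hn : l.length using Nat.strong_induction_on generalizing l g with
  | _ n ih =>
    by_cases hc : List.IsChain R l
    · rw [len_rep h g hc, hn]
    · obtain ⟨g', l', h1, h2⟩ := shorten (i := i) (t := t) l hc
      rw [h2, ← mul_assoc, ← map_mul]
      exact (ih _ (hn ▸ h1) l' _ rfl).trans (hn ▸ h1.le)

theorem len_eq_iff (h : FP i t) (l : List (ℤˣ × G)) (g : G) :
    len h (i g * P i t l) = l.length ↔ List.IsChain R l := by
  refine ⟨fun he => ?_, len_rep h g⟩
  by_contra hc
  obtain ⟨g', l', h1, h2⟩ := shorten (i := i) (t := t) l hc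
  rw [h2, ← mul_assoc, ← map_mul] at he
  have := len_le h l' (g * g')
  omega

theorem len_eq_iff_one (h : FP i t) (l : List (ℤˣ × G)) :
    len h (P i t l) = l.length ↔ List.IsChain R l := by
  simpa using len_eq_iff h l 1

theorem exists_rep_len (h : FP i t) (f : F) :
    ∃ g l, List.IsChain R l ∧ f = i g * P i t l ∧ l.length = len h f := by
  obtain ⟨g, l, h1, h2⟩ := exists_rep h f
  exact ⟨g, l, h1, h2, by rw [h2, len_rep h g h1]⟩

theorem len_mul_le (h : FP i t) (x y : F) : len h (x * y) ≤ len h x + len h y := by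
  obtain ⟨g, l, h1, h2, h3⟩ := exists_rep_len h x
  obtain ⟨g', l', h1', h2', h3'⟩ := exists_rep_len h y
  obtain ⟨g'', l'', h4, h5⟩ := P_mul_any (i := i) (t := t) l g'
  have : x * y = i (g * g'') * P i t (l'' ++ l') := by
    rw [h2, h2', P_append, map_mul, mul_assoc, ← mul_assoc (P i t l), h5]
    simp [mul_assoc]
  rw [this]
  refine (len_le h _ _).trans ?_
  simp [h4, h3, h3']

theorem len_eq_zero (h : FP i t) (x : F) : len h x = 0 ↔ ∃ g, x = i g := by
  constructor
  · intro h0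
    obtain ⟨g, l, h1, h2, h3⟩ := exists_rep_len h x
    rw [h0, List.length_eq_zero_iff] at h3
    exact ⟨g, by simpa [h3] using h2⟩
  · rintro ⟨g, rfl⟩
    have := len_le h [] g
    simpa using this

@[simp] theorem len_i (h : FP i t) (g : G) : len h (i g) = 0 := (len_eq_zero h _).2 ⟨g, rfl⟩
@[simp] theorem len_one (h : FP i t) : len h 1 = 0 := (len_eq_zero h _).2 ⟨1, by simp⟩

@[simp] theorem len_i_mul (h : FP i t) (g : G) (x : F) : len h (i g * x) = len h x := by
  apply le_antisymm
  · simpa using len_mul_le h (i g) x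
  · have := len_mul_le h (i g⁻¹) (i g * x)
    rw [len_i] at this
    simpa using this

@[simp] theorem len_mul_i (h : FP i t) (g : G) (x : F) : len h (x * i g) = len h x := by
  apply le_antisymm
  · simpa using len_mul_le h x (i g)
  · have := len_mul_le h (x * i g) (i g⁻¹)
    rw [len_i] at this
    simpa using this

theorem P_inv (l : List (ℤˣ × G)) (e : ℤˣ) : ∃ (l' : List (ℤˣ × G)) (e' : ℤˣ),
    l'.length = l.length ∧ (P i t (l ++ [(e, 1)]))⁻¹ = P i t (l' ++ [(e', 1)]) := by
  induction l with
  | nil => exact ⟨[], -e, rfl, by simp⟩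
  | cons x l ih =>
    obtain ⟨l', e', h1, h2⟩ := ih
    refine ⟨l' ++ [(e', x.2⁻¹)], -x.1, by simp [h1], ?_⟩
    rw [List.cons_append, P_cons, mul_inv_rev, h2]
    simp [mul_assoc]

theorem len_inv (h : FP i t) (x : F) : len h x⁻¹ = len h x := by
  have key : ∀ x, len h x⁻¹ ≤ len h x := by
    intro x
    obtain ⟨g, l, h1, h2, h3⟩ := exists_rep_len h x
    rcases List.eq_nil_or_concat l with rfl | ⟨m, y, rfl⟩
    · simp only [P_nil, mul_one] at h2
      rw [h2, ← map_inv, len_i]; simp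
    · obtain ⟨l', e', h4, h5⟩ := P_inv (i := i) (t := t) m y.1
      have : x⁻¹ = i y.2⁻¹ * P i t (l' ++ [(e', 1)]) * i g⁻¹ := by
        rw [← h5, h2]; simp [mul_assoc]
      rw [this, len_mul_i]
      refine (len_le h _ _).trans ?_
      simp [h4, ← h3]
  exact le_antisymm (key x) (by simpa using key x⁻¹)

theorem len_trans (h : FP i t) {x y z : F} (hxy : len h (x * y) = len h x + len h y)
    (hyz : len h (y * z) = len h y + len h z) (hy : 1 ≤ len h y) :
    len h (x * y * z) = len h x + len h y + len h z := by
  obtain ⟨g3, l3, c3, e3, n3⟩ := exists_rep_len h z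
  obtain ⟨g2, l2, c2, e2, n2⟩ := exists_rep_len h (y * i g3)
  obtain ⟨g1, l1, c1, e1, n1⟩ := exists_rep_len h (x * i g2)
  rw [len_mul_i] at n1 n2
  have a1 : x * y * i g3 = i g1 * P i t (l1 ++ l2) := by
    rw [mul_assoc, e2, ← mul_assoc, e1, P_append, mul_assoc]
  have a2 : y * z = i g2 * P i t (l2 ++ l3) := by
    rw [e3, ← mul_assoc, e2, P_append, mul_assoc]
  have a3 : x * y * z = i g1 * P i t (l1 ++ l2 ++ l3) := by
    rw [e3, ← mul_assoc, a1, P_append (l1 ++ l2), mul_assoc]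
  have b1 : List.IsChain R (l1 ++ l2) := by
    rw [← len_eq_iff h _ g1, ← a1, len_mul_i, hxy, List.length_append, n1, n2]
  have b2 : List.IsChain R (l2 ++ l3) := by
    rw [← len_eq_iff h _ g2, ← a2, hyz, List.length_append, n2, n3]
  have b3 : List.IsChain R (l1 ++ l2 ++ l3) := by
    apply List.IsChain.append_overlap b1 b2
    rintro rfl
    simp at n2; omega
  rw [a3, len_rep h _ b3]
  simp [n1, n2, n3, add_assoc]

/-- not `R` -/
theorem not_R {x y : ℤˣ × G} (h : ¬ R x y) : x.2 = 1 ∧ y.1 = - x.1 := by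
  unfold R at h
  push Not at h
  refine ⟨h.1, ?_⟩
  rcases Int.units_eq_one_or x.1 with h1 | h1 <;>
  rcases Int.units_eq_one_or y.1 with h2 | h2 <;> simp_all

theorem append_not_chain {l l' : List (ℤˣ × G)} (h1 : List.IsChain R l) (h2 : List.IsChain R l')
    (h : ¬ List.IsChain R (l ++ l')) : ∃ m e y m', l = m ++ [(e, 1)] ∧ l' = (-e, y) :: m' := by
  rw [List.isChain_append] at h
  have h3 : ∃ x ∈ l.getLast?, ∃ y ∈ l'.head?, ¬ R x y := by
    by_contra hc
    push Not at hc
    exact h ⟨h1, h2, hc⟩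
  obtain ⟨x, hx, y, hy, hR⟩ := h3
  obtain ⟨h4, h5⟩ := not_R hR
  rcases List.eq_nil_or_concat l with rfl | ⟨m, x', rfl⟩
  · simp at hx
  rcases l' with _ | ⟨y', l'⟩
  · simp at hy
  simp only [List.getLast?_append, List.getLast?_singleton, Option.some_or, Option.mem_def,
    Option.some.injEq, List.head?_cons, List.concat_eq_append] at hx hy
  subst hx hy
  refine ⟨m, x'.1, y'.2, l', ?_, ?_⟩
  · simp [← h4]
  · simp [← h5]

theorem cyc_decomp (h : FP i t) (s : F) : ∃ v r, s = v * r * v⁻¹ ∧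
    len h s = 2 * len h v + len h r ∧ (len h r = 0 ∨ len h (r * r) = 2 * len h r) ∧
    (v = 1 ∨ 1 ≤ len h v) := by
  induction hn : len h s using Nat.strong_induction_on generalizing s with
  | _ n ih =>
    by_cases h0 : len h s = 0 ∨ len h (s * s) = 2 * len h s
    · exact ⟨1, s, by simp, by simp [hn], h0, Or.inl rfl⟩
    push Not at h0
    obtain ⟨g, l, c1, e1, n1⟩ := exists_rep_len h s
    have hl : l ≠ [] := by rintro rfl; simp at n1; omega
    obtain ⟨l', n2, e2⟩ := P_mul_last (i := i) (t := t) l hl g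
    have e3 : s = i g * P i t l' * i g⁻¹ := by rw [← e2, e1]; simp [mul_assoc]
    have c2 : List.IsChain R l' := by
      rw [← len_eq_iff h _ g, n2, n1, e3, len_mul_i]
    have c3 : ¬ List.IsChain R (l' ++ l') := by
      intro hc
      apply h0.2
      have : s * s = i g * P i t (l' ++ l') * i g⁻¹ := by rw [e3]; simp [mul_assoc]
      rw [this, len_mul_i, len_rep h _ hc, List.length_append, n2, n1]; ring
    obtain ⟨m, e, y, m', hm, hm'⟩ := append_not_chain c2 c2 c3
    have : ∃ k, m = (-e, y) :: k := by
      rcases m with _ | ⟨x, k⟩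
      · rw [hm] at hm'
        simp at hm'
      · rw [hm] at hm'
        simp only [List.cons_append, List.cons.injEq] at hm'
        exact ⟨k, by rw [hm'.1]⟩
    obtain ⟨k, rfl⟩ := this
    have ck : List.IsChain R k := by
      rw [hm] at c2
      exact c2.tail.left_of_append
    have n3 : k.length + 2 = len h s := by rw [← n1, ← n2, hm]; simp
    have n4 : len h (i y * P i t k) = k.length := len_rep h y ck
    obtain ⟨v, r, f1, f2, f3, f4⟩ := ih k.length (by omega) (i y * P i t k) n4
    have e4 : s = (i g * t ^ ((-e : ℤˣ) : ℤ) * v) * r * (i g * t ^ ((-e : ℤˣ) : ℤ) * v)⁻¹ := by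
      have : (i g * t ^ ((-e : ℤˣ) : ℤ) * v) * r * (i g * t ^ ((-e : ℤˣ) : ℤ) * v)⁻¹ =
        i g * t ^ ((-e : ℤˣ) : ℤ) * (v * r * v⁻¹) * (i g * t ^ ((-e : ℤˣ) : ℤ))⁻¹ := by group
      rw [this, ← f1, e3, hm]
      simp [mul_assoc]
    have n5 : len h (i g * t ^ ((-e : ℤˣ) : ℤ) * v) ≤ 1 + len h v := by
      refine (len_mul_le h _ _).trans ?_
      have := len_le h [(-e, 1)] g
      simp at this
      simpa using this
    have n6 := len_mul_le h ((i g * t ^ ((-e : ℤˣ) : ℤ) * v) * r)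
      (i g * t ^ ((-e : ℤˣ) : ℤ) * v)⁻¹
    have n7 := len_mul_le h (i g * t ^ ((-e : ℤˣ) : ℤ) * v) r
    rw [← e4, len_inv] at n6
    exact ⟨_, r, e4, by omega, f3, Or.inr (by omega)⟩

/-- trivial ends -/
def TE (i : G →* F) (t : F) (s : F) : Prop :=
  ∃ l e, List.IsChain R (l ++ [((e : ℤˣ), (1 : G))]) ∧ s = P i t (l ++ [(e, 1)])

theorem TE.inv (h : FP i t) {s : F} (hs : TE i t s) : TE i t s⁻¹ := by
  obtain ⟨l, e, c, rfl⟩ := hs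
  obtain ⟨l', e', h1, h2⟩ := P_inv (i := i) (t := t) l e
  refine ⟨l', e', ?_, h2⟩
  rw [← len_eq_iff_one h, ← h2, len_inv, (len_eq_iff_one h _).2 c]
  simp [h1]

theorem TE.zpow (h : FP i t) {s : F} (hs : TE i t s) (e : ℤˣ) : TE i t (s ^ (e : ℤ)) := by
  rcases Int.units_eq_one_or e with rfl | rfl
  · simpa using hs
  · simpa using hs.inv h

theorem TE.mul (h : FP i t) {s s' : F} (hs : TE i t s) (hs' : TE i t s') {y : G} (hy : y ≠ 1) :
    len h (s * i y * s') = len h s + len h s' := by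
  obtain ⟨l, e, c, rfl⟩ := hs
  obtain ⟨l', e', c', rfl⟩ := hs'
  have : P i t (l ++ [(e, 1)]) * i y * P i t (l' ++ [(e', 1)]) =
    P i t ((l ++ [(e, y)]) ++ (l' ++ [(e', 1)])) := by simp [mul_assoc]
  rw [this, (len_eq_iff_one h _).2 c, (len_eq_iff_one h _).2 c', (len_eq_iff_one h _).2]
  · simp; omega
  · rw [List.isChain_append]
    refine ⟨?_, c', ?_⟩
    · rw [List.isChain_append] at c ⊢
      refine ⟨c.1, by simp, ?_⟩
      intro x hx z hz
      have := c.2.2 x hx (e, 1) (by simp)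
      simp only [List.head?_cons, Option.mem_def, Option.some.injEq] at hz
      subst hz
      exact this
    · intro x hx z hz h1
      simp at hx
      subst hx
      exact absurd h1 hy

theorem exists_TE (h : FP i t) (x : F) (hx : 1 ≤ len h x) :
    ∃ g s g', TE i t s ∧ x = i g * s * i g' := by
  obtain ⟨g, l, c, e, n⟩ := exists_rep_len h x
  rcases List.eq_nil_or_concat l with rfl | ⟨m, y, rfl⟩
  · simp at n; omega
  refine ⟨g, P i t (m ++ [(y.1, 1)]), y.2, ⟨m, y.1, ?_, rfl⟩, ?_⟩
  · rw [List.concat_eq_append, List.isChain_append] at c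
    rw [List.isChain_append]
    refine ⟨c.1, by simp, ?_⟩
    intro x hx z hz
    have := c.2.2 x hx y (by simp)
    simp only [List.head?_cons, Option.mem_def, Option.some.injEq] at hz
    subst hz
    exact this
  · rw [e]; simp [mul_assoc]

/-! ### Automorphisms preserving the factor -/

theorem auto_form (h : FP i t) (Φ : F ≃* F) (φ : G ≃* G) (hΦ : ∀ g, Φ (i g) = i (φ g))
    (hnc : ∀ a b v g, Φ t ≠ i a * (v * i g * v⁻¹) * i b) : len h (Φ t) = 1 := by
  have hpos : 1 ≤ len h (Φ t) := by
    by_contra hc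
    obtain ⟨g, hg⟩ := (len_eq_zero h (Φ t)).1 (by omega)
    exact hnc 1 1 1 g (by simp [hg])
  obtain ⟨g, s, g', hs, hgs⟩ := exists_TE h _ hpos
  have h' : FP i (i (φ.symm g)⁻¹ * t * i (φ.symm g')⁻¹) := h.mul
  set t' := i (φ.symm g)⁻¹ * t * i (φ.symm g')⁻¹ with ht'
  have hs' : Φ t' = s := by
    simp [ht', hΦ, hgs, mul_assoc]
  obtain ⟨v, r, f1, f2, f3, f4⟩ := cyc_decomp h s
  have hr0 : len h r ≠ 0 := by
    intro h0
    obtain ⟨a, ha⟩ := (len_eq_zero h r).1 h0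
    exact hnc g g' v a (by rw [hgs, f1, ha])
  have hrr := f3.resolve_left hr0
  have hle : ∀ (x : F) (e : ℤˣ), len h (x ^ (e : ℤ)) = len h x := by
    intro x e
    rcases Int.units_eq_one_or e with rfl | rfl
    · simp
    · simp [len_inv]
  have hse : ∀ e : ℤˣ, s ^ (e : ℤ) = v * r ^ (e : ℤ) * v⁻¹ := by
    intro e
    rw [f1, ← conj_zpow]
  have hvr : ∀ e : ℤˣ, len h (v * r ^ (e : ℤ)) = len h v + len h (r ^ (e : ℤ)) := by
    intro e
    have n1 := len_mul_le h v (r ^ (e : ℤ))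
    have n2 := len_mul_le h (v * r ^ (e : ℤ)) v⁻¹
    rw [← hse, hle, len_inv] at n2
    rw [hle] at *
    omega
  have hrv : ∀ e : ℤˣ, len h (r ^ (e : ℤ) * v⁻¹) = len h (r ^ (e : ℤ)) + len h v⁻¹ := by
    intro e
    have n1 := len_mul_le h (r ^ (e : ℤ)) v⁻¹
    have n2 := len_mul_le h v (r ^ (e : ℤ) * v⁻¹)
    rw [← mul_assoc, ← hse, hle] at n2
    rw [hle, len_inv] at *
    omega
  have hrre : ∀ e : ℤˣ, len h (r ^ (e : ℤ) * r ^ (e : ℤ)) =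
      len h (r ^ (e : ℤ)) + len h (r ^ (e : ℤ)) := by
    intro e
    rw [← (Commute.refl r).mul_zpow, hle, hle, hrr]; ring
  have hvv : ∀ y : G, y ≠ 1 → len h (v⁻¹ * (i y * v)) = len h v⁻¹ + len h (i y * v) := by
    intro y hy
    have n0 := TE.mul h (hs.inv h) hs hy
    rw [len_inv] at n0
    have e0 : s⁻¹ * i y * s = v * r⁻¹ * (v⁻¹ * (i y * v)) * (r * v⁻¹) := by
      rw [f1]; group
    rw [e0] at n0
    have n1 := len_mul_le h (v * r⁻¹ * (v⁻¹ * (i y * v))) (r * v⁻¹)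
    have n2 := len_mul_le h (v * r⁻¹) (v⁻¹ * (i y * v))
    have n3 := len_mul_le h v r⁻¹
    have n4 := len_mul_le h r v⁻¹
    have n5 := len_mul_le h v⁻¹ (i y * v)
    rw [len_inv] at n3 n4 n5
    rw [len_i_mul] at n5
    rw [len_inv, len_i_mul]
    omega
  have claim : ∀ (k : List (ℤˣ × G)) (x : ℤˣ × G), List.IsChain R (x :: k) →
      ∃ z, Φ (P i t' (x :: k)) = v * r ^ (x.1 : ℤ) * z ∧
        len h (r ^ (x.1 : ℤ) * z) = len h (r ^ (x.1 : ℤ)) + len h z := by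
    intro k
    induction k with
    | nil =>
      intro x _
      refine ⟨v⁻¹ * i (φ x.2), ?_, ?_⟩
      · simp [hs', hse, hΦ, mul_assoc]
      · rw [← mul_assoc, len_mul_i, len_mul_i, hrv]
    | cons y k ih =>
      intro x hc
      rw [List.isChain_cons_cons] at hc
      obtain ⟨z, hz1, hz2⟩ := ih y hc.2
      have hz3 : len h (v * r ^ (y.1 : ℤ) * z) = len h v + len h (r ^ (y.1 : ℤ)) + len h z :=
        len_trans h (hvr _) hz2 (by rw [hle]; omega)
      rw [P_cons, map_mul, hz1, map_mul, map_zpow, hs', hse, hΦ]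
      by_cases hx : x.2 = 1
      · have hxy : x.1 = y.1 := hc.1 hx
        refine ⟨r ^ (y.1 : ℤ) * z, ?_, ?_⟩
        · rw [hx]; simp [mul_assoc]
        · rw [hxy, ← mul_assoc, len_trans h (hrre _) hz2 (by rw [hle]; omega), hz2, add_assoc]
      · have hy : φ x.2 ≠ 1 := by simpa using hx
        refine ⟨v⁻¹ * (i (φ x.2) * v * r ^ (y.1 : ℤ) * z), ?_, ?_⟩
        · simp [mul_assoc]
        · rcases f4 with rfl | f4
          · have hsr : s = r := by simpa using f1
            rw [← hsr] at hz2 ⊢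
            simp only [inv_one, one_mul, mul_one]
            have m1 : len h (s ^ (x.1 : ℤ) * (i (φ x.2) * s ^ (y.1 : ℤ))) =
                len h (s ^ (x.1 : ℤ)) + len h (i (φ x.2) * s ^ (y.1 : ℤ)) := by
              rw [len_i_mul, ← mul_assoc]
              exact TE.mul h (hs.zpow h _) (hs.zpow h _) hy
            have m2 : len h ((i (φ x.2) * s ^ (y.1 : ℤ)) * z) =
                len h (i (φ x.2) * s ^ (y.1 : ℤ)) + len h z := by
              rw [len_i_mul, mul_assoc, len_i_mul, hz2]
            have m3 := len_trans h m1 m2 (by rw [len_i_mul, hle, hsr]; omega)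
            rw [mul_assoc] at m3
            rw [m3, m2, add_assoc]
          · have q1 : len h (i (φ x.2) * v * (r ^ (y.1 : ℤ) * z)) =
                len h (i (φ x.2) * v) + len h (r ^ (y.1 : ℤ) * z) := by
              rw [mul_assoc, len_i_mul, len_i_mul, ← mul_assoc, hz3, hz2, add_assoc]
            have q2 := len_trans h (hvv _ hy) q1 (by rw [len_i_mul]; exact f4)
            have q3 : len h (v⁻¹ * (i (φ x.2) * v * r ^ (y.1 : ℤ) * z)) =
                len h v⁻¹ + len h (i (φ x.2) * v * r ^ (y.1 : ℤ) * z) := by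
              have u1 : i (φ x.2) * v * r ^ (y.1 : ℤ) * z =
                i (φ x.2) * v * (r ^ (y.1 : ℤ) * z) := by simp [mul_assoc]
              rw [u1, q1, ← mul_assoc, q2, add_assoc]
            rw [← mul_assoc, len_trans h (hrv _) q3 (by rw [len_inv]; exact f4), q3, add_assoc]
  have ht1 : len h t = 1 := by
    have := len_rep h (l := [(1, 1)]) 1 (by simp)
    simpa using this
  obtain ⟨a, k, c, e⟩ := exists_rep h' (Φ.symm t)
  rw [MulEquiv.symm_apply_eq] at e
  rcases k with _ | ⟨x, k⟩
  · rw [P_nil, mul_one, hΦ] at e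
    have e5 := congrArg (len h) e
    rw [len_i] at e5
    omega
  · obtain ⟨z, hz1, hz2⟩ := claim k x c
    rw [map_mul, hz1, hΦ] at e
    have n1 := len_trans h (hvr x.1) hz2 (by rw [hle]; omega)
    have e5 := congrArg (len h) e
    rw [len_i_mul, n1, hle] at e5
    rw [hgs, len_mul_i, len_i_mul, f2]
    omega

/-! ### Conjugacy -/

theorem rot_of_append {α : Type*} (k l l' : List α) (hn : l'.length ≠ 0)
    (h : k ++ l = l' ++ k) : l.IsRotated l' := by
  induction hk : k.length using Nat.strong_induction_on generalizing k with
  | _ n ih =>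
    rcases List.append_eq_append_iff.1 h with ⟨c, h1, h2⟩ | ⟨c, h1, h2⟩
    · rw [h1, h2]
      exact List.isRotated_append
    · have h3 : c ++ l = l' ++ c := by rw [← h1, ← h2]
      refine ih c.length ?_ c h3 rfl
      rw [← hk, h1, List.length_append]; omega

/-- cyclically reduced -/
def CC (l : List (ℤˣ × G)) : Prop := Cycle.Chain R (l : Cycle (ℤˣ × G))

theorem CC.chain {l : List (ℤˣ × G)} (h : CC l) : List.IsChain R l := by
  rcases l with _ | ⟨x, l⟩
  · simp
  · unfold CC at h
    rw [Cycle.chain_coe_cons, ← List.cons_append] at h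
    exact h.left_of_append

theorem CC.of_append {l : List (ℤˣ × G)} (h : List.IsChain R (l ++ l)) : CC l := by
  rcases l with _ | ⟨x, l⟩
  · exact Cycle.Chain.nil _
  · unfold CC
    rw [Cycle.chain_coe_cons]
    have : (x :: l) ++ (x :: l) = (x :: (l ++ [x])) ++ l := by simp
    rw [this] at h
    exact h.left_of_append

theorem CC.rot {l l' : List (ℤˣ × G)} (h : CC l) (hr : l.IsRotated l') : CC l' := by
  unfold CC at *
  rwa [← Cycle.coe_eq_coe.2 hr]

theorem collins (h : FP i t) (u : F) (l l' : List (ℤˣ × G)) (hl : CC l) (hl' : CC l')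
    (hn : l.length = l'.length) (h0 : l ≠ []) (hu : u * P i t l = P i t l' * u) :
    l.IsRotated l' := by
  induction hm : len h u using Nat.strong_induction_on generalizing u l with
  | _ n ih =>
    obtain ⟨g, k, c, e, m⟩ := exists_rep_len h u
    have h0' : l' ≠ [] := by
      rintro rfl
      simp at hn
      exact h0 hn
    by_cases hk : List.IsChain R (k ++ l)
    · obtain ⟨l'', n1, e1⟩ := P_mul_last (i := i) (t := t) l' h0' g
      have e2 : i g * P i t (k ++ l) = P i t (l'' ++ k) := by
        rw [P_append, P_append, ← e1, ← mul_assoc, ← e, hu, e, mul_assoc]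
      have c1 : List.IsChain R (l'' ++ k) := by
        rw [← len_eq_iff_one h, ← e2, len_rep h g hk]
        simp; omega
      obtain ⟨rfl, h2⟩ := rep_unique h _ _ _ 1 hk c1 (by rw [e2]; simp)
      have h3 : l' = l'' := by
        refine (rep_unique h _ _ 1 1 hl'.chain c1.left_of_append ?_).2
        rw [← e1]; simp
      subst h3
      exact rot_of_append k l l' (by simpa using h0') h2
    · obtain ⟨k0, f, x, l0, rfl, rfl⟩ := append_not_chain c hl.chain hk
      have hrot : ((-f, x) :: l0).IsRotated (l0 ++ [(-f, x)]) := by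
        have := List.isRotated_append (l := [(-f, x)]) (l' := l0)
        simpa using this
      refine hrot.trans ?_
      refine ih (len h (i g * P i t k0 * i x)) ?_ (i g * P i t k0 * i x) _ (hl.rot hrot)
        (by simpa using hn) (by simp) ?_ rfl
      · rw [len_mul_i, ← hm, ← m, List.length_append]
        have := len_le h k0 g
        simp only [List.length_singleton]; omega
      · have e1 : i g * P i t k0 = u * t ^ ((-f : ℤˣ) : ℤ) := by
          rw [e]; simp [mul_assoc]
        have e2 : i g * P i t k0 * i x * P i t (l0 ++ [(-f, x)]) =
          u * P i t ((-f, x) :: l0) * (t ^ ((-f : ℤˣ) : ℤ) * i x) := by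
          rw [e1]; simp [mul_assoc]
        rw [e2, hu, e1]; simp [mul_assoc]

theorem conj_class (h : FP i t) (f : F) : (∃ g, IsConj f (i g)) ∨
    ∃ l, l ≠ [] ∧ CC l ∧ IsConj f (P i t l) := by
  obtain ⟨v, r, f1, -, f3, -⟩ := cyc_decomp h f
  have hfr : IsConj f r := by
    rw [f1]
    exact (isConj_iff.2 ⟨v, rfl⟩ : IsConj r _).symm
  by_cases h0 : len h r = 0
  · obtain ⟨g, rfl⟩ := (len_eq_zero h r).1 h0
    exact Or.inl ⟨g, hfr⟩
  · right
    have h2 := f3.resolve_left h0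
    obtain ⟨g, l, c, e, m⟩ := exists_rep_len h r
    have hl : l ≠ [] := by rintro rfl; simp at m; omega
    obtain ⟨l', n1, e1⟩ := P_mul_last (i := i) (t := t) l hl g
    have e2 : r = i g * P i t l' * (i g)⁻¹ := by rw [← e1, e]; simp [mul_assoc]
    refine ⟨l', ?_, ?_, ?_⟩
    · rintro rfl
      simp at n1
      exact hl (List.length_eq_zero_iff.1 n1.symm)
    · apply CC.of_append
      rw [← len_eq_iff_one h]
      have e3 : P i t (l' ++ l') = i g⁻¹ * (r * r) * i g := by
        rw [e2]; simp [mul_assoc]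
      rw [e3, len_mul_i, len_i_mul, h2, List.length_append, n1, m]; ring
    · refine hfr.trans ?_
      rw [e2]
      exact (isConj_iff.2 ⟨i g, rfl⟩ : IsConj (P i t l') _).symm

theorem malnormal (h : FP i t) {g g' : G} (hg : g' ≠ 1) (hc : IsConj (i g) (i g')) :
    ∃ b, b * g * b⁻¹ = g' := by
  obtain ⟨u, hu⟩ := isConj_iff.1 hc
  obtain ⟨p, k, c, e, m⟩ := exists_rep_len h u
  by_cases hk : k = []
  · subst hk
    refine ⟨p, inj h ?_⟩
    rw [← hu, e]; simp
  · exfalso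
    obtain ⟨k', n1, e1⟩ := P_mul_last (i := i) (t := t) k hk g
    have e2 : i p * P i t k' = i (g' * p) * P i t k := by
      rw [← e1, map_mul, ← hu, mul_assoc _ (i p), ← e, ← mul_assoc, ← e]; simp
    have c' : List.IsChain R k' := by
      rw [← len_eq_iff h _ p, e2, len_rep h _ c, n1]
    have := (rep_unique h _ _ _ _ c' c e2).1
    exact hg (by simpa using this)

/-! ### Turns -/

/-- first sign -/
def st (e : ℤˣ) : List (ℤˣ × G) → ℤˣ
  | [] => e
  | y :: _ => y.1

/-- turns of a word, closed up by the sign `e` -/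
def turns (e : ℤˣ) : List (ℤˣ × G) → List (ℤˣ × G × ℤˣ)
  | [] => []
  | x :: m => (x.1, x.2, st e m) :: turns e m

/-- turns of a cyclic word -/
def ct (l : List (ℤˣ × G)) : List (ℤˣ × G × ℤˣ) := turns (st 1 l) l

theorem isChain_turns (q : ℤˣ × G × ℤˣ → Prop) (z : ℤˣ × G) (l : List (ℤˣ × G)) :
    List.IsChain (fun x y => q (x.1, x.2, y.1)) (l ++ [z]) ↔ ∀ w ∈ turns z.1 l, q w := by
  induction l with
  | nil => simp [turns]
  | cons x l ih =>
    rw [List.cons_append, List.isChain_cons, ih]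
    rcases l with _ | ⟨y, l⟩ <;> simp [turns, st]

theorem chain_ct (q : ℤˣ × G × ℤˣ → Prop) (l : List (ℤˣ × G)) :
    Cycle.Chain (fun x y => q (x.1, x.2, y.1)) (l : Cycle (ℤˣ × G)) ↔ ∀ w ∈ ct l, q w := by
  rcases l with _ | ⟨x, l⟩
  · simp [ct, turns]
  · rw [Cycle.chain_coe_cons, ← List.cons_append, isChain_turns]
    rfl

theorem ct_rot {l l' : List (ℤˣ × G)} (h : l.IsRotated l') : ∀ w ∈ ct l, w ∈ ct l' := by
  have := (chain_ct (fun w => w ∈ ct l') l').2 (fun w hw => hw)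
  rw [← Cycle.coe_eq_coe.2 h, chain_ct] at this
  exact this

theorem CC_iff (l : List (ℤˣ × G)) : CC l ↔ ∀ w ∈ ct l, w.2.1 = 1 → w.1 = w.2.2 :=
  chain_ct (fun w => w.2.1 = 1 → w.1 = w.2.2) l

section Auto

variable (φ : G ≃* G) (a b : G)

/-- left part -/
def al (e : ℤˣ) : G := if e = 1 then a else b⁻¹
/-- right part -/
def be (e : ℤˣ) : G := if e = 1 then b else a⁻¹

theorem al_neg (e : ℤˣ) : al a b (-e) = (be a b e)⁻¹ := by
  rcases Int.units_eq_one_or e with rfl | rfl <;> simp [al, be]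

/-- action on turns -/
def ta (w : ℤˣ × G × ℤˣ) : ℤˣ × G × ℤˣ := (w.1, be a b w.1 * φ w.2.1 * al a b w.2.2, w.2.2)

/-- action on words -/
def T (e : ℤˣ) : List (ℤˣ × G) → List (ℤˣ × G)
  | [] => []
  | x :: m => (x.1, be a b x.1 * φ x.2 * al a b (st e m)) :: T e m

/-- action on cyclic words -/
def Tc (l : List (ℤˣ × G)) : List (ℤˣ × G) := T φ a b (st 1 l) l

theorem st_T (e e' : ℤˣ) (l : List (ℤˣ × G)) : st e (T φ a b e' l) = st e l := by
  cases l <;> rfl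

theorem T_length (e : ℤˣ) (l : List (ℤˣ × G)) : (T φ a b e l).length = l.length := by
  induction l with
  | nil => rfl
  | cons x l ih => simp [T, ih]

theorem turns_T (e : ℤˣ) (l : List (ℤˣ × G)) :
    turns e (T φ a b e l) = (turns e l).map (ta φ a b) := by
  induction l with
  | nil => rfl
  | cons x l ih => simp [T, turns, ih, st_T, ta]

theorem ct_Tc (l : List (ℤˣ × G)) : ct (Tc φ a b l) = (ct l).map (ta φ a b) := by
  unfold ct Tc
  rw [st_T, turns_T]

theorem CC.Tc {l : List (ℤˣ × G)} (h : CC l) : CC (Tc φ a b l) := by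
  rw [CC_iff] at *
  rw [ct_Tc]
  intro w hw
  obtain ⟨w', hw', rfl⟩ := List.mem_map.1 hw
  intro h1
  by_contra h2
  have h3 : w'.2.2 = - w'.1 := by
    simp only [ta] at h2
    rcases Int.units_eq_one_or w'.1 with h3 | h3 <;>
    rcases Int.units_eq_one_or w'.2.2 with h4 | h4 <;> simp_all
  simp only [ta, h3, al_neg] at h1
  have h4 : φ w'.2.1 = 1 := conj_eq_one_iff.1 h1
  exact h2 (h w' hw' (by simpa using h4))

variable {φ a b} {Φ : F ≃* F}

theorem map_T (hΦ : ∀ g, Φ (i g) = i (φ g)) (ht : Φ t = i a * t * i b) (e : ℤˣ)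
    (l : List (ℤˣ × G)) :
    Φ (P i t l) = i (al a b (st e l)) * P i t (T φ a b e l) * (i (al a b e))⁻¹ := by
  have hz : ∀ e : ℤˣ, Φ (t ^ (e : ℤ)) = i (al a b e) * t ^ (e : ℤ) * i (be a b e) := by
    intro e
    rcases Int.units_eq_one_or e with rfl | rfl
    · simp [al, be, ht]
    · simp [al, be, ht, mul_assoc]
  induction l with
  | nil => simp [T, st]
  | cons x l ih =>
    rw [P_cons, map_mul, ih, map_mul, hz, hΦ]
    simp [T, st, mul_assoc]

theorem conj_Tc (hΦ : ∀ g, Φ (i g) = i (φ g)) (ht : Φ t = i a * t * i b)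
    (l : List (ℤˣ × G)) : IsConj (Φ (P i t l)) (P i t (Tc φ a b l)) := by
  rcases l with _ | ⟨x, l⟩
  · simp [Tc, T]
  · rw [map_T hΦ ht x.1]
    exact (isConj_iff.2 ⟨i (al a b x.1), rfl⟩ : IsConj (P i t (Tc φ a b (x :: l))) _).symm

theorem iter (hΦ : ∀ g, Φ (i g) = i (φ g)) (ht : Φ t = i a * t * i b) (n : ℕ)
    (l : List (ℤˣ × G)) (hl : CC l) : ∃ l' : List (ℤˣ × G), l'.length = l.length ∧ CC l' ∧
      ct l' = (ct l).map (ta φ a b)^[n] ∧ IsConj (Φ^[n] (P i t l)) (P i t l') := by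
  induction n with
  | zero => exact ⟨l, rfl, hl, by simp, IsConj.refl _⟩
  | succ n ih =>
    obtain ⟨l', h1, h2, h3, h4⟩ := ih
    refine ⟨Tc φ a b l', ?_, h2.Tc φ a b, ?_, ?_⟩
    · rw [Tc, T_length, h1]
    · rw [ct_Tc, h3, List.map_map, Function.iterate_succ']
    · rw [Function.iterate_succ', Function.comp]
      refine IsConj.trans ?_ (conj_Tc hΦ ht l')
      exact Φ.toMonoidHom.map_isConj h4

theorem ta_inj : Function.Injective (ta φ a b) := by
  rintro ⟨e, x, f⟩ ⟨e', x', f'⟩ h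
  simp only [ta, Prod.mk.injEq] at h
  obtain ⟨rfl, h2, rfl⟩ := h
  simpa using h2

theorem periodic (h : FP i t) (hΦ : ∀ g, Φ (i g) = i (φ g)) (ht : Φ t = i a * t * i b) {n : ℕ}
    (hn : 1 ≤ n) {l : List (ℤˣ × G)} (hl : CC l) (h0 : l ≠ [])
    (hc : IsConj (Φ^[n] (P i t l)) (P i t l)) :
    ∀ w ∈ ct l, ∃ m, 1 ≤ m ∧ (ta φ a b)^[m] w = w := by
  obtain ⟨l', h1, h2, h3, h4⟩ := iter hΦ ht n l hl
  obtain ⟨u, hu⟩ := isConj_iff.1 (hc.symm.trans h4)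
  have hrot : l.IsRotated l' := collins h u l l' hl h2 h1.symm h0 (by rw [← hu]; simp)
  have hmap : ∀ w ∈ ct l, (ta φ a b)^[n] w ∈ ct l := by
    intro w hw
    apply ct_rot hrot.symm
    rw [h3]
    exact List.mem_map_of_mem hw
  intro w hw
  let f : {w // w ∈ ct l} → {w // w ∈ ct l} := fun w => ⟨(ta φ a b)^[n] w.1, hmap _ w.2⟩
  have hf : Function.Injective f := by
    intro x y hxy
    have := congrArg Subtype.val hxy
    exact Subtype.ext ((ta_inj.iterate n) this)
  have : Finite {w // w ∈ ct l} := List.finite_toSet (ct l)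
  obtain ⟨m, hm, hp⟩ := hf.mem_periodicPts ⟨w, hw⟩
  refine ⟨n * m, Nat.mul_pos hn hm, ?_⟩
  have hfi : ∀ k (x : {w // w ∈ ct l}), (f^[k] x).1 = ((ta φ a b)^[n])^[k] x.1 := by
    intro k
    induction k with
    | zero => intro x; rfl
    | succ k ih => intro x; rw [Function.iterate_succ_apply, ih, Function.iterate_succ_apply]
  rw [Function.iterate_mul]
  have := congrArg Subtype.val hp
  rwa [hfi] at this

theorem ta_form (φ : G ≃* G) (a b : G) (m : ℕ) : ∃ c d : ℤˣ → G, (∀ e, d (-e) = (c e)⁻¹) ∧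
    ∀ e x e', (ta φ a b)^[m] (e, x, e') = (e, c e * φ^[m] x * d e', e') := by
  induction m with
  | zero => exact ⟨1, 1, by simp, by simp⟩
  | succ m ih =>
    obtain ⟨c, d, h1, h2⟩ := ih
    refine ⟨fun e => be a b e * φ (c e), fun e => φ (d e) * al a b e, ?_, ?_⟩
    · intro e
      simp [h1, al_neg]
    · intro e x e'
      rw [Function.iterate_succ', Function.comp, h2]
      simp [ta, mul_assoc, Function.iterate_succ_apply']

/-- the restriction is atoroidal -/
def At (φ : G ≃* G) : Prop := ∀ n : ℕ, 1 ≤ n → ∀ x : G, x ≠ 1 → ∀ c : G, c * φ^[n] x * c⁻¹ ≠ x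

/-- periodic turns -/
def Per (φ : G ≃* G) (a b : G) (w : ℤˣ × G × ℤˣ) : Prop := ∃ m, 1 ≤ m ∧ (ta φ a b)^[m] w = w

theorem per_sign (hA : At φ) {e e' : ℤˣ} {x : G} (hx : x = 1 → e = e')
    (hp : Per φ a b (e, x, e')) : e = e' := by
  by_contra hne
  have h3 : e' = -e := by
    rcases Int.units_eq_one_or e with h3 | h3 <;>
    rcases Int.units_eq_one_or e' with h4 | h4 <;> simp_all
  subst h3
  obtain ⟨m, hm, hp⟩ := hp
  obtain ⟨c, d, h1, h2⟩ := ta_form φ a b m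
  rw [h2, h1] at hp
  simp only [Prod.mk.injEq, true_and, and_true] at hp
  exact hA m hm x (fun h => hne (hx h)) _ hp

theorem per_unique (hA : At φ) {x y : G} (hx : Per φ a b (1, x, 1)) (hy : Per φ a b (1, y, 1)) :
    x = y := by
  obtain ⟨m, hm, hx⟩ := hx
  obtain ⟨n, hn, hy⟩ := hy
  have hx' : (ta φ a b)^[m * n] (1, x, 1) = (1, x, 1) := by
    rw [Function.iterate_mul]; exact Function.iterate_fixed hx n
  have hy' : (ta φ a b)^[m * n] (1, y, 1) = (1, y, 1) := by
    rw [mul_comm, Function.iterate_mul]; exact Function.iterate_fixed hy m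
  obtain ⟨c, d, h1, h2⟩ := ta_form φ a b (m * n)
  rw [h2] at hx' hy'
  simp only [Prod.mk.injEq, true_and, and_true] at hx' hy'
  by_contra hne
  refine hA (m * n) (Nat.mul_pos hm hn) (x * y⁻¹) (by rwa [ne_eq, mul_inv_eq_one]) (c 1) ?_
  have : φ^[m * n] (x * y⁻¹) = φ^[m * n] x * (φ^[m * n] y)⁻¹ := by
    rw [iterate_map_mul, iterate_map_inv]
  rw [this]
  conv_rhs => rw [← hx', ← hy']
  group

theorem per_neg {x : G} (hx : Per φ a b (-1, x, -1)) : Per φ a b (1, x⁻¹, 1) := by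
  obtain ⟨m, hm, hx⟩ := hx
  refine ⟨m, hm, ?_⟩
  obtain ⟨c, d, h1, h2⟩ := ta_form φ a b m
  rw [h2] at hx ⊢
  simp only [Prod.mk.injEq, true_and, and_true] at hx ⊢
  have e1 := h1 1
  have e2 := h1 (-1)
  rw [neg_neg] at e2
  rw [iterate_map_inv, e2]
  conv_rhs => rw [← hx, e1]
  simp [mul_assoc]

theorem per_fixed (hA : At φ) {x : G} (hx : Per φ a b (1, x, 1)) : b * φ x * a = x := by
  have h1 : ta φ a b (1, x, 1) = (1, b * φ x * a, 1) := by simp [ta, be, al]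
  have h2 : Per φ a b (1, b * φ x * a, 1) := by
    obtain ⟨m, hm, hx⟩ := hx
    refine ⟨m, hm, ?_⟩
    rw [← h1, ← Function.iterate_succ_apply, Function.iterate_succ_apply', hx]
  exact per_unique hA h2 hx

theorem eq_replicate (x : ℤˣ → G) (e : ℤˣ) (l : List (ℤˣ × G))
    (h : ∀ w ∈ turns e l, w.1 = w.2.2 ∧ w.2.1 = x w.1) : l = List.replicate l.length (e, x e) := by
  induction l with
  | nil => rfl
  | cons y l ih =>
    have h1 := ih (fun w hw => h w (by simp [turns, hw]))
    have h2 := h (y.1, y.2, st e l) (by simp [turns])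
    have h3 : st e l = e := by
      rw [h1]
      cases l.length <;> rfl
    simp only [h3] at h2
    rw [List.length_cons, List.replicate_succ, ← h1, ← h2.1, ← h2.2]

/-- Main dichotomy: a periodic class gives a periodic turn, and is a power. -/
theorem main_class (h : FP i t) (hΦ : ∀ g, Φ (i g) = i (φ g)) (ht : Φ t = i a * t * i b)
    (hA : At φ) {n : ℕ} (hn : 1 ≤ n) {f : F} (hf : f ≠ 1) (hc : IsConj (Φ^[n] f) f) :
    ∃ x : G, Per φ a b (1, x, 1) ∧ ∃ m : ℤ, m ≠ 0 ∧ IsConj f ((t * i x) ^ m) := by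
  have hΦn : ∀ f', IsConj f f' → IsConj (Φ^[n] f') f' := by
    intro f' hf'
    obtain ⟨u, rfl⟩ := isConj_iff.1 hf'
    refine IsConj.trans ?_ (hc.trans hf')
    rw [iterate_map_mul, iterate_map_mul, iterate_map_inv]
    exact (isConj_iff.2 ⟨Φ^[n] u, rfl⟩ : IsConj (Φ^[n] f) _).symm
  rcases conj_class h f with ⟨g, hg⟩ | ⟨l, h0, hl, hfl⟩
  · exfalso
    have hg1 : g ≠ 1 := by
      rintro rfl
      rw [map_one, isConj_one_left] at hg
      exact hf hg
    have h1 := hΦn _ hg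
    have h2 : ∀ k, Φ^[k] (i g) = i (φ^[k] g) := by
      intro k
      induction k with
      | zero => rfl
      | succ k ih => rw [Function.iterate_succ_apply', ih, hΦ, Function.iterate_succ_apply']
    rw [h2] at h1
    obtain ⟨c, hc⟩ := malnormal h hg1 h1
    exact hA n hn g hg1 c hc
  · have hper := periodic h hΦ ht hn hl h0 (hΦn _ hfl)
    have hsame : ∀ w ∈ ct l, w.1 = w.2.2 := by
      rintro ⟨e, x, e'⟩ hw
      exact per_sign hA ((CC_iff l).1 hl _ hw) (hper _ hw)
    have hper' : ∀ w ∈ ct l, Per φ a b (1, if w.1 = 1 then w.2.1 else w.2.1⁻¹, 1) := by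
      rintro ⟨e, x, e'⟩ hw
      have h1 := hper _ hw
      have h2 := hsame _ hw
      simp only at h2
      subst h2
      rcases Int.units_eq_one_or e with rfl | rfl
      · simpa [Per] using h1
      · have := per_neg h1
        simpa using this
    rcases l with _ | ⟨y, l⟩
    · exact absurd rfl h0
    obtain ⟨x0, hx0⟩ : ∃ x, Per φ a b (1, x, 1) := ⟨_, hper' (y.1, y.2, st y.1 l) (by
      simp [ct, turns, st])⟩
    refine ⟨x0, hx0, ?_⟩
    let xx : ℤˣ → G := fun e => if e = 1 then x0 else x0⁻¹
    have hall : ∀ w ∈ turns y.1 (y :: l), w.1 = w.2.2 ∧ w.2.1 = xx w.1 := by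
      intro w hw
      refine ⟨hsame w hw, ?_⟩
      have := per_unique hA (hper' w hw) hx0
      rcases Int.units_eq_one_or w.1 with h1 | h1
      · simpa [h1, xx] using this
      · simp only [h1, xx] at this ⊢
        simp at this ⊢
        rw [← this, inv_inv]
    have hrep := eq_replicate xx y.1 _ hall
    have hP : P i t (y :: l) = (t ^ (y.1 : ℤ) * i (xx y.1)) ^ (l.length + 1) := by
      rw [hrep]
      simp [P]
    rw [hP] at hfl
    rcases Int.units_eq_one_or y.1 with h1 | h1
    · refine ⟨(l.length + 1 : ℕ), by omega, ?_⟩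
      rw [zpow_natCast]
      simpa [h1, xx] using hfl
    · refine ⟨-(l.length + 1 : ℕ), by omega, ?_⟩
      refine hfl.trans ?_
      rw [zpow_neg, zpow_natCast, ← inv_pow]
      refine IsConj.pow _ ?_
      refine isConj_iff.2 ⟨(i x0)⁻¹, ?_⟩
      simp [h1, xx, mul_assoc]

end Auto

end CorankOne

/-- An automorphism of `F_N` in `IA_N(ℤ/3)` preserving a co-rank `1` free factor
`A` and restricting to an atoroidal automorphism of `A` is either atoroidal, or
fixes the conjugacy class of a nontrivial root-free element `g`, all periodic
conjugacy classes are powers of `g`, and `F_N = A ∗ ⟨g'⟩` for some conjugate `g'`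
of `g`. -/
theorem statement_4 (N : ℕ) (hN : 3 ≤ N)
    (Φ : MulAut (FreeGroup (Fin N)))
    (hIA : (piMod3 N).comp Φ.toMonoidHom = piMod3 N)
    (A : Subgroup (FreeGroup (Fin N)))
    (hcorank : IsCorankOneFreeFactor A)
    (hinv : A.map Φ.toMonoidHom = A)
    (hres : RestrictionAtoroidal Φ A) :
    MulAut.Atoroidal Φ ∨
      ∃ g : FreeGroup (Fin N), g ≠ 1 ∧
        (∀ (h : FreeGroup (Fin N)) (k : ℕ), 2 ≤ k → g ≠ h ^ k) ∧
        IsConj (Φ g) g ∧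
        (∀ h : FreeGroup (Fin N), h ≠ 1 →
          (∃ n : ℕ, 1 ≤ n ∧ IsConj ((Φ ^ n) h) h) →
          ∃ m : ℤ, m ≠ 0 ∧ IsConj h (g ^ m)) ∧
        ∃ g' : FreeGroup (Fin N), IsConj g' g ∧
          Function.Bijective
            ⇑(Monoid.Coprod.lift A.subtype (Subgroup.zpowers g').subtype) := by
  classical
  obtain ⟨t, htf, hb⟩ := hcorank
  have h : CorankOne.FP A.subtype t := CorankOne.fp_of_coprod htf hb
  let φ : A ≃* A := (Φ.subgroupMap A).trans (MulEquiv.subgroupCongr hinv)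
  have hΦ : ∀ g : A, Φ (A.subtype g) = A.subtype (φ g) := fun g => rfl
  have hit : ∀ (n : ℕ) (f : FreeGroup (Fin N)), (Φ ^ n) f = Φ^[n] f := by
    intro n
    induction n with
    | zero => intro f; rfl
    | succ n ih => intro f; rw [pow_succ, MulAut.mul_apply, ih, Function.iterate_succ_apply]
  have hiA : ∀ (n : ℕ) (x : A), Φ^[n] (x : FreeGroup (Fin N)) = ((φ^[n] x : A) : _) := by
    intro n
    induction n with
    | zero => intro f; rfl
    | succ n ih =>
      intro f
      rw [Function.iterate_succ_apply, Function.iterate_succ_apply, ← ih]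
      rfl
  have hA : CorankOne.At φ := by
    intro n hn x hx c hc
    refine hres n hn x x.2 (by simpa using hx) ⟨c, c.2, ?_⟩
    rw [hit, hiA]
    exact congrArg Subtype.val hc
  -- the exponent sum modulo three is preserved
  obtain ⟨ε, hε1, hε2⟩ := CorankOne.exists_eps h
  let epsMod : FreeGroup (Fin N) →* Multiplicative (ZMod 3) :=
    (AddMonoidHom.toMultiplicative (Int.castAddHom (ZMod 3))).comp ε
  let γ : Multiplicative (Fin N → ZMod 3) →* Multiplicative (ZMod 3) :=
    AddMonoidHom.toMultiplicative
      { toFun := fun v => ∑ j, v j * Multiplicative.toAdd (epsMod (FreeGroup.of j))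
        map_zero' := by simp
        map_add' := fun v w => by simp [add_mul, Finset.sum_add_distrib] }
  have hγ : epsMod = γ.comp (piMod3 N) := by
    apply FreeGroup.ext_hom
    intro j
    apply Multiplicative.toAdd.injective
    simp [γ, piMod3, Pi.single_apply]
  have hmod : ∀ f, epsMod (Φ f) = epsMod f := by
    intro f
    rw [hγ]
    exact congrArg γ (DFunLike.congr_fun hIA f)
  have hmod_A : ∀ g : A, epsMod (A.subtype g) = 1 := by
    intro g
    simp only [epsMod, MonoidHom.comp_apply, hε1, map_one]
  have hmod_t : epsMod t = Multiplicative.ofAdd 1 := by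
    simp [epsMod, hε2]
  have hlen : CorankOne.len h (Φ t) = 1 := by
    apply CorankOne.auto_form h Φ φ hΦ
    intro a b v g he
    have h1 := congrArg epsMod he
    rw [hmod, hmod_t] at h1
    simp only [map_mul, map_inv, hmod_A] at h1
    simp only [mul_one, mul_inv_cancel] at h1
    exact absurd h1 (by decide)
  obtain ⟨a, l, hc, he, hn⟩ := CorankOne.exists_rep_len h (Φ t)
  rw [hlen, List.length_eq_one_iff] at hn
  obtain ⟨⟨e, b⟩, rfl⟩ := hn
  have ht : Φ t = A.subtype a * t * A.subtype b := by
    rcases Int.units_eq_one_or e with rfl | rfl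
    · rw [he]; simp [mul_assoc]
    · have h1 := congrArg epsMod he
      rw [hmod, hmod_t] at h1
      simp only [CorankOne.P_cons, CorankOne.P_nil, map_mul, map_one, hmod_A, map_zpow, hmod_t] at h1
      exact absurd h1 (by decide)
  by_cases hat : MulAut.Atoroidal Φ
  · exact Or.inl hat
  right
  unfold MulAut.Atoroidal at hat
  push Not at hat
  obtain ⟨n, hn, f, hf, hcf⟩ := hat
  rw [hit] at hcf
  obtain ⟨x, hx, -⟩ := CorankOne.main_class h hΦ ht hA hn hf hcf
  have hfix := CorankOne.per_fixed hA hx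
  have hεg : ε (t * A.subtype x) = Multiplicative.ofAdd 1 := by
    rw [map_mul, hε1, hε2, mul_one]
  refine ⟨t * A.subtype x, ?_, ?_, ?_, ?_, t * A.subtype x, IsConj.refl _, ?_⟩
  · intro h1
    rw [h1, map_one] at hεg
    exact absurd hεg (by decide)
  · intro y k hk h1
    rw [h1, map_pow] at hεg
    have h2 : (k : ℤ) * Multiplicative.toAdd (ε y) = 1 := by
      have := congrArg Multiplicative.toAdd hεg
      simpa using this
    have h3 := Int.eq_one_or_neg_one_of_mul_eq_one h2
    omega
  · refine isConj_iff.2 ⟨(A.subtype a)⁻¹, ?_⟩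
    conv_rhs => rw [← hfix]
    rw [map_mul, ht, hΦ]
    simp [mul_assoc]
  · rintro y hy ⟨k, hk, hyk⟩
    rw [hit] at hyk
    obtain ⟨x', hx', m, hm, hym⟩ := CorankOne.main_class h hΦ ht hA hk hy hyk
    rw [CorankOne.per_unique hA hx' hx] at hym
    exact ⟨m, hm, hym⟩
  · have := CorankOne.coprod_of_fp (h.mul (a := 1) (b := x))
    rwa [map_one, one_mul] at this
end

section
/- Let N ≥ 1 and let Φ be an automorphism of F_N = FreeGroup (Fin N) with π ∘ Φ = π (the mod-3 abelianization condition for IA_N(Z/3)). If g ∈ F_N and Φ^n(g) is conjugate to g for some integer n ≥ 1, then Φ(g) is conjugate to g. In other words, every periodic conjugacy class of an element of IA_N(Z/3) is fixed. -/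
namespace HM

section Lattice
variable {V : Type*} [AddCommGroup V] [Module ℚ V]

theorem lat_sep (L : Submodule ℤ V) (hfg : L.FG) (y : V)
    (h : ∀ m : ℕ, ∃ z ∈ L, y = (3 : ℤ) ^ m • z) : y = 0 := by
  obtain ⟨y0, hy0, h0⟩ := h 0
  have hy : y ∈ L := by simpa [h0] using hy0
  have : Module.Finite ℤ L := Module.Finite.iff_fg.mpr hfg
  have : Module.IsTorsionFree ℤ V := Module.IsTorsionFree.trans ℚ (S := ℤ)
  have key := Ideal.iInf_pow_smul_eq_bot_of_isTorsionFree (M := L) (Ideal.span {(3 : ℤ)})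
    (by rw [Ne, Ideal.span_singleton_eq_top]; decide)
  have : (⟨y, hy⟩ : L) ∈ (⨅ i : ℕ, Ideal.span {(3 : ℤ)} ^ i • ⊤ : Submodule ℤ L) := by
    rw [Submodule.mem_iInf]
    intro m
    obtain ⟨z, hz, e⟩ := h m
    have : (⟨y, hy⟩ : L) = (3 : ℤ) ^ m • ⟨z, hz⟩ := by
      ext; simpa using e
    rw [this]
    exact Submodule.smul_mem_smul (Ideal.pow_mem_pow (Ideal.mem_span_singleton_self _) _) trivial
  rw [key, Submodule.mem_bot] at this
  simpa using congrArg Subtype.val this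

theorem descend (L : Submodule ℤ V) (hfg : L.FG) (f : V →ₗ[ℚ] V)
    (h : ∀ y ∈ L, f y = 0 → ∃ z ∈ L, y = (3 : ℤ) • z) (y : V) (hy : y ∈ L) (hf : f y = 0) :
    y = 0 := by
  apply lat_sep L hfg
  have : ∀ m : ℕ, ∃ z ∈ L, y = (3 : ℤ) ^ m • z ∧ f z = 0 := by
    intro m
    induction m with
    | zero => exact ⟨y, hy, by simp, hf⟩
    | succ m ih =>
      obtain ⟨z, hz, e, hfz⟩ := ih
      obtain ⟨w, hw, e2⟩ := h z hz hfz
      refine ⟨w, hw, by rw [e, e2, smul_smul, pow_succ], ?_⟩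
      rw [e2, map_zsmul] at hfz
      have h3 : (3 : ℚ) • f w = 0 := by
        rw [← hfz]; norm_cast;
      simpa using h3
  intro m
  obtain ⟨z, hz, e, _⟩ := this m
  exact ⟨z, hz, e⟩

theorem norm_zero (L : Submodule ℤ V) (hfg : L.FG) (n : ℕ) : 1 ≤ n → ∀ T : V →ₗ[ℚ] V,
    (∀ y ∈ L, ∃ z ∈ L, T y = y + (3 : ℤ) • z) → ∀ y ∈ L,
    (∑ i ∈ Finset.range n, T ^ i) y = 0 → y = 0 := by
  have hpow : ∀ T : V →ₗ[ℚ] V,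
    (∀ y ∈ L, ∃ z ∈ L, T y = y + (3 : ℤ) • z) → ∀ i : ℕ, ∀ y ∈ L,
      ∃ z ∈ L, (T ^ i) y = y + (3 : ℤ) • z := by
    intro T hT i
    induction i with
    | zero => exact fun y hy => ⟨0, L.zero_mem, by simp⟩
    | succ i ih =>
      intro y hy
      obtain ⟨z, hz, e⟩ := ih y hy
      have hm : (T ^ i) y ∈ L := by rw [e]; exact L.add_mem hy (L.smul_mem _ hz)
      obtain ⟨w, hw, e2⟩ := hT _ hm
      refine ⟨z + w, L.add_mem hz hw, ?_⟩
      rw [pow_succ', Module.End.mul_apply, e2, e]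
      module
  induction n using Nat.strong_induction_on with
  | _ n ih =>
  intro hn T hT y hy h0
  by_cases h3 : 3 ∣ n
  · obtain ⟨m, rfl⟩ := h3
    have hfac : (∑ i ∈ Finset.range (3 * m), T ^ i) =
        (∑ i ∈ Finset.range m, (T ^ 3) ^ i) * (∑ i ∈ Finset.range 3, T ^ i) := by
      clear ih hn h0
      induction m with
      | zero => simp
      | succ m ihm =>
        rw [show 3 * (m + 1) = 3 * m + 1 + 1 + 1 by ring, Finset.sum_range_succ,
          Finset.sum_range_succ, Finset.sum_range_succ, ihm,
          Finset.sum_range_succ (fun i => (T ^ 3) ^ i), add_mul, ← pow_mul]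
        simp only [Finset.sum_range_succ, Finset.range_zero, Finset.sum_empty, mul_add, ← pow_add]
        simp [add_assoc]
    have hN3 : ∀ y ∈ L, ∃ z ∈ L, (∑ i ∈ Finset.range 3, T ^ i) y = (3 : ℤ) • (y + (3 : ℤ) • z) := by
      intro y hy
      obtain ⟨z, hz, e⟩ := hT y hy
      obtain ⟨w, hw, e2⟩ := hT z hz
      refine ⟨z + w, L.add_mem hz hw, ?_⟩
      simp only [Finset.sum_range_succ, Finset.range_zero, Finset.sum_empty, LinearMap.add_apply,
        pow_two, Module.End.mul_apply, pow_zero, pow_one, Module.End.one_apply, e, map_add, map_zsmul, e2,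
        zero_add]
      module
    rw [hfac, Module.End.mul_apply] at h0
    have hmem : (∑ i ∈ Finset.range 3, T ^ i) y ∈ L := by
      obtain ⟨z, hz, e⟩ := hN3 y hy
      rw [e]; exact L.smul_mem _ (L.add_mem hy (L.smul_mem _ hz))
    have := ih m (by omega) (by omega) (T ^ 3) (hpow T hT 3) _ hmem h0
    refine descend L hfg (∑ i ∈ Finset.range 3, T ^ i) ?_ y hy this
    intro y hy hf
    obtain ⟨z, hz, e⟩ := hN3 y hy
    rw [hf] at e
    have h3 : (3 : ℚ) • (y + (3 : ℤ) • z) = 0 := by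
      rw [e]; norm_cast
    have h4 : y + (3 : ℤ) • z = 0 := (smul_eq_zero.1 h3).resolve_left (by norm_num)
    exact ⟨-z, L.neg_mem hz, by rw [smul_neg]; exact eq_neg_of_add_eq_zero_left h4⟩
  · refine descend L hfg (∑ i ∈ Finset.range n, T ^ i) ?_ y hy h0
    intro y hy hf
    have hk : ∀ k : ℕ, ∃ z ∈ L, (∑ i ∈ Finset.range k, T ^ i) y = (k : ℤ) • y + (3 : ℤ) • z := by
      intro k
      induction k with
      | zero => exact ⟨0, L.zero_mem, by simp⟩
      | succ k ihk =>
        obtain ⟨z, hz, e⟩ := ihk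
        obtain ⟨w, hw, e2⟩ := hpow T hT k y hy
        refine ⟨z + w, L.add_mem hz hw, ?_⟩
        rw [Finset.sum_range_succ, LinearMap.add_apply, e, e2]
        push_cast
        module
    obtain ⟨z, hz, e⟩ := hk n
    rw [hf] at e
    have hc : IsCoprime (n : ℤ) 3 := by
      have := (Nat.Prime.coprime_iff_not_dvd Nat.prime_three).2 h3
      exact_mod_cast (Nat.isCoprime_iff_coprime.2 this.symm)
    obtain ⟨a, b, hab⟩ := hc
    refine ⟨b • y - a • z, L.sub_mem (L.smul_mem _ hy) (L.smul_mem _ hz), ?_⟩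
    have e3 : (n : ℤ) • y = -((3 : ℤ) • z) := eq_neg_of_add_eq_zero_left e.symm
    calc y = (a * n + b * 3) • y := by rw [hab, one_smul]
      _ = a • ((n : ℤ) • y) + (b * 3) • y := by module
      _ = _ := by rw [e3]; module
end Lattice

section GroupRing
set_option linter.unusedSectionVars false
variable {N : ℕ} {S : Type*} [Ring S] [Algebra ℚ S]

/-- The integral augmentation lattice. -/
def aug (o : FreeGroup (Fin N) →* S) : Submodule ℤ S :=
  Submodule.span ℤ (Set.range fun g => o g - 1)

/-- The span of additive commutators. -/
def commSpan (S : Type*) [Ring S] [Algebra ℚ S] : Submodule ℚ S :=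
  Submodule.span ℚ {z | ∃ a b : S, z = a * b - b * a}

/-- The filtration. -/
def filt (o : FreeGroup (Fin N) →* S) (k : ℕ) : Submodule ℚ S :=
  Submodule.span ℚ ((aug o ^ k : Submodule ℤ S) : Set S) ⊔ commSpan S

/-- The lattice spanned by the elements `x_i - 1`. -/
def genLat (o : FreeGroup (Fin N) →* S) : Submodule ℤ S :=
  Submodule.span ℤ (Set.range fun i => o (FreeGroup.of i) - 1)

/-- Exponent sums. -/
def expSum (N : ℕ) : FreeGroup (Fin N) →* Multiplicative (Fin N → ℤ) :=
  FreeGroup.lift fun i => Multiplicative.ofAdd (Pi.single i 1)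

variable (o : FreeGroup (Fin N) →* S)

theorem sub_one_mem_aug (g : FreeGroup (Fin N)) : o g - 1 ∈ aug o :=
  Submodule.subset_span ⟨g, rfl⟩

theorem mul_mem_aug_pow {a b : S} {i j : ℕ} (ha : a ∈ aug o ^ i) (hb : b ∈ aug o ^ j) :
    a * b ∈ aug o ^ (i + j) := by
  rw [pow_add]; exact Submodule.mul_mem_mul ha hb

theorem mul_mem_aug_sq {a b : S} (ha : a ∈ aug o) (hb : b ∈ aug o) : a * b ∈ aug o ^ 2 := by
  rw [pow_two]; exact Submodule.mul_mem_mul ha hb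

theorem linear_part (h : FreeGroup (Fin N)) :
    o h - 1 - ∑ i, (expSum N h).toAdd i • (o (FreeGroup.of i) - 1) ∈ aug o ^ 2 := by
  have hmul : ∀ x y : FreeGroup (Fin N),
      o x - 1 - ∑ i, (expSum N x).toAdd i • (o (FreeGroup.of i) - 1) ∈ aug o ^ 2 →
      o y - 1 - ∑ i, (expSum N y).toAdd i • (o (FreeGroup.of i) - 1) ∈ aug o ^ 2 →
      o (x * y) - 1 - ∑ i, (expSum N (x * y)).toAdd i • (o (FreeGroup.of i) - 1) ∈ aug o ^ 2 := by
    intro x y hx hy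
    have := (aug o ^ 2).add_mem ((aug o ^ 2).add_mem hx hy)
      (mul_mem_aug_sq o (sub_one_mem_aug o x) (sub_one_mem_aug o y))
    convert this using 1
    simp only [map_mul, toAdd_mul, Pi.add_apply, add_smul, Finset.sum_add_distrib]
    noncomm_ring
  have hof : ∀ i : Fin N, o (FreeGroup.of i) - 1 -
      ∑ j, (expSum N (FreeGroup.of i)).toAdd j • (o (FreeGroup.of j) - 1) = 0 := by
    intro i
    simp only [expSum, FreeGroup.lift_apply_of, toAdd_ofAdd]
    rw [Finset.sum_eq_single i]
    · simp
    · intro b _ hb; simp [hb]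
    · simp
  induction h using FreeGroup.induction_on with
  | C1 => simp
  | of i => rw [hof]; exact zero_mem _
  | inv_of i _ =>
    have h2 := mul_mem_aug_sq o (sub_one_mem_aug o (FreeGroup.of i))
      (sub_one_mem_aug o (FreeGroup.of i)⁻¹)
    have h3 := (aug o ^ 2).neg_mem h2
    convert h3 using 1
    have e : (o (FreeGroup.of i) - 1) * (o (FreeGroup.of i)⁻¹ - 1) =
      1 - o (FreeGroup.of i) - o (FreeGroup.of i)⁻¹ + 1 := by
      rw [sub_mul, mul_sub, ← map_mul]; simp
      abel
    rw [e]
    have := hof i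
    rw [sub_eq_zero] at this
    simp only [map_inv, toAdd_inv, Pi.neg_apply, neg_smul, Finset.sum_neg_distrib, ← this]
    abel
  | mul x y hx hy => exact hmul x y hx hy

theorem genLat_le : genLat o ≤ aug o := by
  apply Submodule.span_le.2
  rintro _ ⟨i, rfl⟩
  exact sub_one_mem_aug o _

theorem aug_le : aug o ≤ genLat o ⊔ aug o ^ 2 := by
  apply Submodule.span_le.2
  rintro _ ⟨g, rfl⟩
  have h := linear_part o g
  refine Submodule.mem_sup.2 ⟨_, ?_, _, h, add_sub_cancel _ _⟩
  exact Submodule.sum_mem _ fun i _ => Submodule.smul_mem _ _ (Submodule.subset_span ⟨i, rfl⟩)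

theorem aug_pow_le (j : ℕ) : aug o ^ j ≤ genLat o ^ j ⊔ aug o ^ (j + 1) := by
  induction j with
  | zero => simp
  | succ j ih =>
    rw [pow_succ]
    refine (mul_le_mul' ih (aug_le o)).trans ?_
    rw [Submodule.sup_mul, Submodule.mul_sup, Submodule.mul_sup]
    have hle : genLat o ^ j ≤ aug o ^ j := pow_le_pow_left' (genLat_le o) j
    refine sup_le (sup_le ?_ ?_) (sup_le ?_ ?_)
    · rw [← pow_succ]; exact le_sup_left
    · refine le_trans ?_ le_sup_right
      refine (mul_le_mul' hle le_rfl).trans ?_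
      rw [← pow_add]
    · refine le_trans ?_ le_sup_right
      refine (mul_le_mul' le_rfl (genLat_le o)).trans ?_
      rw [← pow_succ]
    · refine le_trans ?_ le_sup_right
      rw [← pow_add, show j + 1 + 2 = 1 + (j + 1 + 1) by ring, pow_add]
      have h1 : ∀ k, aug o * aug o ^ (k + 1) ≤ aug o ^ (k + 1) := by
        intro k
        rw [pow_succ', ← mul_assoc]
        refine mul_le_mul' ?_ le_rfl
        apply Submodule.mul_le.2
        intro a ha b hb
        induction ha using Submodule.span_induction with
        | mem x hx =>
          obtain ⟨g, rfl⟩ := hx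
          induction hb using Submodule.span_induction with
          | mem y hy =>
            obtain ⟨h, rfl⟩ := hy
            have : (o g - 1) * (o h - 1) = (o (g * h) - 1) - (o g - 1) - (o h - 1) := by
              rw [map_mul]; noncomm_ring
            simp only [this]
            exact sub_mem (sub_mem (sub_one_mem_aug o _) (sub_one_mem_aug o _))
              (sub_one_mem_aug o _)
          | zero => simp
          | add x y _ _ hx hy => rw [mul_add]; exact add_mem hx hy
          | smul r x _ hx => rw [mul_smul_comm]; exact Submodule.smul_mem _ _ hx
        | zero => simp
        | add x y _ _ hx hy => rw [add_mul]; exact add_mem hx hy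
        | smul r x _ hx => rw [smul_mul_assoc]; exact Submodule.smul_mem _ _ hx
      rw [pow_one]
      exact h1 (j + 1)

theorem three_dvd_expSum {h : FreeGroup (Fin N)} (hh : piMod3 N h = 1) (i : Fin N) :
    (3 : ℤ) ∣ (expSum N h).toAdd i := by
  have key : ∀ h : FreeGroup (Fin N),
      (piMod3 N h).toAdd = fun i => (((expSum N h).toAdd i : ℤ) : ZMod 3) := by
    intro h
    induction h using FreeGroup.induction_on with
    | C1 => ext; simp
    | of i =>
      ext j; simp only [piMod3, expSum, FreeGroup.lift_apply_of, toAdd_ofAdd, Pi.single_apply]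
      split_ifs <;> simp
    | inv_of i hi =>
      ext j
      have := congrFun hi j
      simp only [map_inv, toAdd_inv, Pi.neg_apply, this]
      push_cast; rfl
    | mul x y hx hy =>
      ext j
      simp only [map_mul, toAdd_mul, Pi.add_apply, hx, hy]
      push_cast; rfl
  have := congrFun (key h) i
  rw [hh] at this
  exact (ZMod.intCast_zmod_eq_zero_iff_dvd _ 3).1 (by simpa using this.symm)


theorem map_aug (Φ : FreeGroup (Fin N) →* FreeGroup (Fin N))
    (φ : S →ₐ[ℚ] S) (hφ : ∀ g, φ (o g) = o (Φ g))
    (j : ℕ) {x : S} (hx : x ∈ aug o ^ j) : φ x ∈ aug o ^ j := by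
  have h1 : ∀ x ∈ aug o, φ x ∈ aug o := by
    intro x hx
    induction hx using Submodule.span_induction with
    | mem x hx =>
      obtain ⟨g, rfl⟩ := hx
      simp only [map_sub, hφ, map_one]
      exact sub_one_mem_aug o _
    | zero => simp
    | add x y _ _ hx hy => rw [map_add]; exact add_mem hx hy
    | smul r x _ hx => rw [map_zsmul]; exact Submodule.smul_mem _ _ hx
  induction j generalizing x with
  | zero =>
    rw [pow_zero, Submodule.mem_one] at hx ⊢
    obtain ⟨y, rfl⟩ := hx
    exact ⟨y, by simp⟩
  | succ j ih =>
    rw [pow_succ] at hx ⊢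
    induction hx using Submodule.mul_induction_on' with
    | mem_mul_mem m hm n hn => rw [map_mul]; exact Submodule.mul_mem_mul (ih hm) (h1 n hn)
    | add x _ y _ hx hy => rw [map_add]; exact add_mem hx hy

theorem map_sub_self (Φ : FreeGroup (Fin N) →* FreeGroup (Fin N)) (hIA : (piMod3 N).comp Φ = piMod3 N)
    (φ : S →ₐ[ℚ] S) (hφ : ∀ g, φ (o g) = o (Φ g))
    (j : ℕ) {x : S} (hx : x ∈ aug o ^ j) :
    ∃ a ∈ aug o ^ j, ∃ b ∈ aug o ^ (j + 1), φ x = x + (3 : ℤ) • a + b := by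
  have hadd : ∀ (j : ℕ) (x y : S),
      (∃ a ∈ aug o ^ j, ∃ b ∈ aug o ^ (j + 1), φ x = x + (3 : ℤ) • a + b) →
      (∃ a ∈ aug o ^ j, ∃ b ∈ aug o ^ (j + 1), φ y = y + (3 : ℤ) • a + b) →
      (∃ a ∈ aug o ^ j, ∃ b ∈ aug o ^ (j + 1), φ (x + y) = (x + y) + (3 : ℤ) • a + b) := by
    rintro j x y ⟨a, ha, b, hb, e⟩ ⟨a', ha', b', hb', e'⟩
    refine ⟨a + a', add_mem ha ha', b + b', add_mem hb hb', ?_⟩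
    rw [map_add, e, e']; module
  have h1 : ∀ x ∈ aug o, ∃ a ∈ aug o, ∃ b ∈ aug o ^ 2, φ x = x + (3 : ℤ) • a + b := by
    intro x hx
    induction hx using Submodule.span_induction with
    | mem x hx =>
      obtain ⟨g, rfl⟩ := hx
      set h := Φ g * g⁻¹ with hh
      have hpi : piMod3 N h = 1 := by
        have : piMod3 N (Φ g) = piMod3 N g := DFunLike.congr_fun hIA g
        simp [hh, this]
      have hg : Φ g = h * g := by simp [hh]
      choose c hc using three_dvd_expSum hpi
      have hl := linear_part o h
      refine ⟨∑ i, c i • (o (FreeGroup.of i) - 1),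
        Submodule.sum_mem _ fun i _ => Submodule.smul_mem _ _ (sub_one_mem_aug o _), _,
        add_mem hl (mul_mem_aug_sq o (sub_one_mem_aug o h) (sub_one_mem_aug o g)), ?_⟩
      simp only [hc, mul_smul, ← Finset.smul_sum, map_sub, hφ, map_one, hg, map_mul]
      noncomm_ring
    | zero => exact ⟨0, zero_mem _, 0, zero_mem _, by simp⟩
    | add x y _ _ hx hy =>
      have := hadd 1 x y (by simpa using hx) (by simpa using hy)
      simpa using this
    | smul r x _ hx =>
      obtain ⟨a, ha, b, hb, e⟩ := hx
      refine ⟨r • a, Submodule.smul_mem _ _ ha, r • b, Submodule.smul_mem _ _ hb, ?_⟩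
      rw [map_zsmul, e]; module
  induction j generalizing x with
  | zero =>
    rw [pow_zero, Submodule.mem_one] at hx
    obtain ⟨y, rfl⟩ := hx
    exact ⟨0, zero_mem _, 0, zero_mem _, by simp⟩
  | succ j ih =>
    rw [pow_succ] at hx
    induction hx using Submodule.mul_induction_on' with
    | mem_mul_mem x hx y hy =>
      obtain ⟨a, ha, b, hb, e⟩ := ih hx
      obtain ⟨a', ha', b', hb', e'⟩ := h1 y hy
      have hy2 : φ y ∈ aug o ^ 1 := map_aug o Φ φ hφ 1 (by simpa using hy)
      have ha2 : a' ∈ aug o ^ 1 := by simpa using ha'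
      refine ⟨a * φ y + x * a', add_mem (mul_mem_aug_pow o ha hy2) (mul_mem_aug_pow o hx ha2),
        b * φ y + x * b', add_mem (mul_mem_aug_pow o hb hy2) (by
          have := mul_mem_aug_pow o hx hb'
          rwa [show j + 2 = j + 1 + 1 by ring] at this), ?_⟩
      rw [map_mul, e]
      have : x * φ y = x * y + (3 : ℤ) • (x * a') + x * b' := by
        rw [e', mul_add, mul_add, mul_smul_comm]
      rw [add_mul, add_mul, this, smul_mul_assoc]
      module
    | add x _ y _ hx hy => exact hadd _ _ _ hx hy

theorem conj_mem_comm {a b : FreeGroup (Fin N)} (h : IsConj a b) : o a - o b ∈ commSpan S := by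
  obtain ⟨c, rfl⟩ := isConj_iff.1 h
  refine Submodule.subset_span ⟨o c⁻¹, o (c * a), ?_⟩
  rw [← map_mul, ← map_mul]; simp

theorem map_filt (Φ : FreeGroup (Fin N) →* FreeGroup (Fin N))
    (φ : S →ₐ[ℚ] S) (hφ : ∀ g, φ (o g) = o (Φ g))
    (k : ℕ) : filt o k ≤ (filt o k).comap φ.toLinearMap := by
  refine sup_le ?_ ?_
  · apply Submodule.span_le.2
    intro x hx
    exact Submodule.mem_sup_left (Submodule.subset_span (map_aug o Φ φ hφ k hx))
  · apply Submodule.span_le.2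
    rintro x ⟨a, b, rfl⟩
    refine Submodule.mem_sup_right (Submodule.subset_span ⟨φ a, φ b, by simp⟩)

theorem exists_mul_mem (L : Submodule ℤ S) (x : S) (hx : x ∈ Submodule.span ℚ (L : Set S)) :
    ∃ m : ℕ, m ≠ 0 ∧ (m : ℤ) • x ∈ L := by
  induction hx using Submodule.span_induction with
  | mem x hx => exact ⟨1, one_ne_zero, by simpa using hx⟩
  | zero => exact ⟨1, one_ne_zero, by simp⟩
  | add x y _ _ hx hy =>
    obtain ⟨m, hm, h⟩ := hx
    obtain ⟨m', hm', h'⟩ := hy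
    refine ⟨m * m', mul_ne_zero hm hm', ?_⟩
    have : ((m * m' : ℕ) : ℤ) • (x + y) = (m' : ℤ) • ((m : ℤ) • x) + (m : ℤ) • ((m' : ℤ) • y) := by
      push_cast; module
    rw [this]
    exact add_mem (L.smul_mem _ h) (L.smul_mem _ h')
  | smul r x _ hx =>
    obtain ⟨m, hm, h⟩ := hx
    refine ⟨m * r.den, mul_ne_zero hm r.den_nz, ?_⟩
    have : ((m * r.den : ℕ) : ℤ) • (r • x) = r.num • ((m : ℤ) • x) := by
      have e : ∀ (z : ℤ) (y : S), z • y = (z : ℚ) • y := fun z y => (Int.cast_smul_eq_zsmul ℚ z y).symm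
      rw [e, e, e, smul_smul, smul_smul]
      congr 1
      have := Rat.mul_den_eq_num r
      push_cast
      rw [← this]; ring
    rw [this]
    exact L.smul_mem _ h

theorem step (Φ : FreeGroup (Fin N) →* FreeGroup (Fin N)) (hIA : (piMod3 N).comp Φ = piMod3 N)
    (φ : S →ₐ[ℚ] S) (hφ : ∀ g, φ (o g) = o (Φ g))
    (n : ℕ) (hn : 1 ≤ n) (g : FreeGroup (Fin N)) (hper : IsConj ((Φ^[n]) g) g) (j : ℕ)
    (hj : o (Φ g) - o g ∈ filt o j) : o (Φ g) - o g ∈ filt o (j + 1) := by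
  set E := filt o (j + 1) with hE
  let T : (S ⧸ E) →ₗ[ℚ] (S ⧸ E) := E.mapQ E φ.toLinearMap (map_filt o Φ φ hφ _)
  let q : S →ₗ[ℚ] (S ⧸ E) := E.mkQ
  let L : Submodule ℤ (S ⧸ E) := (genLat o ^ j).map (q.restrictScalars ℤ)
  have hTq : ∀ x, T (q x) = q (φ x) := fun x => rfl
  have hTqi : ∀ (i : ℕ) (h : FreeGroup (Fin N)), (T ^ i) (q (o h)) = q (o (Φ^[i] h)) := by
    intro i
    induction i with
    | zero => intro h; simp
    | succ i ih => intro h; rw [pow_succ, Module.End.mul_apply, hTq, hφ, ih]; simp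
  have hq0 : ∀ x ∈ aug o ^ (j + 1), q x = 0 := by
    intro x hx
    exact (Submodule.Quotient.mk_eq_zero E).2 (Submodule.mem_sup_left (Submodule.subset_span hx))
  have hqc : ∀ x ∈ commSpan S, q x = 0 := by
    intro x hx
    exact (Submodule.Quotient.mk_eq_zero E).2 (Submodule.mem_sup_right hx)
  have hqL : ∀ x ∈ aug o ^ j, q x ∈ L := by
    intro x hx
    obtain ⟨a, ha, b, hb, rfl⟩ := Submodule.mem_sup.1 (aug_pow_le o j hx)
    rw [map_add, hq0 b hb, add_zero]
    exact ⟨a, ha, rfl⟩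
  have hfg : L.FG := by
    apply Submodule.FG.map
    apply Submodule.FG.pow
    exact Submodule.fg_span (Set.finite_range _)
  have hT : ∀ y ∈ L, ∃ z ∈ L, T y = y + (3 : ℤ) • z := by
    rintro _ ⟨x, hx, rfl⟩
    have hx' : x ∈ aug o ^ j := pow_le_pow_left' (genLat_le o) j hx
    obtain ⟨a, ha, b, hb, e⟩ := map_sub_self o Φ hIA φ hφ j hx'
    refine ⟨q a, hqL a ha, ?_⟩
    change T (q x) = q x + _
    rw [hTq, e, map_add, map_add, hq0 b hb, add_zero, map_zsmul]
  set u := q (o (Φ g) - o g) with hu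
  have hNu : (∑ i ∈ Finset.range n, T ^ i) u = 0 := by
    have : ∀ n : ℕ, (∑ i ∈ Finset.range n, T ^ i) u = q (o (Φ^[n] g)) - q (o g) := by
      intro n
      induction n with
      | zero => simp
      | succ n ih =>
        rw [Finset.sum_range_succ, LinearMap.add_apply, ih, hu, map_sub, map_sub, hTqi, hTqi]
        rw [Function.iterate_succ_apply]
        abel
    rw [this, ← map_sub]
    exact hqc _ (conj_mem_comm o hper)
  obtain ⟨a, ha, b, hb, hab⟩ := Submodule.mem_sup.1 hj
  obtain ⟨m, hm, hma⟩ := exists_mul_mem _ a ha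
  have hmu : (m : ℤ) • u ∈ L := by
    have : (m : ℤ) • u = q ((m : ℤ) • a) := by
      rw [hu, ← hab, map_add, hqc b hb, add_zero, map_zsmul]
    rw [this]; exact hqL _ hma
  have h0 := norm_zero L hfg n hn T hT _ hmu (by rw [map_zsmul, hNu, smul_zero])
  have hu0 : u = 0 := by
    rw [← Int.cast_smul_eq_zsmul ℚ] at h0
    exact (smul_eq_zero.1 h0).resolve_left (by exact_mod_cast hm)
  exact (Submodule.Quotient.mk_eq_zero E).1 hu0

theorem mem_filt (Φ : FreeGroup (Fin N) →* FreeGroup (Fin N)) (hIA : (piMod3 N).comp Φ = piMod3 N)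
    (φ : S →ₐ[ℚ] S) (hφ : ∀ g, φ (o g) = o (Φ g))
    (n : ℕ) (hn : 1 ≤ n) (g : FreeGroup (Fin N)) (hper : IsConj ((Φ^[n]) g) g)
    (j : ℕ) : o (Φ g) - o g ∈ filt o (j + 1) := by
  induction j with
  | zero =>
    refine Submodule.mem_sup_left (Submodule.subset_span ?_)
    rw [zero_add, pow_one]
    have := sub_mem (sub_one_mem_aug o (Φ g)) (sub_one_mem_aug o g)
    simpa using this
  | succ j ih => exact step o Φ hIA φ hφ n hn g hper _ ih

end GroupRing

section Trace
open PowerSeries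
variable {N : ℕ} {ι : Type*} [Fintype ι] [DecidableEq ι]

theorem rho_const (ρ : FreeGroup (Fin N) →* Matrix ι ι ℚ⟦X⟧)
    (hρ : ∀ i, (ρ (FreeGroup.of i)).map (constantCoeff (R := ℚ)) = 1) (g : FreeGroup (Fin N)) :
    (ρ g).map (constantCoeff (R := ℚ)) = 1 := by
  let h : FreeGroup (Fin N) →* Matrix ι ι ℚ :=
    ((constantCoeff (R := ℚ)).mapMatrix : Matrix ι ι ℚ⟦X⟧ →+* Matrix ι ι ℚ).toMonoidHom.comp ρ
  have : h = 1 := by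
    apply FreeGroup.ext_hom
    intro i
    exact hρ i
  exact DFunLike.congr_fun this g

theorem trace_eq (Φ : FreeGroup (Fin N) →* FreeGroup (Fin N))
    (hIA : (piMod3 N).comp Φ = piMod3 N)
    (n : ℕ) (hn : 1 ≤ n) (g : FreeGroup (Fin N)) (hper : IsConj ((Φ^[n]) g) g)
    (ρ : FreeGroup (Fin N) →* Matrix ι ι ℚ⟦X⟧)
    (hρ : ∀ i, (ρ (FreeGroup.of i)).map (constantCoeff (R := ℚ)) = 1) :
    (ρ (Φ g)).trace = (ρ g).trace := by
  let o : FreeGroup (Fin N) →* MonoidAlgebra ℚ (FreeGroup (Fin N)) := MonoidAlgebra.of ℚ _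
  let φ : MonoidAlgebra ℚ (FreeGroup (Fin N)) →ₐ[ℚ] MonoidAlgebra ℚ (FreeGroup (Fin N)) :=
    MonoidAlgebra.lift ℚ _ _ (o.comp Φ)
  have hφ : ∀ g, φ (o g) = o (Φ g) := fun g => by simp [φ, o]
  let R : MonoidAlgebra ℚ (FreeGroup (Fin N)) →ₐ[ℚ] Matrix ι ι ℚ⟦X⟧ :=
    MonoidAlgebra.lift ℚ _ _ ρ
  have hR : ∀ g, R (o g) = ρ g := fun g => by simp [R, o]
  have h1 : ∀ x ∈ aug o, ∀ v w, (PowerSeries.X : ℚ⟦X⟧) ∣ R x v w := by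
    intro x hx v w
    induction hx using Submodule.span_induction with
    | mem x hx =>
      obtain ⟨g, rfl⟩ := hx
      simp only [map_sub, hR, map_one]
      rw [X_dvd_iff, Matrix.sub_apply, map_sub]
      have := congrFun (congrFun (rho_const ρ hρ g) v) w
      rw [Matrix.map_apply] at this
      rw [this, Matrix.one_apply, Matrix.one_apply]
      split_ifs <;> simp
    | zero => simp
    | add x y _ _ hx hy => rw [map_add, Matrix.add_apply]; exact dvd_add hx hy
    | smul r x _ hx =>
      rw [map_zsmul, Matrix.smul_apply, zsmul_eq_mul]; exact Dvd.dvd.mul_left hx _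
  have hk : ∀ k : ℕ, ∀ x ∈ aug o ^ k, ∀ v w, (PowerSeries.X : ℚ⟦X⟧) ^ k ∣ R x v w := by
    intro k
    induction k with
    | zero => intro x _ v w; simp
    | succ k ih =>
      intro x hx v w
      rw [pow_succ] at hx
      induction hx using Submodule.mul_induction_on' with
      | mem_mul_mem x hx y hy =>
        rw [map_mul, Matrix.mul_apply]
        refine Finset.dvd_sum fun j _ => ?_
        rw [pow_succ]
        exact mul_dvd_mul (ih x hx v j) (h1 y hy j w)
      | add x _ y _ hx hy => rw [map_add, Matrix.add_apply]; exact dvd_add hx hy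
  have hf : ∀ k : ℕ, ∀ x ∈ filt o k, (PowerSeries.X : ℚ⟦X⟧) ^ k ∣ (R x).trace := by
    intro k x hx
    obtain ⟨a, ha, b, hb, rfl⟩ := Submodule.mem_sup.1 hx
    rw [map_add, Matrix.trace_add]
    clear hx
    refine dvd_add ?_ ?_
    · induction ha using Submodule.span_induction with
      | mem x hx => exact Finset.dvd_sum fun v _ => hk k x hx v v
      | zero => simp
      | add x y _ _ hx hy =>
        rw [map_add, Matrix.trace_add]
        exact dvd_add (hx) (hy)
      | smul r x _ hx =>
        rw [map_smul, Matrix.trace_smul, PowerSeries.smul_eq_C_mul]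
        exact Dvd.dvd.mul_left (hx) _
    · have : (R b).trace = 0 := by
        induction hb using Submodule.span_induction with
        | mem x hx =>
          obtain ⟨a, b, rfl⟩ := hx
          rw [map_sub, map_mul, map_mul, Matrix.trace_sub, Matrix.trace_mul_comm, sub_self]
        | zero => simp
        | add x y _ _ hx hy => rw [map_add, Matrix.trace_add, hx, hy, add_zero]
        | smul r x _ hx => rw [map_smul, Matrix.trace_smul, hx, smul_zero]
      rw [this]; exact dvd_zero _
  have hz : (R (o (Φ g) - o g)).trace = 0 := by
    ext m
    have := hf (m + 1) _ (mem_filt o Φ hIA φ hφ n hn g hper m)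
    rw [X_pow_dvd_iff] at this
    rw [this m (Nat.lt_succ_self m), map_zero]
  rw [map_sub, hR, hR, Matrix.trace_sub, sub_eq_zero] at hz
  exact hz
end Trace

section Chars
set_option linter.unusedSectionVars false
open PowerSeries

/-- The unit `1 + X`. -/
noncomputable def uX : ℚ⟦X⟧ˣ :=
  (PowerSeries.isUnit_iff_constantCoeff.2 (by simp) : IsUnit (1 + PowerSeries.X : ℚ⟦X⟧)).unit

theorem uX_val : (uX : ℚ⟦X⟧) = 1 + PowerSeries.X := rfl

theorem uX_zpow_const (n : ℤ) : constantCoeff (R := ℚ) ((uX ^ n : ℚ⟦X⟧ˣ) : ℚ⟦X⟧) = 1 := by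
  have h : Units.map (constantCoeff (R := ℚ) : ℚ⟦X⟧ →* ℚ) uX = 1 := by
    ext; simp [uX_val]
  have h2 : Units.map (constantCoeff (R := ℚ) : ℚ⟦X⟧ →* ℚ) (uX ^ n) = 1 := by
    rw [map_zpow, h, one_zpow]
  exact congrArg Units.val h2

theorem uX_npow_eq_one {n : ℕ} (h : uX ^ n = 1) : n = 0 := by
  have h1 := congrArg Units.val h
  rw [Units.val_pow_eq_pow_val, uX_val, Units.val_one] at h1
  have h2 : (1 + Polynomial.X : Polynomial ℚ) ^ n = 1 := by
    apply Polynomial.coe_injective ℚ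
    push_cast
    simpa using h1
  have := congrArg (fun p => Polynomial.coeff p 1) h2
  simp only [Polynomial.coeff_one_add_X_pow, Nat.choose_one_right, Polynomial.coeff_one] at this
  simpa using this

theorem uX_zpow_eq_one {n : ℤ} (h : uX ^ n = 1) : n = 0 := by
  obtain ⟨m, rfl | rfl⟩ := n.eq_nat_or_neg
  · rw [zpow_natCast] at h
    simpa using uX_npow_eq_one h
  · rw [zpow_neg, inv_eq_one, zpow_natCast] at h
    simpa using uX_npow_eq_one h

theorem uX_zpow_inj {n m : ℤ} (h : uX ^ n = uX ^ m) : n = m := by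
  have : uX ^ (n - m) = 1 := by rw [zpow_sub, h, mul_inv_cancel]
  have := uX_zpow_eq_one this
  omega

variable {κ : Type*} [Fintype κ] [DecidableEq κ]

/-- The characters `m ↦ (1+X)^{m·a}`. -/
noncomputable def chi (a : κ → ℤ) : Multiplicative (κ → ℤ) →* ℚ⟦X⟧ where
  toFun m := ((uX ^ (∑ j, m.toAdd j * a j) : ℚ⟦X⟧ˣ) : ℚ⟦X⟧)
  map_one' := by simp
  map_mul' x y := by
    simp only [toAdd_mul, Pi.add_apply, add_mul, Finset.sum_add_distrib, zpow_add, Units.val_mul]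

theorem chi_injective : Function.Injective (chi (κ := κ)) := by
  intro a b h
  ext j
  have := DFunLike.congr_fun h (Multiplicative.ofAdd (Pi.single j 1))
  have := uX_zpow_inj (Units.ext this)
  simpa [Pi.single_apply] using this

/-- The characters as a monoid homomorphism. -/
noncomputable def chiHom : Multiplicative (κ → ℤ) →* (Multiplicative (κ → ℤ) → ℚ⟦X⟧) where
  toFun a := chi a.toAdd
  map_one' := by ext m; simp [chi]
  map_mul' x y := by
    funext m
    simp only [chi, toAdd_mul, Pi.add_apply, mul_add, Finset.sum_add_distrib, zpow_add, Units.val_mul,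
      MonoidHom.coe_mk, OneHom.coe_mk, Pi.mul_apply]

/-- Evaluation of the group algebra. -/
noncomputable def evA : AddMonoidAlgebra ℚ⟦X⟧ (κ → ℤ) →ₐ[ℚ⟦X⟧] (Multiplicative (κ → ℤ) → ℚ⟦X⟧) :=
  AddMonoidAlgebra.lift ℚ⟦X⟧ _ _ chiHom

theorem evA_single (a : κ → ℤ) (m : κ → ℤ) :
    evA (AddMonoidAlgebra.single a 1) (Multiplicative.ofAdd m) =
      ((uX ^ (∑ j, m j * a j) : ℚ⟦X⟧ˣ) : ℚ⟦X⟧) := by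
  simp [evA, chiHom, chi]

theorem evA_injective : Function.Injective (evA (κ := κ)) := by
  rw [injective_iff_map_eq_zero]
  intro x hx
  have hli : LinearIndependent ℚ⟦X⟧ (fun a : κ → ℤ => (chi a : Multiplicative (κ → ℤ) → ℚ⟦X⟧)) :=
    (linearIndependent_monoidHom (Multiplicative (κ → ℤ)) ℚ⟦X⟧).comp chi chi_injective
  have := linearIndependent_iff.1 hli x.coeff (by
    rw [evA, AddMonoidAlgebra.lift_apply] at hx
    rw [Finsupp.linearCombination_apply]
    exact hx)
  ext1
  simpa using this

theorem coeff_prod (a e : κ → ℤ) (he : ∀ j, e j ≠ 0) :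
    (∏ j, (AddMonoidAlgebra.single (Pi.single j (a j)) (1 : ℚ⟦X⟧) - 1) :
      AddMonoidAlgebra ℚ⟦X⟧ (κ → ℤ)).coeff e =
      if a = e then 1 else 0 := by
  have hs : ∀ t : Finset κ, ∏ j ∈ t, (AddMonoidAlgebra.single (Pi.single j (a j) : κ → ℤ) (1 : ℚ⟦X⟧)) =
      AddMonoidAlgebra.single (∑ j ∈ t, Pi.single j (a j)) 1 := by
    intro t
    induction t using Finset.induction_on with
    | empty => simp [AddMonoidAlgebra.one_def]
    | insert j t hj ih =>
      rw [Finset.prod_insert hj, Finset.sum_insert hj, ih, AddMonoidAlgebra.single_mul_single, one_mul]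
  have hterm : ∀ t : Finset κ,
      ((∏ j ∈ t, (AddMonoidAlgebra.single (Pi.single j (a j) : κ → ℤ) (1 : ℚ⟦X⟧))) *
        ∏ j ∈ Finset.univ \ t, (-1)).coeff e =
      if t = Finset.univ then (if a = e then 1 else 0) else 0 := by
    intro t
    rw [hs, Finset.prod_const]
    have : (∑ j ∈ t, Pi.single j (a j) : κ → ℤ) = fun k => if k ∈ t then a k else 0 := by
      ext k
      simp [Finset.sum_apply, Pi.single_apply]
    rw [this]
    have hne : t ≠ Finset.univ → (fun k => if k ∈ t then a k else 0) ≠ e := by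
      intro ht heq
      apply ht
      rw [Finset.eq_univ_iff_forall]
      intro k
      by_contra hk
      have := congrFun heq k
      simp only [hk, if_false] at this
      exact he k this.symm
    split_ifs with h1 h2 h2
    · subst h1; simp [h2, Finsupp.single_apply]
    · subst h1; simp [h2, Finsupp.single_apply]
    · rcases neg_one_pow_eq_or (AddMonoidAlgebra ℚ⟦X⟧ (κ → ℤ)) (Finset.univ \ t).card with h | h <;>
      simp [h, Finsupp.single_apply, hne h1]
  simp only [sub_eq_add_neg]
  rw [Finset.prod_add, AddMonoidAlgebra.coeff_sum, Finset.sum_apply']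
  rw [Finset.sum_congr rfl (fun t _ => hterm t)]
  simp

end Chars

section Necklace
set_option linter.unusedSectionVars false
variable {N r : ℕ} [NeZero r] {R : Type*} [CommRing R]
  (i : ZMod r → Fin N) (c : ZMod r → Rˣ)

/-- Diagonal part. -/
def Dm (p : Fin N × ℤ) : Matrix (ZMod r) (ZMod r) R :=
  Matrix.diagonal fun v => if i (v - 1) = p.1 then ((c (v - 1) ^ p.2 : Rˣ) : R) else 1

/-- The weight of a step. -/
def wt (p : Fin N × ℤ) (v : ZMod r) : R :=
  if i v = p.1 then ((c v ^ p.2 : Rˣ) : R) - 1 else 0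

/-- Shift part. -/
def Um (p : Fin N × ℤ) : Matrix (ZMod r) (ZMod r) R :=
  Matrix.of fun v w => if w = v + 1 then wt i c p v else 0

/-- The matrix of the syllable `x^f`. -/
def Mm (b : R) (p : Fin N × ℤ) : Matrix (ZMod r) (ZMod r) R := Dm i c p + b • Um i c p

theorem Um_mul_apply (p : Fin N × ℤ) (A : Matrix (ZMod r) (ZMod r) R) (v w : ZMod r) :
    (Um i c p * A) v w = wt i c p v * A (v + 1) w := by
  rw [Matrix.mul_apply, Finset.sum_eq_single (v + 1)]
  · simp [Um]
  · intro x _ hx; simp [Um, hx]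
  · simp

theorem Mm_mul (hi : ∀ v, i v ≠ i (v + 1)) (b : R) (k : Fin N) (f f' : ℤ) :
    Mm i c b (k, f) * Mm i c b (k, f') = Mm i c b (k, f + f') := by
  have h1 : Dm i c (k, f) * Dm i c (k, f') = Dm i c (k, f + f') := by
    simp only [Dm, Matrix.diagonal_mul_diagonal]
    congr 1; ext v
    split_ifs
    · rw [zpow_add, Units.val_mul]
    · rw [one_mul]
  have h2 : Um i c (k, f) * Um i c (k, f') = 0 := by
    ext v w
    rw [Um_mul_apply]
    simp only [Um, Matrix.of_apply, wt]
    have := hi v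
    split_ifs <;> simp_all
  have h3 : Dm i c (k, f) * Um i c (k, f') + Um i c (k, f) * Dm i c (k, f') = Um i c (k, f + f') := by
    ext v w
    rw [Matrix.add_apply, Um_mul_apply, Dm, Matrix.diagonal_mul, Dm, Matrix.diagonal_apply]
    simp only [Um, Matrix.of_apply, wt]
    have h := hi (v - 1)
    rw [sub_add_cancel] at h
    by_cases hw : w = v + 1
    · subst hw
      simp only [if_true, add_sub_cancel_right]
      by_cases hv : i v = k
      · have : i (v - 1) ≠ k := by rw [← hv]; exact h
        simp only [this, hv, if_true, if_false, one_mul, zpow_add, Units.val_mul]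
        ring
      · simp [hv]
    · simp [hw, Ne.symm hw]
  simp only [Mm, add_mul, mul_add, Matrix.smul_mul, Matrix.mul_smul, h1, h2, smul_zero, add_zero,
    add_assoc]
  rw [← h3, smul_add, add_comm (b • (Um i c (k, f) * Dm i c (k, f')))]

theorem Mm_zero (b : R) (k : Fin N) : Mm i c b (k, 0) = 1 := by
  have h1 : Dm i c (k, 0) = 1 := by
    simp [Dm]
  have h2 : Um i c (k, 0) = 0 := by
    ext v w; simp [Um, wt]
  simp [Mm, h1, h2]

/-- The one-parameter group. -/
def MHom (hi : ∀ v, i v ≠ i (v + 1)) (b : R) (k : Fin N) :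
    Multiplicative ℤ →* Matrix (ZMod r) (ZMod r) R where
  toFun f := Mm i c b (k, f.toAdd)
  map_one' := Mm_zero i c b k
  map_mul' x y := by rw [toAdd_mul, Mm_mul i c hi]

/-- The representation. -/
def rep (hi : ∀ v, i v ≠ i (v + 1)) (b : R) : FreeGroup (Fin N) →* Matrix (ZMod r) (ZMod r) R :=
  (Units.coeHom _).comp (FreeGroup.lift fun k => (MHom i c hi b k).toHomUnits (Multiplicative.ofAdd 1))

theorem rep_zpow (hi : ∀ v, i v ≠ i (v + 1)) (b : R) (p : Fin N × ℤ) :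
    rep i c hi b (FreeGroup.of p.1 ^ p.2) = Mm i c b p := by
  simp only [rep, MonoidHom.comp_apply, map_zpow, FreeGroup.lift_apply_of]
  rw [← map_zpow ((MHom i c hi b p.1).toHomUnits), ← ofAdd_zsmul, smul_eq_mul, mul_one]
  rfl

/-- The value of a list of syllables. -/
def sval (l : List (Fin N × ℤ)) : FreeGroup (Fin N) :=
  (l.map fun p => FreeGroup.of p.1 ^ p.2).prod

theorem rep_sval (hi : ∀ v, i v ≠ i (v + 1)) (b : R) (l : List (Fin N × ℤ)) :
    rep i c hi b (sval l) = (l.map (Mm i c b)).prod := by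
  rw [sval, map_list_prod, List.map_map]
  congr 2
  funext p
  exact rep_zpow i c hi b p

theorem expand (l : List (Fin N × ℤ)) : ∃ A : ℕ → Matrix (ZMod r) (ZMod r) R,
    (∀ b, (l.map (Mm i c b)).prod = ∑ m ∈ Finset.range (l.length + 1), b ^ m • A m) ∧
    (∀ m v w, A m v w ≠ 0 → w = v + (m : ZMod r)) ∧
    A l.length = (l.map (Um i c)).prod ∧ ∀ m, l.length < m → A m = 0 := by
  induction l with
  | nil =>
    refine ⟨fun m => if m = 0 then 1 else 0, by simp, ?_, by simp, ?_⟩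
    · intro m v w h
      by_cases hm : m = 0
      · subst hm
        simp only [if_true, Matrix.one_apply] at h
        by_contra h'
        apply h
        rw [if_neg]
        intro e; apply h'; simp [e]
      · simp [hm] at h
    · intro m hm
      simp only [List.length_nil] at hm
      simp [hm.ne']
  | cons p l ih =>
    obtain ⟨A, h1, h2, h3, h4⟩ := ih
    refine ⟨fun m => Dm i c p * A m + (match m with | 0 => 0 | m + 1 => Um i c p * A m),
      ?_, ?_, ?_, ?_⟩
    · intro b
      rw [List.map_cons, List.prod_cons, h1, Mm, add_mul, List.length_cons]
      simp only [smul_add, Finset.sum_add_distrib]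
      congr 1
      · rw [Finset.sum_range_succ _ (l.length + 1), h4 _ (Nat.lt_succ_self _), Finset.mul_sum]
        simp
      · rw [Finset.sum_range_succ' _ (l.length + 1), Finset.mul_sum]
        simp only [smul_zero, add_zero]
        refine Finset.sum_congr rfl fun m _ => ?_
        rw [Matrix.smul_mul, Matrix.mul_smul, smul_smul, pow_succ']
    · intro m v w h
      by_contra hw
      apply h
      beta_reduce
      rw [Matrix.add_apply, Dm, Matrix.diagonal_mul]
      have e1 : A m v w = 0 := by
        by_contra h'; exact hw (h2 m v w h')
      rw [e1, mul_zero, zero_add]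
      cases m with
      | zero => simp
      | succ m =>
        simp only [Um_mul_apply]
        have e2 : A m (v + 1) w = 0 := by
          by_contra h'
          apply hw
          rw [h2 m _ _ h']; push_cast; ring
        rw [e2, mul_zero]
    · simp only [List.length_cons, List.map_cons, List.prod_cons, ← h3]
      rw [h4 _ (Nat.lt_succ_self _), mul_zero, zero_add]
    · intro m hm
      rw [List.length_cons] at hm
      cases m with
      | zero => omega
      | succ m => simp [h4 m (by omega), h4 (m + 1) (by omega)]

theorem prod_Um (l : List (Fin N × ℤ)) (v w : ZMod r) : (l.map (Um i c)).prod v w =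
    if w = v + (l.length : ZMod r) then
      ∏ k : Fin l.length, wt i c l[k] (v + ((k : ℕ) : ZMod r)) else 0 := by
  induction l generalizing v with
  | nil => simp [Matrix.one_apply, eq_comm]
  | cons p l ih =>
    rw [List.map_cons, List.prod_cons, Um_mul_apply, ih]
    have : v + 1 + (l.length : ZMod r) = v + ((p :: l).length : ZMod r) := by
      rw [List.length_cons]; push_cast; ring
    rw [this]
    split_ifs
    · simp only [List.length_cons]
      rw [Fin.prod_univ_succ]
      simp only [Fin.val_zero, Nat.cast_zero, add_zero, Fin.val_succ, Nat.cast_add, Nat.cast_one]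
      congr 1
      refine Finset.prod_congr rfl fun k _ => ?_
      rw [add_assoc, add_comm (1 : ZMod r)]
      rfl
    · simp

theorem trace_diff (hi : ∀ v, i v ≠ i (v + 1)) (l : List (Fin N × ℤ)) (hl : l.length ≤ r) :
    (rep i c hi 1 (sval l)).trace - (rep i c hi 0 (sval l)).trace =
      if l.length = r then
        ∑ v : ZMod r, ∏ k : Fin l.length, wt i c l[k] (v + ((k : ℕ) : ZMod r)) else 0 := by
  obtain ⟨A, h1, h2, h3, h4⟩ := expand i c l
  have hr : r ≠ 0 := NeZero.ne r
  have htr : ∀ m, 0 < m → m < r → (A m).trace = 0 := by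
    intro m hm hmr
    refine Finset.sum_eq_zero fun v _ => ?_
    by_contra h
    have := h2 m v v h
    have h0 : (m : ZMod r) = 0 := by simpa using this
    rw [ZMod.natCast_eq_zero_iff] at h0
    exact absurd (Nat.le_of_dvd hm h0) (by omega)
  have e1 : (rep i c hi 1 (sval l)).trace - (rep i c hi 0 (sval l)).trace =
      ∑ m ∈ Finset.range l.length, (A (m + 1)).trace := by
    rw [rep_sval, rep_sval, h1, h1, Finset.sum_range_succ', Finset.sum_range_succ']
    simp [Matrix.trace_sum]
  rw [e1]
  split_ifs with h
  · have hpos : 0 < l.length := by omega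
    obtain ⟨s, hs⟩ := Nat.exists_eq_succ_of_ne_zero hpos.ne'
    have : ∑ m ∈ Finset.range l.length, (A (m + 1)).trace = (A l.length).trace := by
      rw [hs, Finset.sum_range_succ, Finset.sum_eq_zero, zero_add]
      intro m hm
      rw [Finset.mem_range] at hm
      exact htr _ (by omega) (by omega)
    rw [this, h3]
    refine Finset.sum_congr rfl fun v _ => ?_
    rw [Matrix.diag_apply, prod_Um, if_pos]
    rw [h]; simp
  · refine Finset.sum_eq_zero fun m hm => ?_
    rw [Finset.mem_range] at hm
    exact htr _ (by omega) (by omega)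

end Necklace

section Combin
set_option linter.unusedSectionVars false
open PowerSeries
variable {N r : ℕ} [NeZero r]

/-- The formal version of a closed path weight. -/
noncomputable def pth (i : ZMod r → Fin N) (a : ZMod r → Fin N × ℤ) (v : ZMod r) :
    AddMonoidAlgebra ℚ⟦X⟧ (ZMod r → ℤ) :=
  ∏ j, (if i j = (a (j - v)).1 then
    AddMonoidAlgebra.single (Pi.single j (a (j - v)).2) 1 - 1 else 0)

theorem evA_pth (i : ZMod r → Fin N) (a : ZMod r → Fin N × ℤ) (v : ZMod r) (m : ZMod r → ℤ) :
    evA (pth i a v) (Multiplicative.ofAdd m) =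
      ∏ j, wt i (fun j => uX ^ m j) (a (j - v)) j := by
  rw [pth, map_prod, Finset.prod_apply]
  refine Finset.prod_congr rfl fun j _ => ?_
  rw [wt]
  split_ifs
  · rw [map_sub, Pi.sub_apply, evA_single, map_one, Pi.one_apply, ← zpow_mul]
    congr 3
    rw [Finset.sum_eq_single j]
    · simp
    · intro k _ hk; simp [hk]
    · simp
  · simp

theorem coeff_pth (i : ZMod r → Fin N) (a : ZMod r → Fin N × ℤ) (v : ZMod r) (e : ZMod r → ℤ)
    (he : ∀ j, e j ≠ 0) :
    (pth i a v).coeff e = if ∀ j, (i j, e j) = a (j - v) then 1 else 0 := by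
  by_cases h : ∀ j, i j = (a (j - v)).1
  · have : pth i a v = ∏ j, (AddMonoidAlgebra.single (Pi.single j (a (j - v)).2) (1 : ℚ⟦X⟧) - 1) := by
      refine Finset.prod_congr rfl fun j _ => ?_
      rw [if_pos (h j)]
    rw [this, coeff_prod (fun j => (a (j - v)).2) e he]
    congr 1
    rw [eq_iff_iff, funext_iff]
    refine forall_congr' fun j => ?_
    rw [Prod.ext_iff]
    exact ⟨fun h' => ⟨h j, h'.symm⟩, fun h' => h'.2.symm⟩
  · rw [if_neg (fun h' => h fun j => by rw [← h' j])]
    push Not at h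
    obtain ⟨j, hj⟩ := h
    have : pth i a v = 0 := Finset.prod_eq_zero (Finset.mem_univ j) (if_neg hj)
    rw [this]; simp

theorem combin (a : ZMod r → Fin N × ℤ) (ha : ∀ j, (a j).2 ≠ 0)
    (Y : AddMonoidAlgebra ℚ⟦X⟧ (ZMod r → ℤ))
    (h : ∀ m : ZMod r → ℤ,
      ∑ v, ∏ j, wt (fun j => (a j).1) (fun j => uX ^ m j) (a (j - v)) j =
        evA Y (Multiplicative.ofAdd m)) :
    Y.coeff (fun j => (a j).2) ≠ 0 := by
  have hY : ∑ v, pth (fun j => (a j).1) a v = Y := by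
    apply evA_injective
    funext m
    rw [← ofAdd_toAdd m, ← h, map_sum, Finset.sum_apply]
    exact Finset.sum_congr rfl fun v _ => evA_pth _ _ _ _
  rw [← hY, AddMonoidAlgebra.coeff_sum, Finset.sum_apply']
  have : CharZero ℚ⟦X⟧ := charZero_of_injective_algebraMap (algebraMap ℚ ℚ⟦X⟧).injective
  rw [Finset.sum_congr rfl (fun v _ => coeff_pth _ a v _ ha), Finset.sum_boole, Nat.cast_ne_zero]
  apply Finset.card_ne_zero_of_mem (a := 0)
  simp

theorem combin_zero (a : ZMod r → Fin N × ℤ) (ha : ∀ j, (a j).2 ≠ 0)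
    (h : ∀ m : ZMod r → ℤ,
      ∑ v, ∏ j, wt (fun j => (a j).1) (fun j => uX ^ m j) (a (j - v)) j = (0 : ℚ⟦X⟧)) : False :=
  combin a ha 0 (fun m => by rw [h, map_zero]; rfl) (by simp)

theorem combin_eq (a a' : ZMod r → Fin N × ℤ) (ha : ∀ j, (a j).2 ≠ 0)
    (h : ∀ m : ZMod r → ℤ,
      ∑ v, ∏ j, wt (fun j => (a j).1) (fun j => uX ^ m j) (a (j - v)) j =
      ∑ v, ∏ j, (wt (fun j => (a j).1) (fun j => uX ^ m j) (a' (j - v)) j : ℚ⟦X⟧)) :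
    ∃ v, ∀ j, a j = a' (j - v) := by
  have key := combin a ha (∑ v, pth (fun j => (a j).1) a' v) (fun m => by
    rw [h, map_sum, Finset.sum_apply]
    exact Finset.sum_congr rfl fun v _ => (evA_pth _ _ _ _).symm)
  rw [AddMonoidAlgebra.coeff_sum, Finset.sum_apply'] at key
  obtain ⟨v, -, hv⟩ := Finset.exists_ne_zero_of_sum_ne_zero key
  rw [coeff_pth _ _ _ _ ha] at hv
  exact ⟨v, by by_contra h'; exact hv (if_neg h')⟩

/-- The `v`-th entry of a list. -/
def ent (l : List (Fin N × ℤ)) (hl : l.length = r) (v : ZMod r) : Fin N × ℤ :=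
  l[v.val]'((ZMod.val_lt v).trans_eq hl.symm)

theorem reindex {R : Type*} [CommRing R] (i : ZMod r → Fin N) (c : ZMod r → Rˣ)
    (l : List (Fin N × ℤ)) (hl : l.length = r) (v : ZMod r) :
    ∏ k : Fin l.length, wt i c l[k] (v + ((k : ℕ) : ZMod r)) =
      ∏ j, wt i c (ent l hl (j - v)) j := by
  refine Finset.prod_bij' (fun k _ => v + ((k : ℕ) : ZMod r))
    (fun j _ => ⟨(j - v).val, (ZMod.val_lt (j - v)).trans_eq hl.symm⟩) (by simp) (by simp) ?_ ?_ ?_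
  · intro k _
    ext
    simp only [add_sub_cancel_left]
    exact ZMod.val_cast_of_lt (k.2.trans_eq hl)
  · intro j _
    simp
  · intro k _
    congr 1
    simp only [ent, add_sub_cancel_left, Fin.getElem_fin]
    congr 1
    exact (ZMod.val_cast_of_lt (k.2.trans_eq hl)).symm

theorem rotate_of_ent (l l' : List (Fin N × ℤ)) (hl : l.length = r) (hl' : l'.length = r)
    (v : ZMod r) (h : ∀ j, ent l hl j = ent l' hl' (j - v)) : l = l'.rotate (-v).val := by
  apply List.ext_getElem
  · rw [List.length_rotate, hl, hl']
  · intro k hk hk'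
    rw [List.getElem_rotate]
    have := h (k : ZMod r)
    simp only [ent, sub_eq_add_neg, ZMod.val_add, ZMod.val_cast_of_lt (hl ▸ hk : k < r)] at this
    simpa only [hl'] using this

theorem sval_cons (p : Fin N × ℤ) (l) : sval (p :: l) = FreeGroup.of p.1 ^ p.2 * sval l := by
  simp [sval]

theorem sval_append (l l' : List (Fin N × ℤ)) : sval (l ++ l') = sval l * sval l' := by
  simp [sval]

theorem sval_rotate (l : List (Fin N × ℤ)) (n : ℕ) : IsConj (sval l) (sval (l.rotate n)) := by
  induction n with
  | zero => rw [List.rotate_zero]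
  | succ n ih =>
    rw [← List.rotate_rotate]
    refine ih.trans ?_
    generalize l.rotate n = m
    cases m with
    | nil => rw [List.rotate_nil]
    | cons p m =>
      rw [List.rotate_cons_succ, List.rotate_zero, sval_cons, sval_append, sval_cons]
      rw [isConj_iff]
      exact ⟨(FreeGroup.of p.1 ^ p.2)⁻¹, by simp [sval]⟩

/-- Minimal length in the conjugacy class. -/
def Mini (l : List (Fin N × ℤ)) : Prop := ∀ l', IsConj (sval l) (sval l') → l.length ≤ l'.length

theorem exists_sval (g : FreeGroup (Fin N)) : ∃ l, sval l = g := by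
  induction g using FreeGroup.induction_on with
  | C1 => exact ⟨[], by simp [sval]⟩
  | of x => exact ⟨[(x, 1)], by simp [sval]⟩
  | inv_of x _ => exact ⟨[(x, -1)], by simp [sval]⟩
  | mul x y hx hy =>
    obtain ⟨l, rfl⟩ := hx
    obtain ⟨l', rfl⟩ := hy
    exact ⟨l ++ l', sval_append _ _⟩

theorem exists_mini (g : FreeGroup (Fin N)) : ∃ l, IsConj g (sval l) ∧ Mini l := by
  classical
  have h : ∃ n, ∃ l : List (Fin N × ℤ), IsConj g (sval l) ∧ l.length = n := by
    obtain ⟨l, hl⟩ := exists_sval g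
    exact ⟨_, l, by rw [hl], rfl⟩
  obtain ⟨l, h1, h2⟩ := Nat.find_spec h
  refine ⟨l, h1, fun l' hl' => ?_⟩
  rw [h2]
  exact Nat.find_min' h ⟨l', h1.trans hl', rfl⟩

theorem Mini.rotate {l : List (Fin N × ℤ)} (h : Mini l) (n : ℕ) : Mini (l.rotate n) := by
  intro l' hl'
  rw [List.length_rotate]
  exact h l' ((sval_rotate l n).trans hl')

theorem Mini.head {p : Fin N × ℤ} {l} (h : Mini (p :: l)) : p.2 ≠ 0 := by
  intro hp
  have := h l (by rw [sval_cons, hp, zpow_zero, one_mul])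
  simp at this

theorem Mini.head2 {p q : Fin N × ℤ} {l} (h : Mini (p :: q :: l)) : p.1 ≠ q.1 := by
  intro hp
  have := h ((p.1, p.2 + q.2) :: l) (by
    rw [sval_cons, sval_cons, sval_cons, ← hp, zpow_add, mul_assoc])
  simp at this

theorem Mini.ent_ne {l : List (Fin N × ℤ)} (h : Mini l) (hl : l.length = r) (v : ZMod r) :
    (ent l hl v).2 ≠ 0 := by
  have h' := h.rotate v.val
  have hlen : 0 < (l.rotate v.val).length := by
    rw [List.length_rotate, hl]; exact Nat.pos_of_ne_zero (NeZero.ne r)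
  have h0 := List.getElem_rotate l v.val 0 hlen
  have e : (l.rotate v.val)[0] = ent l hl v := by
    rw [h0, ent]; congr 1
    rw [zero_add, hl, Nat.mod_eq_of_lt (ZMod.val_lt v)]
  rw [← e]
  clear e h0
  generalize l.rotate v.val = m at *
  cases m with
  | nil => simp at hlen
  | cons p m => exact h'.head

theorem Mini.get2 {m : List (Fin N × ℤ)} (h : Mini m) (hlen : 1 < m.length) :
    (m[0]'(by omega)).1 ≠ m[1].1 := by
  match m, hlen, h with
  | p :: q :: m, _, h => exact h.head2

theorem Mini.ent_ne2 {l : List (Fin N × ℤ)} (h : Mini l) (hl : l.length = r) (hr : 2 ≤ r)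
    (v : ZMod r) : (ent l hl v).1 ≠ (ent l hl (v + 1)).1 := by
  have h' := h.rotate v.val
  have hlen : 1 < (l.rotate v.val).length := by
    rw [List.length_rotate, hl]; omega
  have h0 := List.getElem_rotate l v.val 0 (by omega)
  have h1 := List.getElem_rotate l v.val 1 hlen
  have e : (l.rotate v.val)[0] = ent l hl v := by
    rw [h0, ent]; congr 1
    rw [zero_add, hl, Nat.mod_eq_of_lt (ZMod.val_lt v)]
  have e1 : (l.rotate v.val)[1] = ent l hl (v + 1) := by
    rw [h1, ent]; congr 1
    have : Fact (1 < r) := ⟨hr⟩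
    rw [ZMod.val_add, ZMod.val_one, add_comm, hl]
  rw [← e, ← e1]
  exact h'.get2 hlen

/-- Equality of all traces of unipotent-constant-term representations. -/
def SameTr (g g' : FreeGroup (Fin N)) : Prop :=
  ∀ (r : ℕ) (_ : NeZero r) (ρ : FreeGroup (Fin N) →* Matrix (ZMod r) (ZMod r) ℚ⟦X⟧),
    (∀ i, (ρ (FreeGroup.of i)).map (constantCoeff (R := ℚ)) = 1) → (ρ g).trace = (ρ g').trace

theorem trace_conj {R ι : Type*} [CommRing R] [Fintype ι] [DecidableEq ι]
    (ρ : FreeGroup (Fin N) →* Matrix ι ι R) {g h : FreeGroup (Fin N)} (hc : IsConj g h) :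
    (ρ g).trace = (ρ h).trace := by
  obtain ⟨c, rfl⟩ := isConj_iff.1 hc
  rw [map_mul, Matrix.trace_mul_comm, ← map_mul]
  simp

theorem SameTr.congr {g g' h h' : FreeGroup (Fin N)} (H : SameTr g g') (hg : IsConj g h)
    (hg' : IsConj g' h') : SameTr h h' := by
  intro r _ ρ hρ
  rw [← trace_conj ρ hg, ← trace_conj ρ hg', H r _ ρ hρ]

theorem SameTr.symm {g g' : FreeGroup (Fin N)} (H : SameTr g g') : SameTr g' g :=
  fun r _ ρ hρ => (H r _ ρ hρ).symm

theorem rep_unip (i : ZMod r → Fin N) (m : ZMod r → ℤ) (hi : ∀ v, i v ≠ i (v + 1)) (b : ℚ⟦X⟧)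
    (k : Fin N) :
    (rep i (fun j => uX ^ m j) hi b (FreeGroup.of k)).map (constantCoeff (R := ℚ)) = 1 := by
  have := rep_zpow i (fun j => uX ^ m j) hi b (k, 1)
  simp only [zpow_one] at this
  rw [this]
  ext v w
  rw [Matrix.map_apply, Mm, Matrix.add_apply, map_add, Dm, Matrix.diagonal_apply,
    Matrix.smul_apply, Um, Matrix.of_apply, wt, Matrix.one_apply, smul_eq_mul, map_mul]
  have h2 : constantCoeff (R := ℚ) (if w = v + 1 then
      (if i v = (k, (1 : ℤ)).1 then (((uX ^ m v) ^ (k, (1 : ℤ)).2 : ℚ⟦X⟧ˣ) : ℚ⟦X⟧) - 1 else 0)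
        else 0) = 0 := by
    split_ifs
    · rw [map_sub, ← zpow_mul, uX_zpow_const, map_one, sub_self]
    · simp
    · simp
  rw [h2, mul_zero, add_zero]
  split_ifs
  · rw [← zpow_mul, uX_zpow_const]
  · simp
  · simp

theorem case_ge_two (l l' : List (Fin N × ℤ)) (h : Mini l) (hle : l'.length ≤ l.length)
    (h2 : 2 ≤ l.length) (H : SameTr (sval l) (sval l')) : IsConj (sval l) (sval l') := by
  obtain ⟨r, hl⟩ : ∃ r, l.length = r := ⟨_, rfl⟩
  have : NeZero r := ⟨by omega⟩
  have hi := h.ent_ne2 hl (by omega)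
  have hd : ∀ m : ZMod r → ℤ, _ := fun m =>
    trace_diff (fun v => (ent l hl v).1) (fun j => uX ^ m j) hi l hl.le
  have hd' : ∀ m : ZMod r → ℤ, _ := fun m =>
    trace_diff (fun v => (ent l hl v).1) (fun j => uX ^ m j) hi l' (hl ▸ hle)
  have hs : ∀ (m : ZMod r → ℤ) b, _ := fun m b =>
    H r _ (rep (fun v => (ent l hl v).1) (fun j => uX ^ m j) hi b) (rep_unip _ m hi b)
  simp only [← hs, hd, if_pos hl, reindex _ _ l hl] at hd'
  by_cases hl' : l'.length = r
  · simp only [if_pos hl', reindex _ _ l' hl'] at hd'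
    obtain ⟨v, hv⟩ := combin_eq (ent l hl) (ent l' hl') (h.ent_ne hl) hd'
    rw [rotate_of_ent l l' hl hl' v hv]
    exact (sval_rotate _ _).symm
  · simp only [if_neg hl'] at hd'
    exact (combin_zero (ent l hl) (h.ent_ne hl) hd').elim

/-- One dimensional representations. -/
noncomputable def rep1 (k : Fin N) : FreeGroup (Fin N) →* Matrix (ZMod 1) (ZMod 1) ℚ⟦X⟧ :=
  ((Matrix.scalar (ZMod 1)).toMonoidHom.comp (Units.coeHom ℚ⟦X⟧)).comp
    (FreeGroup.lift fun j => if j = k then uX else 1)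

theorem rep1_tr (k : Fin N) (g) : (rep1 k g).trace =
    ((FreeGroup.lift (fun j => if j = k then uX else 1) g : ℚ⟦X⟧ˣ) : ℚ⟦X⟧) := by
  simp [rep1, Matrix.trace]

theorem case_one (p : Fin N × ℤ) (l' : List (Fin N × ℤ)) (h : Mini [p]) (h' : Mini l')
    (hle : l'.length ≤ 1) (H : SameTr (sval [p]) (sval l')) : IsConj (sval [p]) (sval l') := by
  have hs : ∀ k : Fin N, _ := fun k => H 1 _ (rep1 k) (by
    intro j
    ext v w
    simp only [rep1, MonoidHom.comp_apply, FreeGroup.lift_apply_of, Matrix.map_apply]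
    have : v = w := Subsingleton.elim _ _
    subst this
    split_ifs
    · simp [uX_val]
    · simp)
  have hk := hs p.1
  rw [rep1_tr, rep1_tr] at hk
  have hk := Units.ext hk
  match l', hle, h' with
  | [], _, _ =>
    simp [sval] at hk
    exact (h.head (uX_zpow_eq_one hk)).elim
  | [q], _, h' =>
    simp only [sval, List.map_cons, List.map_nil, List.prod_cons, List.prod_nil, mul_one,
      map_zpow, FreeGroup.lift_apply_of, if_true] at hk
    by_cases hq : q.1 = p.1
    · rw [if_pos hq] at hk
      have : p = q := Prod.ext hq.symm (uX_zpow_inj hk)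
      rw [this]
    · rw [if_neg hq, one_zpow] at hk
      exact (h.head (uX_zpow_eq_one hk)).elim

theorem conj_aux (l l' : List (Fin N × ℤ)) (h : Mini l) (h' : Mini l')
    (hle : l'.length ≤ l.length) (H : SameTr (sval l) (sval l')) :
    IsConj (sval l) (sval l') := by
  by_cases h2 : 2 ≤ l.length
  · exact case_ge_two l l' h hle h2 H
  · match l, h2, hle, h with
    | [], _, hle, _ =>
      have : l' = [] := List.length_eq_zero_iff.1 (by simpa using hle)
      rw [this]
    | [p], _, hle, h => exact case_one p l' h h' hle H
    | _ :: _ :: _, h2, _, _ => exact (h2 (by simp)).elim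

theorem conj_of_trace (g g' : FreeGroup (Fin N)) (H : SameTr g g') : IsConj g g' := by
  obtain ⟨l, hc, h⟩ := exists_mini g
  obtain ⟨l', hc', h'⟩ := exists_mini g'
  have H' := H.congr hc hc'
  refine hc.trans (IsConj.trans ?_ hc'.symm)
  rcases le_total l'.length l.length with hle | hle
  · exact conj_aux l l' h h' hle H'
  · exact (conj_aux l' l h' h hle H'.symm).symm

end Combin

end HM

/-- (Handel–Mosher) Every periodic conjugacy class of an element of `IA_N(ℤ/3)` is
fixed: if `π ∘ Φ = π` and `Φ^n(g)` is conjugate to `g` for some `n ≥ 1`, then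
`Φ(g)` is conjugate to `g`. -/
theorem statement_7 (N : ℕ) (hN : 1 ≤ N)
    (Φ : MulAut (FreeGroup (Fin N)))
    (hIA : (piMod3 N).comp Φ.toMonoidHom = piMod3 N)
    (g : FreeGroup (Fin N))
    (hper : ∃ n : ℕ, 1 ≤ n ∧ IsConj ((Φ ^ n) g) g) :
    IsConj (Φ g) g := by
  obtain ⟨n, hn, hper⟩ := hper
  have hit : ∀ n : ℕ, (Φ ^ n) g = (Φ.toMonoidHom)^[n] g := by
    intro n
    induction n with
    | zero => rfl
    | succ n ih =>
      rw [Function.iterate_succ_apply', ← ih, pow_succ', MulAut.mul_apply]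
      rfl
  rw [hit] at hper
  apply HM.conj_of_trace
  intro r _ ρ hρ
  exact HM.trace_eq Φ.toMonoidHom hIA n hn g hper ρ hρ
end

section
/- Let N ≥ 1 and let Φ be an automorphism of F_N = FreeGroup (Fin N) with π ∘ Φ = π (the mod-3 abelianization condition for IA_N(Z/3)). If A is a free factor of F_N and there exist an integer n ≥ 1 and an element x ∈ F_N with Φ^n(A) = xAx⁻¹ (as subgroups), then there exists y ∈ F_N with Φ(A) = yAy⁻¹. In other words, every periodic conjugacy class of a free factor under an element of IA_N(Z/3) is fixed. -/
/-- `A` is a free factor of `F` if there is a subgroup `B` such that `F` is the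
internal free product of `A` and `B`, i.e. the canonical homomorphism from the
coproduct `A ∗ B` to `F` is an isomorphism. -/
def IsFreeFactor {F : Type*} [Group F] (A : Subgroup F) : Prop :=
  ∃ B : Subgroup F, Function.Bijective ⇑(Monoid.Coprod.lift A.subtype B.subtype)

/-- The conjugate subgroup `x A x⁻¹`. -/
def conjSubgroup {F : Type*} [Group F] (x : F) (A : Subgroup F) : Subgroup F :=
  A.map (MulAut.conj x).toMonoidHom

open Polynomial in
lemma hm_pow_form (n : ℕ) (hn : 1 ≤ n) :
    ∃ (e : ℕ) (u : ℤ) (Q R : ℤ[X]), 1 ≤ e ∧ ¬ (3 : ℤ) ∣ u ∧ Q = (u : ℤ[X]) * X + 3 * R ∧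
      (1 + 3 * X : ℤ[X]) ^ n = 1 + 3 ^ e * Q := by
  induction n using Nat.strong_induction_on with
  | _ n ih =>
    by_cases h3 : 3 ∣ n
    · obtain ⟨m, rfl⟩ := h3
      obtain ⟨e, u, Q, R, he, hu, hQ, hT⟩ := ih m (by omega) (by omega)
      obtain ⟨e, rfl⟩ : ∃ k, e = k + 1 := ⟨e - 1, by omega⟩
      refine ⟨e + 2, u, Q + 3 ^ (e+1) * Q ^ 2 + 3 ^ (2 * e + 1) * Q ^ 3,
        R + 3 ^ e * Q ^ 2 + 3 ^ (2 * e) * Q ^ 3, by omega, hu, ?_, ?_⟩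
      · rw [hQ]; ring
      · rw [mul_comm 3 m, pow_mul, hT]; ring
    · have h : ∀ m : ℕ, ∃ R : ℤ[X],
          (1 + 3 * X : ℤ[X]) ^ m = 1 + 3 * (((m : ℤ) : ℤ[X]) * X + 3 * R) := by
        intro m
        induction m with
        | zero => exact ⟨0, by simp⟩
        | succ m ih =>
          obtain ⟨R, hR⟩ := ih
          refine ⟨R + (m : ℤ[X]) * X ^ 2 + 3 * R * X, ?_⟩
          rw [pow_succ, hR]; push_cast; ring
      obtain ⟨R, hR⟩ := h n
      exact ⟨1, n, _, R, le_rfl, by exact_mod_cast h3, rfl, by rw [hR]; ring⟩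

open Polynomial in
lemma hm_div_all (lam : ℤ[X] →ₗ[ℤ] ℤ) (u : ℤ) (Q R : ℤ[X]) (hu : ¬ (3 : ℤ) ∣ u)
    (hQ : Q = (u : ℤ[X]) * X + 3 * R) (h0 : ∀ k, lam (Q ^ k) = 0) (M : ℕ) :
    ∀ P, (3 : ℤ) ^ M ∣ lam P := by
  induction M with
  | zero => simp
  | succ M ih =>
    have key : ∀ k, (3 : ℤ) ^ (M + 1) ∣ lam (X ^ k) := by
      intro k
      have h1 : (3 : ℤ[X]) ∣ Q ^ k - ((u : ℤ[X]) * X) ^ k := by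
        refine dvd_trans ⟨R, ?_⟩ (sub_dvd_pow_sub_pow _ _ k)
        rw [hQ]; ring
      obtain ⟨R', hR'⟩ := h1
      have h2 : u ^ k * lam (X ^ k) = - (3 * lam R') := by
        have e1 : (u ^ k : ℤ) • (X ^ k : ℤ[X]) = Q ^ k - (3 : ℤ) • R' := by
          rw [zsmul_eq_mul, zsmul_eq_mul]
          push_cast
          rw [← hR']; ring
        have := congrArg lam e1
        rw [map_smul, map_sub, map_smul, h0] at this
        simpa using this
      have h3 : (3 : ℤ) ^ (M + 1) ∣ u ^ k * lam (X ^ k) := by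
        rw [h2, pow_succ, mul_comm, dvd_neg]
        exact mul_dvd_mul_left _ (ih R')
      refine IsCoprime.dvd_of_dvd_mul_left ?_ h3
      exact ((Int.prime_three.coprime_iff_not_dvd).2 hu).pow
    intro P
    induction P using Polynomial.induction_on' with
    | add p q hp hq => rw [map_add]; exact dvd_add hp hq
    | monomial n a =>
      rw [← Polynomial.C_mul_X_pow_eq_monomial, ← Polynomial.smul_eq_C_mul, map_smul]
      exact Dvd.dvd.mul_left (key n) _

open Polynomial in
lemma hm_arith (mu : ℤ[X] →ₗ[ℤ] ℤ) (hmu : ∀ j, (3 : ℤ) ^ j ∣ mu (X ^ j)) (n : ℕ) (hn : 1 ≤ n)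
    (h0 : ∀ i, mu ((1 + X) ^ (n * i)) = 0) : mu (1 + X) = 0 := by
  choose s hs using hmu
  let lam : ℤ[X] →ₗ[ℤ] ℤ := (Polynomial.basisMonomials ℤ).constr ℤ s
  have hlam : ∀ P : ℤ[X], lam (P.comp (3 * X)) = mu P := by
    intro P
    induction P using Polynomial.induction_on' with
    | add p q hp hq => rw [add_comp, map_add, map_add, hp, hq]
    | monomial n a =>
      have e1 : (monomial n a : ℤ[X]).comp (3 * X) = (a * 3 ^ n) • (monomial n 1 : ℤ[X]) := by
        rw [← Polynomial.C_mul_X_pow_eq_monomial, ← Polynomial.C_mul_X_pow_eq_monomial,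
          smul_eq_C_mul]
        simp
        ring
      have e2 : (monomial n a : ℤ[X]) = a • X ^ n := by
        rw [← Polynomial.C_mul_X_pow_eq_monomial, smul_eq_C_mul]
      have e3 : lam (monomial n 1) = s n := by
        have := (Polynomial.basisMonomials ℤ).constr_basis ℤ s n
        rwa [Polynomial.coe_basisMonomials] at this
      rw [e1, map_smul, e3, e2, map_smul, hs, smul_eq_mul, smul_eq_mul]; ring
  obtain ⟨e, u, Q, R, he, hu, hQ, hT⟩ := hm_pow_form n hn
  have h1 : ∀ i, lam ((1 + 3 * X) ^ (n * i)) = 0 := by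
    intro i
    rw [← h0 i, ← hlam]
    simp
  have h2 : ∀ k, lam (Q ^ k) = 0 := by
    intro k
    have e1 : (((3 : ℤ) ^ e) ^ k) • Q ^ k = ((1 + 3 * X : ℤ[X]) ^ n - 1) ^ k := by
      rw [hT, zsmul_eq_mul]; push_cast; ring
    have e2 : lam (((1 + 3 * X : ℤ[X]) ^ n - 1) ^ k) = 0 := by
      rw [sub_pow, map_sum]
      refine Finset.sum_eq_zero fun m _ => ?_
      have : (-1 : ℤ[X]) ^ (m + k) * ((1 + 3 * X) ^ n) ^ m * 1 ^ (k - m) * (k.choose m : ℤ[X])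
        = ((-1) ^ (m + k) * (k.choose m : ℤ)) • (1 + 3 * X) ^ (n * m) := by
        rw [zsmul_eq_mul, pow_mul]; push_cast; ring
      rw [this, map_smul, h1, smul_zero]
    rw [← e1, map_smul, smul_eq_mul] at e2
    exact (mul_eq_zero.1 e2).resolve_left (by positivity)
  have h3 : ∀ P, lam P = 0 := by
    intro P
    by_contra hne
    have hfin : FiniteMultiplicity (3 : ℤ) (lam P) := Int.finiteMultiplicity_iff.2 ⟨by decide, hne⟩
    obtain ⟨M, hM⟩ := hfin
    exact hM (hm_div_all lam u Q R hu hQ h2 (M+1) P)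
  rw [← hlam, h3]

/-- Span of `3` and all `g - 1` in the integral group ring. -/
noncomputable def hmM (F : Type) [Group F] : Submodule ℤ (MonoidAlgebra ℤ F) :=
  Submodule.span ℤ (insert 3 (Set.range fun g : F => MonoidAlgebra.of ℤ F g - 1))

lemma hmM_three (F : Type) [Group F] : (3 : MonoidAlgebra ℤ F) ∈ hmM F :=
  Submodule.subset_span (Set.mem_insert _ _)

lemma hmM_of (F : Type) [Group F] (g : F) : MonoidAlgebra.of ℤ F g - 1 ∈ hmM F :=
  Submodule.subset_span (Set.mem_insert_of_mem _ ⟨g, rfl⟩)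

lemma hm_q (N : ℕ) (g : FreeGroup (Fin N)) :
    ∃ n : Fin N → ℤ, (∀ i, ((n i : ℤ) : ZMod 3) = (piMod3 N g).toAdd i) ∧
      MonoidAlgebra.of ℤ _ g - 1 - ∑ i, n i • (MonoidAlgebra.of ℤ _ (FreeGroup.of i) - 1)
        ∈ hmM (FreeGroup (Fin N)) * hmM (FreeGroup (Fin N)) := by
  have mulm : ∀ g h : FreeGroup (Fin N), (MonoidAlgebra.of ℤ _ g - 1) * (MonoidAlgebra.of ℤ _ h - 1)
      ∈ hmM (FreeGroup (Fin N)) * hmM (FreeGroup (Fin N)) :=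
    fun g h => Submodule.mul_mem_mul (hmM_of _ g) (hmM_of _ h)
  induction g using FreeGroup.induction_on with
  | C1 => exact ⟨0, by simp, by simp [← MonoidAlgebra.one_def]⟩
  | of i =>
    refine ⟨Pi.single i 1, ?_, ?_⟩
    · intro j
      simp only [piMod3, FreeGroup.lift_apply_of, toAdd_ofAdd]
      by_cases h : j = i
      · subst h; simp
      · simp [h]
    · rw [Finset.sum_eq_single i]
      · simp
      · intro j _ h; simp [h]
      · simp
  | inv_of i ih =>
    obtain ⟨n, hn, h⟩ := ih
    refine ⟨-n, ?_, ?_⟩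
    · intro j; simp [hn]
    · have e := mulm (FreeGroup.of i) (FreeGroup.of i)⁻¹
      have e1 : (MonoidAlgebra.of ℤ _ (FreeGroup.of i)) * (MonoidAlgebra.of ℤ _ (FreeGroup.of i)⁻¹) = 1 := by
        rw [← map_mul, mul_inv_cancel, map_one]
      have := (Submodule.neg_mem _ (Submodule.add_mem _ h e))
      convert this using 1
      simp only [Pi.neg_apply, neg_smul, Finset.sum_neg_distrib, sub_mul, mul_sub, e1]
      simp only [mul_one, one_mul]
      abel
  | mul g h ih1 ih2 =>
    obtain ⟨n, hn, h1⟩ := ih1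
    obtain ⟨m, hm, h2⟩ := ih2
    refine ⟨n + m, ?_, ?_⟩
    · intro j; simp [hn, hm]
    · have := Submodule.add_mem _ (Submodule.add_mem _ h1 h2) (mulm g h)
      convert this using 1
      rw [map_mul]
      simp only [Pi.add_apply, add_smul, Finset.sum_add_distrib, sub_mul, mul_sub]
      simp only [mul_one, one_mul]
      abel

lemma hm_q2 (N : ℕ) (g h : FreeGroup (Fin N)) (hgh : piMod3 N g = piMod3 N h) :
    MonoidAlgebra.of ℤ _ g - MonoidAlgebra.of ℤ _ h
        ∈ hmM (FreeGroup (Fin N)) * hmM (FreeGroup (Fin N)) := by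
  obtain ⟨n, hn, h1⟩ := hm_q N g
  obtain ⟨m, hm, h2⟩ := hm_q N h
  have h3 : ∀ i, ∃ k : ℤ, n i - m i = 3 * k := by
    intro i
    have : ((n i - m i : ℤ) : ZMod 3) = 0 := by
      rw [Int.cast_sub, hn, hm, hgh, sub_self]
    exact (ZMod.intCast_zmod_eq_zero_iff_dvd _ 3).1 this
  choose k hk using h3
  have h4 : ∑ i, (n i • (MonoidAlgebra.of ℤ _ (FreeGroup.of i) - 1 : MonoidAlgebra ℤ (FreeGroup (Fin N)))
      - m i • (MonoidAlgebra.of ℤ _ (FreeGroup.of i) - 1))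
      ∈ hmM (FreeGroup (Fin N)) * hmM (FreeGroup (Fin N)) := by
    refine Submodule.sum_mem _ fun i _ => ?_
    rw [← sub_smul, hk, mul_comm, mul_smul]
    refine Submodule.smul_mem _ _ ?_
    have := Submodule.mul_mem_mul (hmM_three _) (hmM_of _ (FreeGroup.of i))
    convert this using 1
    rw [zsmul_eq_mul]; norm_cast
  have := Submodule.add_mem _ (Submodule.sub_mem _ h1 h2) h4
  convert this using 1
  rw [Finset.sum_sub_distrib]
  abel

/-- The ring endomorphism induced by an automorphism. -/
noncomputable def hmPhi {F : Type} [Group F] (Φ : MulAut F) :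
    MonoidAlgebra ℤ F →ₐ[ℤ] MonoidAlgebra ℤ F :=
  MonoidAlgebra.lift ℤ _ F ((MonoidAlgebra.of ℤ F).comp Φ.toMonoidHom)

lemma hmPhi_of {F : Type} [Group F] (Φ : MulAut F) (g : F) :
    hmPhi Φ (MonoidAlgebra.of ℤ F g) = MonoidAlgebra.of ℤ F (Φ g) := by
  simp [hmPhi]

lemma hmPhi_map {F : Type} [Group F] (Φ : MulAut F) : 
    (hmM F).map (hmPhi Φ).toLinearMap ≤ hmM F := by
  rw [hmM, Submodule.map_span_le]
  rintro x (rfl | ⟨g, rfl⟩)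
  · simp only [AlgHom.toLinearMap_apply, map_ofNat]; exact hmM_three F
  · simp only [AlgHom.toLinearMap_apply, map_sub, hmPhi_of, map_one]; exact hmM_of F _

lemma hm_filt (N : ℕ) (Φ : MulAut (FreeGroup (Fin N)))
    (hIA : (piMod3 N).comp Φ.toMonoidHom = piMod3 N) (j : ℕ) :
    ∀ y ∈ hmM (FreeGroup (Fin N)) ^ (j + 1),
      hmPhi Φ y - y ∈ hmM (FreeGroup (Fin N)) ^ (j + 2) := by
  have base : ∀ y ∈ hmM (FreeGroup (Fin N)),
      hmPhi Φ y - y ∈ hmM (FreeGroup (Fin N)) * hmM (FreeGroup (Fin N)) := by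
    intro y hy
    refine Submodule.span_induction ?_ ?_ ?_ ?_ hy
    · rintro x (rfl | ⟨g, rfl⟩)
      · rw [map_ofNat, sub_self]; exact Submodule.zero_mem _
      · simp only [map_sub, hmPhi_of, map_one]
        have := hm_q2 N (Φ g) g (DFunLike.congr_fun hIA g)
        convert this using 1; abel
    · simp
    · intro x y _ _ hx hy
      have := Submodule.add_mem _ hx hy
      convert this using 1; rw [map_add]; abel
    · intro a x _ hx
      rw [map_smul, ← smul_sub]; exact Submodule.smul_mem _ _ hx
  induction j with
  | zero => 
    intro y hy
    rw [zero_add, pow_one] at hy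
    rw [zero_add, pow_two]; exact base y hy
  | succ j ih =>
    intro y hy
    rw [pow_succ'] at hy
    refine Submodule.mul_induction_on hy ?_ ?_
    · intro p hp q hq
      have h1 : hmPhi Φ q ∈ hmM (FreeGroup (Fin N)) ^ (j + 1) := by
        have : (hmM (FreeGroup (Fin N)) ^ (j + 1)).map (hmPhi Φ).toLinearMap ≤ hmM (FreeGroup (Fin N)) ^ (j + 1) := by
          rw [Submodule.map_pow]
          exact pow_le_pow_left' (hmPhi_map Φ) _
        exact this ⟨q, hq, rfl⟩
      have h2 : (hmPhi Φ p - p) * hmPhi Φ q ∈ hmM (FreeGroup (Fin N)) ^ (j + 1 + 2) := by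
        have := Submodule.mul_mem_mul (base p hp) h1
        rwa [← pow_two, ← pow_add, add_comm] at this
      have h3 : p * (hmPhi Φ q - q) ∈ hmM (FreeGroup (Fin N)) ^ (j + 1 + 2) := by
        have := Submodule.mul_mem_mul hp (ih q hq)
        rwa [← pow_succ'] at this
      have := Submodule.add_mem _ h2 h3
      convert this using 1
      rw [map_mul]; noncomm_ring
    · intro x y hx hy
      have := Submodule.add_mem _ hx hy
      convert this using 1; rw [map_add]; abel

open Polynomial in
theorem hm_trace (N : ℕ) (Φ : MulAut (FreeGroup (Fin N)))
    (hIA : (piMod3 N).comp Φ.toMonoidHom = piMod3 N)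
    {ι : Type} [Fintype ι] [DecidableEq ι] (ρ : FreeGroup (Fin N) →* Matrix ι ι ℤ)
    (hρ : ∀ g, ∃ Y, ρ g - 1 = (3 : ℤ) • Y) (c : ℤ) (hc : c = Fintype.card ι) (n : ℕ) (hn : 1 ≤ n)
    (a : FreeGroup (Fin N))
    (h : ∀ i, (ρ ((Φ ^ (n * i)) a)).trace = c) : (ρ (Φ a)).trace = c := by
  subst hc
  let U : Module.End ℤ (MonoidAlgebra ℤ (FreeGroup (Fin N))) := (hmPhi Φ).toLinearMap - 1
  let r : MonoidAlgebra ℤ (FreeGroup (Fin N)) →ₐ[ℤ] Matrix ι ι ℤ := MonoidAlgebra.lift ℤ _ _ ρ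
  have hr : ∀ g, r (MonoidAlgebra.of ℤ _ g) = ρ g := fun g => by simp [r]
  let mu : ℤ[X] →ₗ[ℤ] ℤ := (Matrix.traceLinearMap ι ℤ ℤ) ∘ₗ r.toLinearMap ∘ₗ
    (LinearMap.applyₗ (MonoidAlgebra.of ℤ _ a - 1)) ∘ₗ (aeval U).toLinearMap
  have hmu : ∀ P, mu P = (r ((aeval U P) (MonoidAlgebra.of ℤ _ a - 1))).trace := fun P => rfl
  have hpow : ∀ i, mu ((1 + X) ^ i) = (ρ ((Φ ^ i) a)).trace - Fintype.card ι := by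
    intro i
    have e1 : aeval U ((1 + X : ℤ[X]) ^ i) = ((hmPhi Φ).toLinearMap : Module.End ℤ (MonoidAlgebra ℤ (FreeGroup (Fin N)))) ^ i := by
      rw [map_pow, map_add, map_one, aeval_X]; congr 1; simp [U]
    have e2 : ∀ i : ℕ, (((hmPhi Φ).toLinearMap : Module.End ℤ (MonoidAlgebra ℤ (FreeGroup (Fin N)))) ^ i) (MonoidAlgebra.of ℤ _ a - 1)
        = MonoidAlgebra.of ℤ _ ((Φ ^ i) a) - 1 := by
      intro i
      induction i with
      | zero => simp
      | succ i ih =>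
        rw [pow_succ' (hmPhi Φ).toLinearMap, Module.End.mul_apply, ih, AlgHom.toLinearMap_apply,
          map_sub, hmPhi_of, map_one, pow_succ' Φ, MulAut.mul_apply]
    rw [hmu, e1, e2, map_sub, hr, map_one, Matrix.trace_sub, Matrix.trace_one]
  have hdiv : ∀ j, ∀ y ∈ hmM (FreeGroup (Fin N)) ^ (j + 1), ∃ Y, r y = ((3 : ℤ) ^ (j+1)) • Y := by
    have base : ∀ y ∈ hmM (FreeGroup (Fin N)), ∃ Y, r y = (3 : ℤ) • Y := by
      intro y hy
      refine Submodule.span_induction ?_ ?_ ?_ ?_ hy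
      · rintro x (rfl | ⟨g, rfl⟩)
        · refine ⟨1, ?_⟩
          rw [map_ofNat, zsmul_eq_mul, mul_one]; norm_cast
        · obtain ⟨Y, hY⟩ := hρ g
          refine ⟨Y, ?_⟩
          rw [map_sub, hr, map_one, hY]
      · exact ⟨0, by simp⟩
      · rintro x y _ _ ⟨X, hx⟩ ⟨Y, hy⟩
        exact ⟨X + Y, by rw [map_add, hx, hy, smul_add]⟩
      · rintro a x _ ⟨X, hx⟩
        exact ⟨a • X, by rw [map_smul, hx, smul_comm]⟩
    intro j
    induction j with
    | zero => simpa using base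
    | succ j ih =>
      intro y hy
      rw [pow_succ'] at hy
      refine Submodule.mul_induction_on hy ?_ ?_
      · intro p hp q hq
        obtain ⟨X, hX⟩ := base p hp
        obtain ⟨Y, hY⟩ := ih q hq
        refine ⟨X * Y, ?_⟩
        rw [map_mul, hX, hY, smul_mul_smul_comm, ← pow_succ']
      · rintro x y ⟨X, hx⟩ ⟨Y, hy⟩
        exact ⟨X + Y, by rw [map_add, hx, hy, smul_add]⟩
  have hU : ∀ j, (U ^ j) (MonoidAlgebra.of ℤ _ a - 1) ∈ hmM (FreeGroup (Fin N)) ^ (j + 1) := by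
    intro j
    induction j with
    | zero => simpa using hmM_of _ a
    | succ j ih =>
      rw [pow_succ' U, Module.End.mul_apply]
      exact hm_filt N Φ hIA j _ ih
  have key := hm_arith mu (by
    intro j
    obtain ⟨Y, hY⟩ := hdiv j _ (hU j)
    rw [hmu, map_pow, aeval_X, hY, Matrix.trace_smul, smul_eq_mul, pow_succ, mul_assoc]
    exact dvd_mul_right _ _) n hn (by
    intro i
    rw [hpow, h, sub_self])
  have := hpow 1
  rw [pow_one, key, pow_one] at this
  linarith

/-- Product of a syllable list. -/
def hmW {F X : Type} [Group F] (v : X → F) (K : List (X × ℤ)) : F :=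
  (K.map fun p => v p.1 ^ p.2).prod

/-- A basis `v` of `F` such that the letters in `S` give a basis of `A`. -/
structure HmBasis {F : Type} [Group F] (A : Subgroup F) (X : Type) where
  v : X → F
  S : Set X
  gen : ∀ g : F, ∃ K, g = hmW v K
  genA : ∀ a ∈ A, ∃ K : List (X × ℤ), (∀ p ∈ K, p.1 ∈ S) ∧ a = hmW v K
  memA : ∀ x ∈ S, v x ∈ A
  lift : ∀ (H : Type) [Group H] (f : X → H), ∃ φ : F →* H, ∀ x, φ (v x) = f x

/-- `b` is distinguished from `A` by the trace of an integral representation trivial mod 3. -/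
def HmBad {F : Type} [Group F] (A : Subgroup F) (b : F) : Prop :=
  ∃ (ι : Type) (_ : Fintype ι) (_ : DecidableEq ι) (ρ : F →* Matrix ι ι ℤ),
    (∀ g, ∃ Y, ρ g - 1 = (3 : ℤ) • Y) ∧ (∀ a ∈ A, (ρ a).trace = (Fintype.card ι : ℤ)) ∧
    (ρ b).trace ≠ (Fintype.card ι : ℤ)

open Classical in
/-- Nilpotent matrix of the letter `x` on the cycle labelled by `y`. -/
noncomputable def hmN {X : Type} {l : ℕ} (y : ZMod l → X) (x : X) : Matrix (ZMod l) (ZMod l) ℤ :=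
  Matrix.of fun i j => if j = i + 1 ∧ y i = x then 1 else 0

/-- The unipotent matrix of the syllable `x ^ e`. -/
noncomputable def hmT {X : Type} {l : ℕ} (y : ZMod l → X) (x : X) (e : ℤ) :
    Matrix (ZMod l) (ZMod l) ℤ := 1 + (3 * e) • hmN y x

open Classical in
/-- Path coefficients. -/
noncomputable def hmB {X : Type} {l : ℕ} (y : ZMod l → X) : List (X × ℤ) → ZMod l → ℕ → ℤ
  | [], _, r => if r = 0 then 1 else 0
  | _ :: K, i, 0 => hmB y K i 0
  | p :: K, i, r + 1 => hmB y K i (r + 1) + (if y i = p.1 then 3 * p.2 * hmB y K (i + 1) r else 0)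

section
variable {X : Type} {l : ℕ} (y : ZMod l → X)

lemma hmB_zero (K : List (X × ℤ)) (i : ZMod l) : hmB y K i 0 = 1 := by
  induction K with
  | nil => simp [hmB]
  | cons p K ih => simp [hmB, ih]

lemma hmB_big (K : List (X × ℤ)) : ∀ (i : ZMod l) (r : ℕ), K.length < r → hmB y K i r = 0 := by
  induction K with
  | nil => intro i r h; simp at h; simp [hmB]; omega
  | cons p K ih =>
    intro i r h
    rw [List.length_cons] at h
    obtain ⟨r, rfl⟩ : ∃ k, r = k + 1 := ⟨r - 1, by omega⟩
    simp [hmB, ih i (r+1) (by omega), ih (i+1) r (by omega)]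

lemma hmB_top (K : List (X × ℤ)) : ∀ (i : ZMod l),
    (∃ χ : ℕ, hmB y K i K.length = χ * (K.map fun p => 3 * p.2).prod) ∧
    ((∀ m (h : m < K.length), y (i + m) = K[m].1) →
      hmB y K i K.length = (K.map fun p => 3 * p.2).prod) := by
  induction K with
  | nil => intro i; exact ⟨⟨1, by simp [hmB]⟩, by simp [hmB]⟩
  | cons p K ih =>
    intro i
    obtain ⟨⟨χ, h1⟩, h2⟩ := ih (i + 1)
    simp only [List.length_cons, hmB, hmB_big y K i (K.length + 1) (by omega), zero_add,
      List.map_cons, List.prod_cons]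
    constructor
    · by_cases h : y i = p.1
      · exact ⟨χ, by rw [if_pos h, h1]; ring⟩
      · exact ⟨0, by rw [if_neg h]; simp⟩
    · intro hm
      rw [if_pos (by simpa using hm 0 (by omega)), h2]
      intro m h
      have := hm (m + 1) (by omega)
      rw [List.getElem_cons_succ] at this
      rw [← this]; congr 1; push_cast; ring

lemma hmB_S (S : Set X) (K : List (X × ℤ)) (hK : ∀ p ∈ K, p.1 ∈ S) : ∀ (i : ZMod l) (r : ℕ),
    hmB y K i r ≠ 0 → ∀ m < r, y (i + m) ∈ S := by
  induction K with
  | nil => intro i r h m hm; simp [hmB] at h; omega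
  | cons p K ih =>
    intro i r h m hm
    obtain ⟨r, rfl⟩ : ∃ k, r = k + 1 := ⟨r - 1, by omega⟩
    have ih := ih (fun q hq => hK q (List.mem_cons_of_mem _ hq))
    rw [hmB] at h
    by_cases h1 : hmB y K i (r + 1) = 0
    · rw [h1, zero_add] at h
      by_cases h2 : y i = p.1
      · rw [if_pos h2] at h
        have h3 := ih (i + 1) r (right_ne_zero_of_mul h)
        cases m with
        | zero => simpa [h2] using hK p (List.mem_cons_self)
        | succ m =>
          have := h3 m (by omega)
          convert this using 2; push_cast; ring
      · rw [if_neg h2] at h; exact absurd rfl h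
    · exact ih i (r + 1) h1 m hm

variable [NeZero l]

lemma hmN_mul (x : X) (M : Matrix (ZMod l) (ZMod l) ℤ) (i j : ZMod l) [Decidable (y i = x)] :
    (hmN y x * M) i j = if y i = x then M (i + 1) j else 0 := by
  classical
  rw [Matrix.mul_apply]
  simp only [hmN, Matrix.of_apply]
  by_cases h : y i = x
  · simp [h]
  · simp [h]

lemma hmP_apply (K : List (X × ℤ)) : ∀ (M : ℕ) (i j : ZMod l), K.length ≤ M →
    (K.map fun p => hmT y p.1 p.2).prod i j =
      ∑ r ∈ Finset.range (M + 1), hmB y K i r * (if j = i + r then 1 else 0) := by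
  classical
  induction K with
  | nil =>
    intro M i j _
    rw [Finset.sum_range_succ', Finset.sum_eq_zero]
    · simp [hmB, Matrix.one_apply, eq_comm]
    · intro r _; simp [hmB]
  | cons p K ih =>
    intro M i j h
    rw [List.length_cons] at h
    obtain ⟨M, rfl⟩ : ∃ k, M = k + 1 := ⟨M - 1, by omega⟩
    rw [List.map_cons, List.prod_cons, hmT, add_mul, one_mul, smul_mul_assoc, Matrix.add_apply,
      Matrix.smul_apply, hmN_mul, ih (M + 1) i j (by omega), ih M (i + 1) j (by omega),
      Finset.sum_range_succ', Finset.sum_range_succ' _ (M + 1)]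
    simp only [hmB, add_mul, Finset.sum_add_distrib, smul_eq_mul]
    have : ∀ r : ℕ, i + 1 + (r : ZMod l) = i + ((r + 1 : ℕ) : ZMod l) := by
      intro r; push_cast; ring
    simp only [this]
    by_cases hy : y i = p.1
    · simp only [if_pos hy, Finset.mul_sum]
      simp only [← mul_assoc]
      ring
    · simp only [if_neg hy]; simp

lemma hm_trace_A (S : Set X) (K : List (X × ℤ)) (hK : ∀ p ∈ K, p.1 ∈ S) (q : ZMod l)
    (hq : y q ∉ S) : (K.map fun p => hmT y p.1 p.2).prod.trace = (Fintype.card (ZMod l) : ℤ) := by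
  have hd : ∀ i : ZMod l, (K.map fun p => hmT y p.1 p.2).prod i i = 1 := by
    intro i
    rw [hmP_apply y K K.length i i le_rfl, Finset.sum_range_succ', Finset.sum_eq_zero]
    · simp [hmB_zero]
    · intro r _
      by_cases hr : r + 1 < l
      · have : ((r + 1 : ℕ) : ZMod l) ≠ 0 := by
          rw [Ne, ZMod.natCast_eq_zero_iff]
          exact fun h => absurd (Nat.le_of_dvd (by omega) h) (by omega)
        simp only [left_eq_add, this, if_false, mul_zero]
      · by_contra hne
        have := hmB_S y S K hK i (r+1) (left_ne_zero_of_mul hne) (q - i).val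
          (by have := ZMod.val_lt (q - i); omega)
        rw [ZMod.natCast_zmod_val] at this
        exact hq (by simpa using this)
  simp [Matrix.trace, hd]

lemma hm_trace_L (K : List (X × ℤ)) (hl : K.length = l) (h0 : ∀ p ∈ K, p.2 ≠ 0)
    (hm : ∀ m (h : m < K.length), y (m : ZMod l) = K[m].1) :
    (K.map fun p => hmT y p.1 p.2).prod.trace ≠ (Fintype.card (ZMod l) : ℤ) := by
  have hl0 : l ≠ 0 := NeZero.ne l
  have hd : ∀ i : ZMod l, (K.map fun p => hmT y p.1 p.2).prod i i = 1 + hmB y K i K.length := by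
    intro i
    rw [hmP_apply y K K.length i i le_rfl, hl]
    obtain ⟨k, hk⟩ : ∃ k, l = k + 1 := ⟨l - 1, by omega⟩
    rw [Finset.sum_range_succ]
    congr 1
    · rw [congrArg Finset.range hk, Finset.sum_range_succ', Finset.sum_eq_zero]
      · simp [hmB_zero]
      · intro r hr
        rw [Finset.mem_range] at hr
        have : ((r + 1 : ℕ) : ZMod l) ≠ 0 := by
          rw [Ne, ZMod.natCast_eq_zero_iff]
          exact fun h => absurd (Nat.le_of_dvd (by omega) h) (by omega)
        simp only [left_eq_add, this, if_false, mul_zero]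
    · simp
  choose χ hχ using fun i : ZMod l => (hmB_top y K i).1
  have h00 := (hmB_top y K 0).2 (by simpa using hm)
  have hE : (K.map fun p => 3 * p.2).prod ≠ 0 := by
    refine List.prod_ne_zero ?_
    simp only [List.mem_map, not_exists, not_and]
    intro p hp h
    exact h0 p hp (by omega)
  have hc0 : χ 0 ≠ 0 := by
    intro h
    have := hχ 0
    rw [h00, h] at this
    simp at this
    exact hE (by simpa using this)
  have : (K.map fun p => hmT y p.1 p.2).prod.trace = (Fintype.card (ZMod l) : ℤ)
      + ((∑ i, χ i : ℕ) : ℤ) * (K.map fun p => 3 * p.2).prod := by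
    simp only [Matrix.trace, Matrix.diag, hd, Finset.sum_add_distrib, hχ]
    rw [← Finset.sum_mul]; simp
  rw [this]
  have h2 : (∑ i, χ i) ≠ 0 := by
    have := Finset.single_le_sum (f := χ) (fun i _ => Nat.zero_le _) (Finset.mem_univ (0 : ZMod l))
    omega
  intro h
  have h3 : ((∑ i, χ i : ℕ) : ℤ) * (K.map fun p => 3 * p.2).prod = 0 := by linarith
  rcases mul_eq_zero.1 h3 with h | h
  · exact h2 (by exact_mod_cast h)
  · exact hE h

end

lemma hm_rep {F : Type} [Group F] {A : Subgroup F} {X : Type} (b : HmBasis A X)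
    {ι : Type} [Fintype ι] [DecidableEq ι] (E : X → ℤ → Matrix ι ι ℤ)
    (h0 : ∀ x, E x 0 = 1) (hadd : ∀ x e e', E x (e + e') = E x e * E x e')
    (h3 : ∀ x e, ∃ Y, E x e - 1 = (3 : ℤ) • Y) :
    ∃ ρ : F →* Matrix ι ι ℤ, (∀ K, ρ (hmW b.v K) = (K.map fun p => E p.1 p.2).prod) ∧
      (∀ g, ∃ Y, ρ g - 1 = (3 : ℤ) • Y) := by
  let Eh : X → (Multiplicative ℤ →* Matrix ι ι ℤ) := fun x =>
    { toFun := fun e => E x e.toAdd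
      map_one' := h0 x
      map_mul' := fun a c => hadd x _ _ }
  obtain ⟨φ, hφ⟩ := b.lift (Matrix ι ι ℤ)ˣ fun x => (Eh x).toHomUnits (Multiplicative.ofAdd 1)
  have key : ∀ K, ((Units.coeHom _).comp φ) (hmW b.v K) = (K.map fun p => E p.1 p.2).prod := by
    intro K
    rw [hmW, map_list_prod, List.map_map]
    congr 1
    refine List.map_congr_left fun p _ => ?_
    simp only [Function.comp, MonoidHom.comp_apply, map_zpow, hφ]
    rw [← map_zpow (Eh p.1).toHomUnits, ← ofAdd_zsmul]
    simp [Eh]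
  refine ⟨(Units.coeHom _).comp φ, key, ?_⟩
  intro g
  obtain ⟨K, rfl⟩ := b.gen g
  rw [key]
  induction K with
  | nil => exact ⟨0, by simp⟩
  | cons p K ih =>
    obtain ⟨Y, hY⟩ := ih
    obtain ⟨Z, hZ⟩ := h3 p.1 p.2
    refine ⟨Z * (K.map fun p => E p.1 p.2).prod + Y, ?_⟩
    rw [smul_add, ← hY, ← smul_mul_assoc, ← hZ, List.map_cons, List.prod_cons]
    noncomm_ring

/-- Cyclically reduced words of length at least two with a letter outside `S` are bad. -/
lemma hm_bad_long {F : Type} [Group F] {A : Subgroup F} {X : Type} (b : HmBasis A X)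
    (K : List (X × ℤ)) (h2 : 2 ≤ K.length) (h0 : ∀ p ∈ K, p.2 ≠ 0)
    (hch : ∀ m (h : m + 1 < K.length), (K[m]).1 ≠ (K[m+1]).1)
    (hcyc : (K[K.length - 1]).1 ≠ (K[0]).1)
    (hS : ∃ p ∈ K, p.1 ∉ b.S) : HmBad A (hmW b.v K) := by
  classical
  obtain ⟨l, hl⟩ : ∃ l, l = K.length := ⟨_, rfl⟩
  have : NeZero l := ⟨by omega⟩
  let y : ZMod l → X := fun i => (K[i.val]'(by have := ZMod.val_lt i; omega)).1
  have hy : ∀ m (h : m < K.length), y (m : ZMod l) = K[m].1 := by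
    intro m h
    have : (m : ZMod l).val = m := ZMod.val_natCast_of_lt (by omega)
    simp only [y, this]
  have hyy : ∀ i, y i ≠ y (i + 1) := by
    intro i
    have hi : i.val < l := ZMod.val_lt i
    have e : i = (i.val : ZMod l) := (ZMod.natCast_zmod_val i).symm
    by_cases h : i.val + 1 < l
    · have e2 : i + 1 = ((i.val + 1 : ℕ) : ZMod l) := by push_cast; rw [← e]
      rw [e2, hy _ (by omega)]
      exact hch _ (by omega)
    · have e3 : i.val = l - 1 := by omega
      have e2 : i + 1 = ((0 : ℕ) : ZMod l) := by
        have : ((i.val + 1 : ℕ) : ZMod l) = 0 := by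
          rw [e3, Nat.sub_add_cancel (by omega)]; simp
        push_cast at this ⊢
        rw [← e] at this; exact this
      rw [e2, hy 0 (by omega)]
      simp only [y, e3, hl]
      exact hcyc
  have hNN : ∀ x, hmN y x * hmN y x = 0 := by
    intro x
    ext i j
    rw [hmN_mul]
    by_cases h : y i = x
    · rw [if_pos h]
      simp only [hmN, Matrix.of_apply, Matrix.zero_apply]
      rw [if_neg]
      rintro ⟨_, h'⟩
      exact hyy i (h.trans h'.symm)
    · simp [h]
  obtain ⟨ρ, hρ, hρ3⟩ := hm_rep b (hmT y) (by simp [hmT]) (by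
      intro x e e'
      simp only [hmT, add_mul, mul_add, smul_mul_smul_comm, hNN, smul_zero, one_mul, mul_one, add_smul]
      abel) (by
      intro x e
      exact ⟨e • hmN y x, by simp [hmT, mul_smul]⟩)
  obtain ⟨p, hp, hpS⟩ := hS
  obtain ⟨m, hm, rfl⟩ := List.mem_iff_getElem.1 hp
  refine ⟨ZMod l, inferInstance, inferInstance, ρ, hρ3, ?_, ?_⟩
  · intro a ha
    obtain ⟨L, hL, rfl⟩ := b.genA a ha
    rw [hρ]
    exact hm_trace_A y b.S L hL (m : ZMod l) (by rw [hy m hm]; exact hpS)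
  · rw [hρ]
    exact hm_trace_L y K hl.symm h0 hy

lemma hm_bad_short {F : Type} [Group F] {A : Subgroup F} {X : Type} (b : HmBasis A X)
    (x : X) (e : ℤ) (he : e ≠ 0) (hx : x ∉ b.S) : HmBad A (hmW b.v [(x, e)]) := by
  classical
  let U : (Matrix (Fin 2) (Fin 2) ℤ)ˣ :=
    ⟨!![1, 3; 3, 10], !![10, -3; -3, 1], by decide, by decide⟩
  have hpos : ∀ n : ℕ, 1 ≤ ((U ^ (n + 1) : (Matrix (Fin 2) (Fin 2) ℤ)ˣ).val 0 0) ∧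
      0 ≤ ((U ^ (n + 1) : (Matrix (Fin 2) (Fin 2) ℤ)ˣ).val 0 1) ∧
      0 ≤ ((U ^ (n + 1) : (Matrix (Fin 2) (Fin 2) ℤ)ˣ).val 1 0) ∧
      10 ≤ ((U ^ (n + 1) : (Matrix (Fin 2) (Fin 2) ℤ)ˣ).val 1 1) := by
    intro n
    induction n with
    | zero => simp [U]
    | succ n ih =>
      rw [pow_succ U (n + 1)]
      generalize U ^ (n + 1) = V at ih
      rw [Units.val_mul]
      simp only [Matrix.mul_apply, Fin.sum_univ_two]
      simp [U]
      omega
  have hneg : ∀ n : ℕ, 10 ≤ ((U⁻¹ ^ (n + 1) : (Matrix (Fin 2) (Fin 2) ℤ)ˣ).val 0 0) ∧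
      0 ≥ ((U⁻¹ ^ (n + 1) : (Matrix (Fin 2) (Fin 2) ℤ)ˣ).val 0 1) ∧
      0 ≥ ((U⁻¹ ^ (n + 1) : (Matrix (Fin 2) (Fin 2) ℤ)ˣ).val 1 0) ∧
      1 ≤ ((U⁻¹ ^ (n + 1) : (Matrix (Fin 2) (Fin 2) ℤ)ˣ).val 1 1) := by
    intro n
    induction n with
    | zero => simp [U]
    | succ n ih =>
      rw [pow_succ U⁻¹ (n + 1)]
      generalize U⁻¹ ^ (n + 1) = V at ih
      rw [Units.val_mul]
      simp only [Matrix.mul_apply, Fin.sum_univ_two]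
      simp [U]
      omega
  have h3 : ∀ e : ℤ, ∃ Y : Matrix (Fin 2) (Fin 2) ℤ, (U ^ e).val - 1 = (3 : ℤ) • Y := by
    have hmul : ∀ V V' : Matrix (Fin 2) (Fin 2) ℤ, (∃ Y, V - 1 = (3 : ℤ) • Y) →
        (∃ Y, V' - 1 = (3 : ℤ) • Y) → ∃ Y, V * V' - 1 = (3 : ℤ) • Y := by
      rintro V V' ⟨Y, hY⟩ ⟨Z, hZ⟩
      refine ⟨Y * V' + Z, ?_⟩
      rw [smul_add, ← hZ, ← smul_mul_assoc, ← hY]; noncomm_ring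
    intro e
    induction e using Int.induction_on with
    | zero => exact ⟨0, by simp⟩
    | succ n ih =>
      rw [zpow_add_one, Units.val_mul]
      refine hmul _ _ ih ⟨!![0, 1; 1, 3], ?_⟩
      simp only [U]; decide
    | pred n ih =>
      rw [zpow_sub_one, Units.val_mul]
      refine hmul _ _ ih ⟨!![3, -1; -1, 0], ?_⟩
      simp only [U]; decide
  obtain ⟨ρ, hρ, hρ3⟩ := hm_rep b (fun x' e => if x' = x then (U ^ e).val else 1)
    (by intro x'; simp) (by
      intro x' e e'
      by_cases h : x' = x
      · simp [h, zpow_add]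
      · simp [h]) (by
      intro x' e
      by_cases h : x' = x
      · simpa [h] using h3 e
      · exact ⟨0, by simp [h]⟩)
  refine ⟨Fin 2, inferInstance, inferInstance, ρ, hρ3, ?_, ?_⟩
  · intro a ha
    obtain ⟨L, hL, rfl⟩ := b.genA a ha
    rw [hρ]
    have : (L.map fun p => if p.1 = x then (U ^ p.2).val else 1).prod = 1 := by
      apply List.prod_eq_one
      intro M hM
      obtain ⟨p, hp, rfl⟩ := List.mem_map.1 hM
      rw [if_neg]
      rintro rfl
      exact hx (hL p hp)
    rw [this, Matrix.trace_one]
  · rw [hρ]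
    simp only [List.map_cons, List.map_nil, List.prod_cons, List.prod_nil, mul_one, if_true,
      Matrix.trace_fin_two, Fintype.card_fin]
    obtain ⟨n, hn⟩ : ∃ n : ℕ, e = (n + 1 : ℕ) ∨ e = -((n + 1 : ℕ) : ℤ) := by
      refine ⟨e.natAbs - 1, ?_⟩
      omega
    rcases hn with rfl | rfl
    · rw [zpow_natCast]
      have := hpos n
      omega
    · rw [zpow_neg, ← inv_zpow, zpow_natCast]
      have := hneg n
      omega

/-- Reduced syllable lists. -/
def HmRed {X : Type} (K : List (X × ℤ)) : Prop :=
  (∀ p ∈ K, p.2 ≠ 0) ∧ K.IsChain (fun p q => p.1 ≠ q.1)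

section
variable {F : Type} [Group F] {X : Type} (v : X → F)

lemma hmW_cons (p : X × ℤ) (K : List (X × ℤ)) : hmW v (p :: K) = v p.1 ^ p.2 * hmW v K := by
  simp [hmW]

lemma hmW_nil : hmW v [] = 1 := by simp [hmW]

lemma hmW_append (K L : List (X × ℤ)) : hmW v (K ++ L) = hmW v K * hmW v L := by
  simp [hmW]

/-- The inverse syllable list. -/
def hmInv (K : List (X × ℤ)) : List (X × ℤ) := (K.map fun p => (p.1, -p.2)).reverse

lemma hmW_inv (K : List (X × ℤ)) : hmW v (hmInv K) = (hmW v K)⁻¹ := by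
  induction K with
  | nil => simp [hmW, hmInv]
  | cons p K ih =>
    have : hmInv (p :: K) = hmInv K ++ [(p.1, -p.2)] := by simp [hmInv]
    rw [this, hmW_append, ih, hmW_cons, hmW_cons, hmW_nil]
    simp

lemma hm_shorten (K : List (X × ℤ)) (hK : ¬ HmRed K) :
    ∃ K' : List (X × ℤ), K'.length < K.length ∧ hmW v K' = hmW v K ∧
      ∀ S : Set X, (∀ p ∈ K, p.1 ∈ S) → ∀ p ∈ K', p.1 ∈ S := by
  induction K with
  | nil => exact absurd ⟨by simp, by simp⟩ hK
  | cons p K ih =>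
    by_cases h0 : p.2 = 0
    · exact ⟨K, by simp, by rw [hmW_cons, h0]; simp,
        fun S h q hq => h q (List.mem_cons_of_mem _ hq)⟩
    by_cases hr : HmRed K
    · cases K with
      | nil =>
        exact absurd ⟨by simpa using h0, by simp⟩ hK
      | cons q K =>
        by_cases hpq : p.1 = q.1
        · refine ⟨(p.1, p.2 + q.2) :: K, by simp, ?_, ?_⟩
          · rw [hmW_cons, hmW_cons, hmW_cons, ← hpq, zpow_add, mul_assoc]
          · intro S h r hr
            rcases List.mem_cons.1 hr with rfl | hr
            · exact h p (by simp)
            · exact h r (by simp [hr])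
        · refine absurd ⟨?_, ?_⟩ hK
          · intro r hr'
            rcases List.mem_cons.1 hr' with rfl | hr'
            · exact h0
            · exact hr.1 r hr'
          · rw [List.isChain_cons_cons]; exact ⟨hpq, hr.2⟩
    · obtain ⟨K', h1, h2, h3⟩ := ih hr
      refine ⟨p :: K', by simpa using h1, by rw [hmW_cons, hmW_cons, h2], ?_⟩
      intro S h r hr
      rcases List.mem_cons.1 hr with rfl | hr
      · exact h r (by simp)
      · exact h3 S (fun q hq => h q (List.mem_cons_of_mem _ hq)) r hr

lemma hm_reduce (n : ℕ) : ∀ K : List (X × ℤ), K.length ≤ n →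
    ∃ K' : List (X × ℤ), HmRed K' ∧ hmW v K' = hmW v K ∧
      ∀ S : Set X, (∀ p ∈ K, p.1 ∈ S) → ∀ p ∈ K', p.1 ∈ S := by
  induction n with
  | zero =>
    intro K hK
    have : K = [] := List.length_eq_zero_iff.1 (by omega)
    subst this
    exact ⟨[], ⟨by simp, by simp⟩, rfl, fun S h => h⟩
  | succ n ih =>
    intro K hK
    by_cases hr : HmRed K
    · exact ⟨K, hr, rfl, fun S h => h⟩
    · obtain ⟨K', h1, h2, h3⟩ := hm_shorten v K hr
      obtain ⟨K'', h4, h5, h6⟩ := ih K' (by omega)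
      exact ⟨K'', h4, h5.trans h2, fun S h => h6 S (h3 S h)⟩
end

section
variable {F : Type} [Group F] {A : Subgroup F} {X : Type} (b : HmBasis A X)

lemma HmBad.of_conj {g x : F} (h : HmBad A (g * x * g⁻¹)) : HmBad A x := by
  obtain ⟨ι, i1, i2, ρ, h1, h2, h3⟩ := h
  refine ⟨ι, i1, i2, ρ, h1, h2, ?_⟩
  have e : ρ g⁻¹ * ρ g = 1 := by rw [← map_mul, inv_mul_cancel, map_one]
  rwa [map_mul, map_mul, Matrix.trace_mul_comm, ← mul_assoc, e, one_mul] at h3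

include b in
lemma hmW_memA (K : List (X × ℤ)) (hK : ∀ p ∈ K, p.1 ∈ b.S) : hmW b.v K ∈ A := by
  apply Subgroup.list_prod_mem
  intro x hx
  obtain ⟨p, hp, rfl⟩ := List.mem_map.1 hx
  exact Subgroup.zpow_mem _ (b.memA _ (hK p hp)) _

lemma hm_bad_long' (K : List (X × ℤ)) (h2 : 2 ≤ K.length) (hr : HmRed K)
    (hcyc : ∀ x ∈ K.getLast?, ∀ y ∈ K.head?, x.1 ≠ y.1)
    (hS : ∃ p ∈ K, p.1 ∉ b.S) : HmBad A (hmW b.v K) := by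
  refine hm_bad_long b K h2 hr.1 ?_ ?_ hS
  · intro m h
    exact List.isChain_iff_getElem.1 hr.2 m h
  · refine hcyc _ ?_ _ ?_
    · rw [List.getLast?_eq_getElem?, List.getElem?_eq_getElem (by omega)]; simp
    · rw [List.head?_eq_getElem?, List.getElem?_eq_getElem (by omega)]; simp

include b in
lemma hm_bad_or (n : ℕ) : ∀ K : List (X × ℤ), K.length ≤ n →
    HmBad A (hmW b.v K) ∨ ∃ g, ∃ a ∈ A, hmW b.v K = g * a * g⁻¹ := by
  induction n with
  | zero =>
    intro K hK
    have : K = [] := List.length_eq_zero_iff.1 (by omega)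
    subst this
    exact Or.inr ⟨1, 1, A.one_mem, by simp [hmW]⟩
  | succ n ih =>
    intro K hK
    by_cases hr : HmRed K
    swap
    · obtain ⟨K', h1, h2, _⟩ := hm_shorten b.v K hr
      rw [← h2]; exact ih K' (by omega)
    by_cases hS : ∀ p ∈ K, p.1 ∈ b.S
    · exact Or.inr ⟨1, _, hmW_memA b K hS, by simp⟩
    push Not at hS
    by_cases h1 : K.length ≤ 1
    · obtain ⟨p, hp, hpS⟩ := hS
      have hKp : K = [p] := by
        match K, h1, hp with
        | [q], _, hp => rw [List.mem_singleton.1 hp]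
      left
      rw [hKp]
      exact hm_bad_short b p.1 p.2 (hr.1 p hp) hpS
    by_cases hcyc : ∀ x ∈ K.getLast?, ∀ y ∈ K.head?, x.1 ≠ y.1
    · exact Or.inl (hm_bad_long' b K (by omega) hr hcyc hS)
    · cases K with
      | nil => simp at h1
      | cons p K =>
        rcases List.eq_nil_or_concat K with rfl | ⟨M, q, rfl⟩
        · simp at h1
        · rw [List.concat_eq_append] at *
          have hqp : q.1 = p.1 := by
            by_contra hne
            apply hcyc
            intro x hx y hy
            rw [← List.cons_append, List.getLast?_append] at hx
            simp at hx hy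
            subst hx; subst hy; exact hne
          have e : hmW b.v (p :: (M ++ [q])) =
              (b.v p.1 ^ q.2)⁻¹ * hmW b.v ((p.1, q.2 + p.2) :: M) * (b.v p.1 ^ q.2)⁻¹⁻¹ := by
            simp only [hmW_cons, hmW_append, hmW_nil, hqp, zpow_add]
            group
          have := ih ((p.1, q.2 + p.2) :: M) (by simp at hK ⊢; omega)
          rcases this with h | ⟨g, a, ha, h⟩
          · left
            refine HmBad.of_conj (g := b.v p.1 ^ q.2) ?_
            rw [e]
            convert h using 1
            group
          · right
            refine ⟨(b.v p.1 ^ q.2)⁻¹ * g, a, ha, ?_⟩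
            rw [e, h]; group

lemma hm_red_inv (K : List (X × ℤ)) (hr : HmRed K) : HmRed (hmInv K) := by
  refine ⟨?_, ?_⟩
  · intro p hp
    simp only [hmInv, List.mem_reverse, List.mem_map] at hp
    obtain ⟨q, hq, rfl⟩ := hp
    simpa using hr.1 q hq
  · rw [hmInv, List.isChain_reverse, List.isChain_map]
    exact hr.2.imp fun _ _ h => h.symm

include b in
lemma hm_bad_mul (n : ℕ) : ∀ K : List (X × ℤ), K.length ≤ n → hmW b.v K ∉ A →
    ∀ a ∈ A, a ≠ 1 → ∀ c ∈ A, c ≠ 1 → HmBad A (a * (hmW b.v K * c * (hmW b.v K)⁻¹)) := by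
  induction n with
  | zero =>
    intro K hK hn
    have : K = [] := List.length_eq_zero_iff.1 (by omega)
    subst this
    exact absurd (by simp [hmW]) hn
  | succ n ih =>
    intro K hK hn a ha ha1 c hc hc1
    by_cases hr : HmRed K
    swap
    · obtain ⟨K', h1, h2, _⟩ := hm_shorten b.v K hr
      rw [← h2] at hn ⊢; exact ih K' (by omega) hn a ha ha1 c hc hc1
    by_cases hp : ∃ p K1, K = p :: K1 ∧ p.1 ∈ b.S
    · obtain ⟨p, K1, rfl, hpS⟩ := hp
      have hz : b.v p.1 ^ p.2 ∈ A := A.zpow_mem (b.memA _ hpS) _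
      rw [hmW_cons] at hn ⊢
      generalize b.v p.1 ^ p.2 = z at *
      have := ih K1 (by simp at hK; omega) (fun h => hn (A.mul_mem hz h)) (z⁻¹ * a * z)
        (A.mul_mem (A.mul_mem (A.inv_mem hz) ha) hz)
        (fun h => ha1 (by
          have : a = z * (z⁻¹ * a * z) * z⁻¹ := by group
          rw [this, h]; group)) c hc hc1
      refine HmBad.of_conj (g := z⁻¹) ?_
      convert this using 1
      group
    by_cases hq : ∃ q K1, K = K1 ++ [q] ∧ q.1 ∈ b.S
    · obtain ⟨q, K1, rfl, hqS⟩ := hq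
      have hz : b.v q.1 ^ q.2 ∈ A := A.zpow_mem (b.memA _ hqS) _
      rw [hmW_append, hmW_cons, hmW_nil, mul_one] at hn ⊢
      generalize b.v q.1 ^ q.2 = z at *
      have := ih K1 (by simp at hK; omega) (fun h => hn (A.mul_mem h hz)) a ha ha1 (z * c * z⁻¹)
        (A.mul_mem (A.mul_mem hz hc) (A.inv_mem hz))
        (fun h => hc1 (by
          have : c = z⁻¹ * (z * c * z⁻¹) * z := by group
          rw [this, h]; group))
      convert this using 1
      group
    have hK0 : K ≠ [] := by rintro rfl; exact hn (by simp [hmW])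
    obtain ⟨p, K1, hpK⟩ := List.exists_cons_of_ne_nil hK0
    have hpS : p.1 ∉ b.S := fun h => hp ⟨p, K1, hpK, h⟩
    obtain ⟨K2, q, hqK⟩ := (List.eq_nil_or_concat K).resolve_left hK0
    rw [List.concat_eq_append] at hqK
    have hqS : q.1 ∉ b.S := fun h => hq ⟨q, K2, hqK, h⟩
    have hhead : K.head? = some p := by rw [hpK]; rfl
    have hlast : K.getLast? = some q := by rw [hqK]; simp
    have nf : ∀ a ∈ A, a ≠ 1 → ∃ L : List (X × ℤ), HmRed L ∧ (∀ p ∈ L, p.1 ∈ b.S) ∧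
        hmW b.v L = a ∧ L ≠ [] := by
      intro a ha ha1
      obtain ⟨L, hL, rfl⟩ := b.genA a ha
      obtain ⟨L', h1, h2, h3⟩ := hm_reduce b.v L.length L le_rfl
      refine ⟨L', h1, h3 _ hL, h2, ?_⟩
      rintro rfl
      exact ha1 (by rw [← h2, hmW_nil])
    obtain ⟨L, hL, hLS, rfl, hL0⟩ := nf a ha ha1
    obtain ⟨M, hM, hMS, rfl, hM0⟩ := nf c hc hc1
    have hKi := hm_red_inv K hr
    have hihead : (hmInv K).head? = some (q.1, -q.2) := by
      simp [hmInv, List.head?_reverse, List.getLast?_map, hlast]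
    have hilast : (hmInv K).getLast? = some (p.1, -p.2) := by
      simp [hmInv, List.getLast?_reverse, List.head?_map, hhead]
    have e : hmW b.v L * (hmW b.v K * hmW b.v M * (hmW b.v K)⁻¹) =
        hmW b.v (L ++ (K ++ (M ++ hmInv K))) := by
      simp only [hmW_append, hmW_inv, mul_assoc]
    have hne : ∀ {x y : X}, x ∈ b.S → y ∉ b.S → x ≠ y := by
      rintro x y hx hy rfl; exact hy hx
    rw [e]
    refine hm_bad_long' b _ ?_ ⟨?_, ?_⟩ ?_ ?_
    · have := List.length_pos_of_ne_nil hK0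
      have := List.length_pos_of_ne_nil hL0
      simp only [List.length_append]; omega
    · intro r hr'
      simp only [List.mem_append] at hr'
      rcases hr' with h | h | h | h
      · exact hL.1 r h
      · exact hr.1 r h
      · exact hM.1 r h
      · exact hKi.1 r h
    · rw [List.isChain_append, List.isChain_append, List.isChain_append]
      refine ⟨hL.2, ⟨hr.2, ⟨hM.2, hKi.2, ?_⟩, ?_⟩, ?_⟩
      · intro x hx y hy
        rw [hihead] at hy
        simp at hy; subst hy
        exact hne (hMS x (List.mem_of_getLast? hx)) hqS
      · intro x hx y hy
        rw [hlast] at hx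
        simp at hx; subst hx
        obtain ⟨m, M', rfl⟩ := List.exists_cons_of_ne_nil hM0
        simp at hy; subst hy
        exact (hne (hMS _ (by simp)) hqS).symm
      · intro x hx y hy
        rw [List.head?_append, hhead] at hy
        simp at hy; subst hy
        exact hne (hLS x (List.mem_of_getLast? hx)) hpS
    · intro x hx y hy
      rw [List.getLast?_append, List.getLast?_append, List.getLast?_append, hilast] at hx
      simp at hx; subst hx
      obtain ⟨m, M', rfl⟩ := List.exists_cons_of_ne_nil hL0
      simp at hy; subst hy
      exact (hne (hLS _ (by simp)) hpS).symm
    · exact ⟨p, by simp [hpK], hpS⟩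

include b in
/-- A subgroup none of whose elements is bad is conjugate into `A`. -/
lemma hm_subconj (B : Subgroup F) (hB : ∀ x ∈ B, ¬ HmBad A x) :
    ∃ y, ∀ x ∈ B, y⁻¹ * x * y ∈ A := by
  have hc : ∀ x ∈ B, ∃ g, ∃ a ∈ A, x = g * a * g⁻¹ := by
    intro x hx
    obtain ⟨K, rfl⟩ := b.gen x
    exact (hm_bad_or b _ K le_rfl).resolve_left (hB _ hx)
  by_cases h1 : ∀ x ∈ B, x = 1
  · exact ⟨1, fun x hx => by rw [h1 x hx]; simp⟩
  push Not at h1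
  obtain ⟨x1, hx1, hne⟩ := h1
  obtain ⟨y, a1, ha1, rfl⟩ := hc x1 hx1
  refine ⟨y, ?_⟩
  intro x hx
  obtain ⟨h, a, ha, rfl⟩ := hc x hx
  by_cases ha0 : a = 1
  · subst ha0; simp
  have ha10 : a1 ≠ 1 := by rintro rfl; simp at hne
  by_cases hg : y⁻¹ * h ∈ A
  · have : y⁻¹ * (h * a * h⁻¹) * y = (y⁻¹ * h) * a * (y⁻¹ * h)⁻¹ := by group
    rw [this]
    exact A.mul_mem (A.mul_mem hg ha) (A.inv_mem hg)
  · exfalso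
    obtain ⟨K, hK⟩ := b.gen (y⁻¹ * h)
    rw [hK] at hg
    have := hm_bad_mul b _ K le_rfl hg a1 ha1 ha10 a ha ha0
    rw [← hK] at this
    refine hB _ (B.mul_mem hx1 hx) (HmBad.of_conj (g := y⁻¹) ?_)
    convert this using 1
    group

include b in
lemma hm_malnormal (w : F) (h : ∀ a ∈ A, w⁻¹ * a * w ∈ A) (hA : A ≠ ⊥) : w ∈ A := by
  obtain ⟨⟨a, ha⟩, hne⟩ := Subgroup.ne_bot_iff_exists_ne_one.1 hA
  have ha1 : a ≠ 1 := fun h' => hne (Subtype.ext h')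
  by_contra hw
  obtain ⟨K, hK⟩ := b.gen w
  rw [hK] at hw
  have := hm_bad_mul b _ K le_rfl hw a ha ha1 (w⁻¹ * a * w) (h a ha) (fun h' => ha1 (by
    have : a = w * (w⁻¹ * a * w) * w⁻¹ := by group
    rw [this, h']; group))
  rw [← hK] at this
  have e : a * (w * (w⁻¹ * a * w) * w⁻¹) = a * a := by group
  rw [e] at this
  obtain ⟨ι, i1, i2, ρ, h1, h2, h3⟩ := this
  exact h3 (h2 _ (A.mul_mem ha ha))

end

/-- Existence of an adapted basis. -/
lemma hm_basis {N : ℕ} (A : Subgroup (FreeGroup (Fin N))) (hA : IsFreeFactor A) :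
    ∃ X : Type, Nonempty (HmBasis A X) := by
  obtain ⟨B, hB⟩ := hA
  let e := MulEquiv.ofBijective (Monoid.Coprod.lift A.subtype B.subtype) hB
  have hgen : ∀ (X Y : Type) (C : Subgroup (FreeGroup (Fin N))) (bs : FreeGroupBasis Y C)
      (i : Y → X) (v : X → FreeGroup (Fin N)), (∀ y, v (i y) = bs y) →
      ∀ c ∈ C, ∃ K : List (X × ℤ), (∀ p ∈ K, p.1 ∈ Set.range i) ∧ c = hmW v K := by
    intro X Y C bs i v hv c hc
    have : ∀ w : FreeGroup Y, ∃ K : List (X × ℤ), (∀ p ∈ K, p.1 ∈ Set.range i) ∧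
        ((bs.repr.symm w : C) : FreeGroup (Fin N)) = hmW v K := by
      intro w
      induction w using FreeGroup.induction_on with
      | C1 => exact ⟨[], by simp, by simp [hmW]⟩
      | of y => exact ⟨[(i y, 1)], by simp, by simp [hmW, hv]; rfl⟩
      | inv_of y _ => exact ⟨[(i y, -1)], by simp, by simp [hmW, hv]; rfl⟩
      | mul x y hx hy =>
        obtain ⟨K, h1, h2⟩ := hx
        obtain ⟨L, h3, h4⟩ := hy
        refine ⟨K ++ L, ?_, by rw [map_mul, Subgroup.coe_mul, h2, h4, hmW_append]⟩
        intro p hp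
        rcases List.mem_append.1 hp with h | h
        · exact h1 p h
        · exact h3 p h
    obtain ⟨K, h1, h2⟩ := this (bs.repr ⟨c, hc⟩)
    exact ⟨K, h1, by rw [← h2]; simp⟩
  let bA := IsFreeGroup.basis A
  let bB := IsFreeGroup.basis B
  let v : IsFreeGroup.Generators A ⊕ IsFreeGroup.Generators B → FreeGroup (Fin N) :=
    Sum.elim (fun x => bA x) (fun x => bB x)
  refine ⟨IsFreeGroup.Generators A ⊕ IsFreeGroup.Generators B, ⟨⟨v, Set.range Sum.inl, ?_, ?_, ?_, ?_⟩⟩⟩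
  · intro g
    obtain ⟨w, rfl⟩ := hB.2 g
    induction w using Monoid.Coprod.induction_on with
    | inl a =>
      obtain ⟨K, _, h⟩ := hgen _ _ A bA Sum.inl v (fun y => rfl) a a.2
      exact ⟨K, by simpa using h⟩
    | inr c =>
      obtain ⟨K, _, h⟩ := hgen _ _ B bB Sum.inr v (fun y => rfl) c c.2
      exact ⟨K, by simpa using h⟩
    | mul x y hx hy =>
      obtain ⟨K, hK⟩ := hx
      obtain ⟨L, hL⟩ := hy
      exact ⟨K ++ L, by rw [map_mul, hK, hL, hmW_append]⟩
  · exact hgen _ _ A bA Sum.inl v (fun y => rfl)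
  · rintro _ ⟨x, rfl⟩
    exact (bA x).2
  · intro H _ f
    refine ⟨(Monoid.Coprod.lift (bA.lift (f ∘ Sum.inl)) (bB.lift (f ∘ Sum.inr))).comp
      e.symm.toMonoidHom, ?_⟩
    rintro (x | x)
    · have : e.symm (v (Sum.inl x)) = Monoid.Coprod.inl (bA x) := by
        rw [MulEquiv.symm_apply_eq]; simp [e, v]
      simp [this]
    · have : e.symm (v (Sum.inr x)) = Monoid.Coprod.inr (bB x) := by
        rw [MulEquiv.symm_apply_eq]; simp [e, v]
      simp [this]

lemma hm_half (N : ℕ) (Φ : MulAut (FreeGroup (Fin N)))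
    (hIA : (piMod3 N).comp Φ.toMonoidHom = piMod3 N)
    (A : Subgroup (FreeGroup (Fin N))) {X : Type} (b : HmBasis A X) (n : ℕ) (hn : 1 ≤ n)
    (x : FreeGroup (Fin N)) (hx : ∀ a ∈ A, x⁻¹ * (Φ ^ n) a * x ∈ A) :
    ∃ y, ∀ a ∈ A, y⁻¹ * Φ a * y ∈ A := by
  have hit : ∀ i : ℕ, ∃ z : FreeGroup (Fin N), ∀ a ∈ A, z⁻¹ * (Φ ^ (n * i)) a * z ∈ A := by
    intro i
    induction i with
    | zero => exact ⟨1, fun a ha => by simpa using ha⟩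
    | succ i ih =>
      obtain ⟨z, hz⟩ := ih
      refine ⟨(Φ ^ n) z * x, fun a ha => ?_⟩
      have := hx _ (hz a ha)
      rw [map_mul, map_mul, map_inv] at this
      rw [mul_add, mul_one, add_comm, pow_add, MulAut.mul_apply]
      convert this using 1
      group
  obtain ⟨y, hy⟩ := hm_subconj b (A.map Φ.toMonoidHom) (by
    rintro _ ⟨a, ha, rfl⟩ ⟨ι, i1, i2, ρ, h1, h2, h3⟩
    refine h3 (hm_trace N Φ hIA ρ h1 _ rfl n hn a ?_)
    intro i
    obtain ⟨z, hz⟩ := hit i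
    rw [← h2 _ (hz a ha), map_mul, map_mul, Matrix.trace_mul_comm, ← mul_assoc, ← map_mul,
      mul_inv_cancel, map_one, one_mul])
  exact ⟨y, fun a ha => hy _ ⟨a, ha, rfl⟩⟩

/-- (Handel–Mosher) Every periodic conjugacy class of a free factor under an
element of `IA_N(ℤ/3)` is fixed: if `π ∘ Φ = π`, `A` is a free factor and
`Φ^n(A) = x A x⁻¹` for some `n ≥ 1` and some `x`, then `Φ(A) = y A y⁻¹` for
some `y`. -/
theorem statement_8 (N : ℕ) (hN : 1 ≤ N)
    (Φ : MulAut (FreeGroup (Fin N)))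
    (hIA : (piMod3 N).comp Φ.toMonoidHom = piMod3 N)
    (A : Subgroup (FreeGroup (Fin N)))
    (hA : IsFreeFactor A)
    (hper : ∃ n : ℕ, 1 ≤ n ∧ ∃ x : FreeGroup (Fin N),
        A.map (Φ ^ n).toMonoidHom = conjSubgroup x A) :
    ∃ y : FreeGroup (Fin N), A.map Φ.toMonoidHom = conjSubgroup y A := by
  obtain ⟨n, hn, x, hx⟩ := hper
  obtain ⟨X, ⟨b⟩⟩ := hm_basis A hA
  by_cases hA0 : A = ⊥
  · subst hA0
    exact ⟨1, by simp [conjSubgroup]⟩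
  have hx1 : ∀ a ∈ A, x⁻¹ * (Φ ^ n) a * x ∈ A := by
    intro a ha
    have : (Φ ^ n) a ∈ conjSubgroup x A := by rw [← hx]; exact ⟨a, ha, rfl⟩
    obtain ⟨c, hc, hce⟩ := this
    rw [← hce]
    have e : x⁻¹ * ((MulAut.conj x).toMonoidHom c) * x = c := by
      simp [MulAut.conj_apply, mul_assoc]
    rw [e]; exact hc
  have hIA' : (piMod3 N).comp (Φ⁻¹ : MulAut (FreeGroup (Fin N))).toMonoidHom = piMod3 N := by
    ext1 i
    have := DFunLike.congr_fun hIA (Φ⁻¹ (FreeGroup.of i))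
    rw [← show Φ (Φ⁻¹ (FreeGroup.of i)) = FreeGroup.of i from MulAut.apply_inv_self _ _ _]
    simpa using this.symm
  have hx2 : ∀ a ∈ A, ((Φ⁻¹ ^ n) x⁻¹)⁻¹ * (Φ⁻¹ ^ n) a * (Φ⁻¹ ^ n) x⁻¹ ∈ A := by
    intro a ha
    have : x * a * x⁻¹ ∈ A.map (Φ ^ n).toMonoidHom := by
      rw [hx]; exact ⟨a, ha, rfl⟩
    obtain ⟨c, hc, hce⟩ := this
    have e : (Φ⁻¹ ^ n) (x * a * x⁻¹) = c := by
      rw [← hce, inv_pow]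
      exact MulAut.inv_apply_self _ _ _
    rw [← map_inv, inv_inv, ← map_mul, ← map_mul, e]
    exact hc
  obtain ⟨y, hy⟩ := hm_half N Φ hIA A b n hn x hx1
  obtain ⟨z, hz⟩ := hm_half N Φ⁻¹ hIA' A b n hn _ hx2
  have hw : Φ z * y ∈ A := by
    refine hm_malnormal b _ ?_ hA0
    intro a ha
    have := hy _ (hz a ha)
    rw [map_mul, map_mul, map_inv, MulAut.apply_inv_self] at this
    convert this using 1
    group
  refine ⟨y, le_antisymm ?_ ?_⟩
  · rintro _ ⟨a, ha, rfl⟩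
    refine ⟨_, hy a ha, ?_⟩
    simp [MulAut.conj_apply, mul_assoc]
  · rintro _ ⟨a, ha, rfl⟩
    have h1 := A.mul_mem (A.mul_mem hw ha) (A.inv_mem hw)
    refine ⟨_, hz _ h1, ?_⟩
    simp [MulAut.conj_apply, mul_assoc]
end
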